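/- Let p be prime and A ⊆ 𝔽_p with |A| ≤ p^{2/3}, E⁺(A) ≤ |A|^{3−c} and Ē^×(A) ≤ |A|^{3−c} for some constant c > 0. Then C₅(A) − 2|A|⁶ ≪ |A|^{6−c/6} log^{5/6}|A| up to a factor polylogarithmic in |A| (i.e. C₅(A) − 2|A|⁶ ≲ |A|^{6−c/6} log^{5/6}|A|). -/

import Mathlib

open scoped Classical Pointwise

noncomputable section

/-- Number of collinear `k`-tuples of points of `A × B`. -/
def Ctuples (F : Type*) [Field F] (k : ℕ) (A B : Finset F) : ℕ :=
  ((Fintype.piFinset fun _ : Fin k => A ×ˢ B).filter fun f => Collinear F (Set.range f)).card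

/-- Additive energy of two finite sets. -/
def addE (F : Type*) [Field F] (A B : Finset F) : ℕ :=
  (((A ×ˢ A) ×ˢ B ×ˢ B).filter fun q => q.1.1 - q.2.1 = q.1.2 - q.2.2).card

/-- Multiplicative energy of two finite sets. -/
def mulE (F : Type*) [Field F] (A B : Finset F) : ℕ :=
  (((A ×ˢ A) ×ˢ B ×ˢ B).filter fun q => q.1.1 * q.2.2 = q.1.2 * q.2.1).card

/-- `max_s E^×(A - s)`. -/
def mulEbar (F : Type*) [Field F] (A : Finset F) : ℕ :=
  ⨆ s : F, mulE F (A.image fun a => a - s) (A.image fun a => a - s)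

def repSub (F : Type*) [Field F] (A B : Finset F) (x : F) : ℕ :=
  ((A ×ˢ B).filter fun q => q.1 - q.2 = x).card

def addEk (F : Type*) [Field F] (k : ℕ) (A : Finset F) : ℕ :=
  ∑ x ∈ A - A, repSub F A A x ^ k

def repDiv (F : Type*) [Field F] (A B : Finset F) (x : F) : ℕ :=
  ((A ×ˢ B).filter fun q => q.2 ≠ 0 ∧ q.1 / q.2 = x).card

def mulEk (F : Type*) [Field F] (k : ℕ) (A : Finset F) : ℕ :=
  ∑ x ∈ A / A, repDiv F A A x ^ k

def mulEkbar (F : Type*) [Field F] (k : ℕ) (A : Finset F) : ℕ :=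
  ⨆ s : F, mulEk F k (A.image fun a => a - s)

/-- Number of points of `A × B` on the graph of `x ↦ l.1 * x + l.2`. -/
def nPts {F : Type*} [Field F] (A B : Finset F) (l : F × F) : ℕ :=
  ((A ×ˢ B).filter fun q => q.2 = l.1 * q.1 + l.2).card

/-- τ-rich lines of `𝓛`. -/
def Lrich {F : Type*} [Field F] (A B : Finset F) (L : Finset (F × F)) (τ : ℝ) : Finset (F × F) :=
  L.filter fun l => τ ≤ (nPts A B l : ℝ)

def affMap {F : Type*} [Field F] (l : F × F) : F → F := fun x => l.1 * x + l.2

def affInv {F : Type*} [Field F] (l : F × F) : F → F := fun x => (x - l.2) / l.1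

/-- alternating product `l₁ ∘ l₂⁻¹ ∘ l₃ ∘ l₄⁻¹ ∘ ⋯` in the affine group. -/
def altAff {F : Type*} [Field F] {k : ℕ} (a : Fin k → F × F) : F → F :=
  (List.ofFn fun i : Fin k => if (i : ℕ) % 2 = 0 then affMap (a i) else affInv (a i)).foldr
    (· ∘ ·) id

def TaffSet {F : Type*} [Field F] (k : ℕ) (L : Finset (F × F)) : ℕ :=
  (((Fintype.piFinset fun _ : Fin k => L) ×ˢ Fintype.piFinset fun _ : Fin k => L).filter
    fun q => altAff q.1 = altAff q.2).card

def affEnergy {F : Type*} [Field F] (L : Finset (F × F)) : ℕ :=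
  (((L ×ˢ L) ×ˢ L ×ˢ L).filter fun q =>
    affMap q.1.1 ∘ affInv q.1.2 = affMap q.2.1 ∘ affInv q.2.2).card

/-- incidences between `A × B` and the graphs of the maps in `L`. -/
def nInc {F : Type*} [Field F] (A B : Finset F) (L : Finset (F × F)) : ℕ :=
  (((A ×ˢ B) ×ˢ L).filter fun q => q.1.2 = q.2.1 * q.1.1 + q.2.2).card

/-- balanced function of `A ⊆ 𝔽_p`. -/
def balanced {p : ℕ} [NeZero p] (A : Finset (ZMod p)) : ZMod p → ℝ :=
  fun x => (if x ∈ A then 1 else 0) - (A.card : ℝ) / p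

def addEfun {p : ℕ} [NeZero p] (f : ZMod p → ℝ) : ℝ :=
  ∑ x, ∑ y, ∑ z, ∑ w, if x - y = z - w then f x * f y * f z * f w else 0

def mulEfun {p : ℕ} [NeZero p] (f : ZMod p → ℝ) : ℝ :=
  ∑ x, ∑ y, ∑ z, ∑ w, if x * w = z * y then f x * f y * f z * f w else 0

def mulEbarFun {p : ℕ} [NeZero p] (f : ZMod p → ℝ) : ℝ :=
  ⨆ s : ZMod p, mulEfun fun x => f (x + s)

/-- a line in the plane: `inl (a,b)` is `y = a x + b`, `inr c` is `x = c`. -/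
def onLine {F : Type*} [Field F] (l : (F × F) ⊕ F) (q : F × F) : Prop :=
  match l with
  | .inl ab => q.2 = ab.1 * q.1 + ab.2
  | .inr c => q.1 = c

def iLine {F : Type*} [Field F] (A B : Finset F) (l : (F × F) ⊕ F) : ℕ :=
  ((A ×ˢ B).filter fun q => onLine l q).card

def altSum {M : Type*} [AddCommGroup M] {k : ℕ} (x : Fin k → M) : M :=
  ∑ i : Fin k, if (i : ℕ) % 2 = 0 then x i else -x i

def TaddSet {M : Type*} [AddCommGroup M] (k : ℕ) (A : Finset M) : ℕ :=
  (((Fintype.piFinset fun _ : Fin k => A) ×ˢ Fintype.piFinset fun _ : Fin k => A).filter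
    fun q => altSum q.1 = altSum q.2).card

def TaddFun {p : ℕ} [NeZero p] (k : ℕ) (f : ZMod p → ℝ) : ℝ :=
  ∑ x : Fin k → ZMod p, ∑ y : Fin k → ZMod p,
    if altSum x = altSum y then (∏ i, f (x i)) * ∏ i, f (y i) else 0

def TaffFun {p : ℕ} [Fact p.Prime] (k : ℕ) (f : ZMod p × ZMod p → ℝ) : ℝ :=
  ∑ a ∈ Fintype.piFinset fun _ : Fin k => (Finset.univ.filter fun l : ZMod p × ZMod p => l.1 ≠ 0),
    ∑ b ∈ Fintype.piFinset fun _ : Fin k => (Finset.univ.filter fun l : ZMod p × ZMod p => l.1 ≠ 0),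
      if altAff a = altAff b then (∏ i, f (a i)) * ∏ i, f (b i) else 0

/-- `Ẽ^×_k (X, Y)`. -/
def tmulEk (F : Type*) [Field F] (k : ℕ) (X Y : Finset F) : ℕ :=
  (((Fintype.piFinset fun _ : Fin k => X.erase 0) ×ˢ
      Fintype.piFinset fun _ : Fin k => Y.erase 0).filter
    fun q => ∀ i j : Fin k, q.1 i * q.2 j = q.1 j * q.2 i).card

def addEkG {G : Type*} [AddCommGroup G] (k : ℕ) (A : Finset G) : ℕ :=
  ∑ x ∈ A - A, (((A ×ˢ A).filter fun q => q.1 - q.2 = x).card) ^ k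

end

section NullLines

open MvPolynomial

variable {K : Type*} [Field K]

/-- Restriction of a polynomial to the line `t ↦ (t, y + s t, w + s y + s² t)`, where
`u = (s, y, w)`. -/
noncomputable def restr (u : K × K × K) : MvPolynomial (Fin 3) K →ₐ[K] Polynomial K :=
  aeval ![Polynomial.X, Polynomial.C u.2.1 + Polynomial.C u.1 * Polynomial.X,
    Polynomial.C (u.2.2 + u.1 * u.2.1) + Polynomial.C (u.1 ^ 2) * Polynomial.X]

/-- The point with parameter `t` on the line encoded by `u`. -/
noncomputable def linePt (u : K × K × K) (t : K) : Fin 3 → K :=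
  ![t, u.2.1 + u.1 * t, u.2.2 + u.1 * u.2.1 + u.1 ^ 2 * t]

/-- The incidence condition for the lines encoded by `u` and `u'`. -/
def Cross {F : Type*} [Field F] (u u' : F × F × F) : Prop :=
  u'.2.2 - u.2.2 = u.1 * u'.2.1 - u'.1 * u.2.1

/-- The parameter of the meeting point of the lines encoded by `u` and `u'`. -/
noncomputable def meetT (u u' : K × K × K) : K := (u'.2.1 - u.2.1) / (u.1 - u'.1)

theorem Cross.symm {F : Type*} [Field F] {u u' : F × F × F} (h : Cross u u') : Cross u' u := by
  unfold Cross at *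
  linear_combination -h

theorem linePt_meetT {u u' : K × K × K} (h : Cross u u') (hs : u.1 ≠ u'.1) :
    linePt u (meetT u u') = linePt u' (meetT u u') := by
  have hs' : u.1 - u'.1 ≠ 0 := sub_ne_zero.2 hs
  have ht : meetT u u' * (u.1 - u'.1) = u'.2.1 - u.2.1 := div_mul_cancel₀ _ hs'
  unfold Cross at h
  funext i
  fin_cases i
  · simp [linePt]
  · simp only [linePt, Fin.mk_one, Matrix.cons_val_one, Matrix.cons_val_zero]
    linear_combination ht
  · simp only [linePt, Fin.reduceFinMk, Matrix.cons_val]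
    linear_combination (u.1 + u'.1) * ht - h

theorem cross_of_linePt_eq {u u' : K × K × K} {t : K} (h : linePt u t = linePt u' t) :
    Cross u u' := by
  have h1 := congrFun h 1
  have h2 := congrFun h 2
  simp only [linePt, Matrix.cons_val_one, Matrix.cons_val_zero, Matrix.cons_val] at h1 h2
  unfold Cross
  linear_combination (u.1 + u'.1) * h1 - h2

theorem eval_restr (u : K × K × K) (t : K) (f : MvPolynomial (Fin 3) K) :
    (restr u f).eval t = MvPolynomial.eval (linePt u t) f := by
  have : ((Polynomial.aeval t).comp (restr u)) f = (MvPolynomial.aeval (linePt u t)) f := by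
    congr 1
    apply MvPolynomial.algHom_ext
    intro i
    fin_cases i <;> simp [restr, linePt]
  simpa [Polynomial.coe_aeval_eq_eval, MvPolynomial.coe_aeval_eq_eval] using this

theorem natDegree_restr_le (u : K × K × K) (f : MvPolynomial (Fin 3) K) :
    (restr u f).natDegree ≤ f.totalDegree := by
  have := MvPolynomial.aeval_natDegree_le (F := f) (m := f.totalDegree) le_rfl
    ![Polynomial.X, Polynomial.C u.2.1 + Polynomial.C u.1 * Polynomial.X,
    Polynomial.C (u.2.2 + u.1 * u.2.1) + Polynomial.C (u.1 ^ 2) * Polynomial.X] (n := 1) (by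
      intro i
      fin_cases i
      · simp
      · simp only [Fin.mk_one, Matrix.cons_val_one, Matrix.cons_val_zero]; compute_degree
      · simp only [Fin.reduceFinMk, Matrix.cons_val]; compute_degree)
  simpa [restr] using this

theorem eval_eq_zero_of_restr {u : K × K × K} {f : MvPolynomial (Fin 3) K} (h : restr u f = 0)
    (t : K) : MvPolynomial.eval (linePt u t) f = 0 := by
  rw [← eval_restr, h, Polynomial.eval_zero]

theorem exists_separating_form {u u' : K × K × K} (h : u ≠ u') :
    ∃ l : MvPolynomial (Fin 3) K, l.totalDegree ≤ 1 ∧ restr u' l = 0 ∧ restr u l ≠ 0 := by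
  have hdeg : ∀ (i : Fin 3) (a b : K),
      (X i - C a - C b * X 0 : MvPolynomial (Fin 3) K).totalDegree ≤ 1 := by
    intro i a b
    refine (totalDegree_sub _ _).trans (max_le ((totalDegree_sub _ _).trans (max_le ?_ ?_)) ?_)
    · simp
    · simp
    · exact (totalDegree_mul _ _).trans (by simp)
  by_cases hsy : u.1 = u'.1 ∧ u.2.1 = u'.2.1
  · refine ⟨X 2 - C (u'.2.2 + u'.1 * u'.2.1) - C (u'.1 ^ 2) * X 0, hdeg _ _ _, ?_, ?_⟩
    · simp [restr, algHom_C]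
    · intro h0
      apply h
      have h1 := congrArg (Polynomial.eval 0) h0
      simp [restr, hsy.1, hsy.2] at h1
      exact Prod.ext hsy.1 (Prod.ext hsy.2 (by linear_combination h1))
  · refine ⟨X 1 - C u'.2.1 - C u'.1 * X 0, hdeg _ _ _, ?_, ?_⟩
    · simp [restr, algHom_C]
    · intro h0
      apply hsy
      have h1 := congrArg (Polynomial.eval 0) h0
      have h2 := congrArg (Polynomial.eval 1) h0
      simp [restr] at h1 h2
      exact ⟨by linear_combination h2 - h1, by linear_combination h1⟩

theorem exists_isolating_poly (T : Finset (K × K × K)) (u : K × K × K) :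
    ∃ P : MvPolynomial (Fin 3) K, P.totalDegree ≤ T.card ∧
      (∀ u' ∈ T, u' ≠ u → restr u' P = 0) ∧ restr u P ≠ 0 := by
  induction T using Finset.induction_on with
  | empty => exact ⟨1, by simp⟩
  | insert v T hv ih =>
    obtain ⟨P, h1, h2, h3⟩ := ih
    by_cases hvu : v = u
    · refine ⟨P, h1.trans (Finset.card_le_card (Finset.subset_insert _ _)), ?_, h3⟩
      intro u' hu' hne
      rcases Finset.mem_insert.1 hu' with rfl | hu'
      · exact absurd hvu hne
      · exact h2 u' hu' hne
    · obtain ⟨l, hl1, hl2, hl3⟩ := exists_separating_form (Ne.symm hvu)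
      refine ⟨P * l, ?_, ?_, ?_⟩
      · rw [Finset.card_insert_of_notMem hv]
        exact (totalDegree_mul _ _).trans (add_le_add h1 hl1)
      · intro u' hu' hne
        rw [map_mul]
        rcases Finset.mem_insert.1 hu' with rfl | hu'
        · rw [hl2, mul_zero]
        · rw [h2 u' hu' hne, zero_mul]
      · rw [map_mul]
        exact mul_ne_zero h3 hl3

theorem six_mul_card_degree_le (D : ℕ) :
    6 * Nat.card {n : Fin 3 →₀ ℕ | (n.sum fun _ e => e) ≤ D} = (D + 1) * (D + 2) * (D + 3) := by
  have hset : {n : Fin 3 →₀ ℕ | (n.sum fun _ e => e) ≤ D} =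

      (((Finset.range (D + 1)).biUnion fun k =>
        Finset.finsuppAntidiag (Finset.univ : Finset (Fin 3)) k : Finset (Fin 3 →₀ ℕ)) :
        Set (Fin 3 →₀ ℕ)) := by
    ext n
    simp [Finset.mem_finsuppAntidiag, Finsupp.sum_fintype]
  rw [hset, Nat.card_coe_set_eq, Set.ncard_coe_finset, Finset.card_biUnion]
  · have : ∀ k,
        (Finset.finsuppAntidiag (Finset.univ : Finset (Fin 3)) k).card = (k + 2).choose 2 := by
      intro k
      rw [Finset.card_finsuppAntidiag_nat_eq_choose]
      · simp
        rw [← Nat.choose_symm_add, add_comm]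
    simp only [this]
    clear this hset
    induction D with
    | zero => simp
    | succ D ih =>
      rw [Finset.sum_range_succ, mul_add, ih]
      have h2 : 2 * (D + 1 + 2).choose 2 = (D + 3) * (D + 2) := by
        have := Nat.add_one_mul_choose_eq (D + 2) 1
        simp at this
        linarith
      linear_combination 3 * h2
  · intro i _ j _ hij
    simp only [Function.onFun]
    rw [Finset.disjoint_left]
    intro n hn hn'
    rw [Finset.mem_finsuppAntidiag] at hn hn'
    exact hij (hn.1.symm.trans hn'.1)

theorem six_mul_finrank_restrictTotalDegree (D : ℕ) :
    6 * Module.finrank K (restrictTotalDegree (Fin 3) K D) = (D + 1) * (D + 2) * (D + 3) := by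
  rw [← six_mul_card_degree_le, restrictTotalDegree,
    Module.finrank_eq_nat_card_basis (basisRestrictSupport K _)]

end NullLines

section Bezout

open MvPolynomial

variable {K : Type*} [Field K]

theorem totalDegree_aeval_X_le (c : Polynomial K) :
    (Polynomial.aeval (X 0 : MvPolynomial (Fin 3) K) c).totalDegree ≤ c.natDegree := by
  rw [Polynomial.aeval_eq_sum_range]
  refine (totalDegree_finsetSum _ _).trans (Finset.sup_le fun i hi => ?_)
  refine (totalDegree_smul_le _ _).trans ?_
  rw [totalDegree_X_pow]
  exact Nat.lt_succ_iff.1 (Finset.mem_range.1 hi)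

theorem restr_aeval_X (u : K × K × K) (c : Polynomial K) :
    restr u (Polynomial.aeval (X 0 : MvPolynomial (Fin 3) K) c) = c := by
  rw [← Polynomial.aeval_algHom_apply]
  simp [restr]

theorem finrank_bezout_le {g h : MvPolynomial (Fin 3) K} (hg : Prime g) (hgh : ¬ g ∣ h)
    (T : Finset (K × K × K)) (hT : ∀ u ∈ T, restr u g = 0 ∧ restr u h = 0) (m : ℕ) :
    Module.finrank K (restrictTotalDegree (Fin 3) K (h.totalDegree + m)) +
      (Module.finrank K (restrictTotalDegree (Fin 3) K (g.totalDegree + m)) +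
        T.card * (g.totalDegree + h.totalDegree + m - T.card)) ≤
    Module.finrank K (restrictTotalDegree (Fin 3) K (g.totalDegree + h.totalDegree + m)) +
      Module.finrank K (restrictTotalDegree (Fin 3) K m) := by
  have hg0 : g ≠ 0 := hg.ne_zero
  have hh0 : h ≠ 0 := fun h0 => hgh (h0 ▸ dvd_zero g)
  set a := g.totalDegree with ha
  set b := h.totalDegree with hb
  choose P hP1 hP2 hP3 using fun u => exists_isolating_poly T u
  have hr0 : ∀ u : T, ∀ c : T → Polynomial K,
      restr u.1 (∑ i : T, Polynomial.aeval (X 0) (c i) * P i.1) = c u * restr u.1 (P u.1) := by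
    intro u c
    rw [map_sum, Finset.sum_eq_single u]
    · rw [map_mul, restr_aeval_X]
    · intro i _ hi
      rw [map_mul, hP2 i.1 u.1 u.2 (fun h => hi (Subtype.ext h.symm)), mul_zero]
    · simp
  let E := Polynomial.degreeLT K (a + b + m - T.card)
  let V := fun n => restrictTotalDegree (Fin 3) K n
  let Λ : (V (b + m) × V (a + m) × (T → E)) →ₗ[K] MvPolynomial (Fin 3) K :=
    { toFun := fun x => x.1.1 * g + x.2.1.1 * h +
        ∑ i : T, Polynomial.aeval (X 0) (x.2.2 i).1 * P i.1
      map_add' := by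
        intro x y
        simp only [Prod.fst_add, Prod.snd_add, Submodule.coe_add, Pi.add_apply, map_add, add_mul,
          Finset.sum_add_distrib]
        ring
      map_smul' := by
        intro r x
        simp only [Prod.smul_fst, Prod.smul_snd, Submodule.coe_smul, Pi.smul_apply, map_smul,
          smul_mul_assoc, RingHom.id_apply, smul_add, Finset.smul_sum] }
  have hΛ : ∀ x, Λ x = x.1.1 * g + x.2.1.1 * h +
        ∑ i : T, Polynomial.aeval (X 0) (x.2.2 i).1 * P i.1 := fun x => rfl
  have hrange : LinearMap.range Λ ≤ V (a + b + m) := by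
    rintro _ ⟨x, rfl⟩
    rw [hΛ]
    have h1 : x.1.1.totalDegree ≤ b + m := (mem_restrictTotalDegree _ _ _).1 x.1.2
    have h2 : x.2.1.1.totalDegree ≤ a + m := (mem_restrictTotalDegree _ _ _).1 x.2.1.2
    refine Submodule.add_mem _ (Submodule.add_mem _ ?_ ?_) (Submodule.sum_mem _ fun i _ => ?_)
    · rw [mem_restrictTotalDegree]
      exact (totalDegree_mul _ _).trans (by omega)
    · rw [mem_restrictTotalDegree]
      exact (totalDegree_mul _ _).trans (by omega)
    · rw [mem_restrictTotalDegree]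
      have h3 := Polynomial.mem_degreeLT.1 (x.2.2 i).2
      by_cases hx : (x.2.2 i).1 = 0
      · simp [hx]
      · rw [Polynomial.degree_eq_natDegree hx] at h3
        have h3' : (x.2.2 i).1.natDegree < a + b + m - T.card := by exact_mod_cast h3
        have h4 := hP1 i.1
        have h5 := totalDegree_aeval_X_le (x.2.2 i).1
        refine (totalDegree_mul _ _).trans ?_
        omega
  have hker0 : ∀ x, Λ x = 0 → x.2.2 = 0 ∧ x.1.1 * g + x.2.1.1 * h = 0 := by
    intro x hx
    rw [hΛ] at hx
    have hc : x.2.2 = 0 := by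
      funext u
      have h1 := congrArg (restr u.1) hx
      rw [map_add, map_add, map_mul, map_mul, (hT u.1 u.2).1, (hT u.1 u.2).2, mul_zero, mul_zero,
        zero_add, zero_add, hr0 u (fun i => (x.2.2 i).1), map_zero] at h1
      exact Subtype.ext ((mul_eq_zero.1 h1).resolve_right (hP3 u.1))
    refine ⟨hc, ?_⟩
    simpa [hc] using hx
  let π : LinearMap.ker Λ →ₗ[K] MvPolynomial (Fin 3) K :=
    ((V (a + m)).subtype ∘ₗ LinearMap.fst K _ _ ∘ₗ LinearMap.snd K _ _).domRestrict _
  have hπ : ∀ x : LinearMap.ker Λ, π x = x.1.2.1.1 := fun x => rfl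
  have hinj : Function.Injective π := by
    rw [injective_iff_map_eq_zero]
    intro x hx
    obtain ⟨hx1, hx2⟩ := hker0 x.1 (LinearMap.mem_ker.1 x.2)
    rw [hπ] at hx
    rw [hx, zero_mul, add_zero] at hx2
    have hx3 := (mul_eq_zero.1 hx2).resolve_right hg0
    exact Subtype.ext (Prod.ext (Subtype.ext hx3) (Prod.ext (Subtype.ext hx) hx1))
  have hπr : LinearMap.range π ≤ (V m).map (LinearMap.mulLeft K g) := by
    rintro _ ⟨x, rfl⟩
    rw [hπ]
    obtain ⟨-, hx2⟩ := hker0 x.1 (LinearMap.mem_ker.1 x.2)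
    have hd : g ∣ x.1.2.1.1 * h := by
      rw [← neg_eq_iff_add_eq_zero.2 hx2]
      exact (Dvd.intro_left _ rfl).neg_right
    obtain ⟨w, hw⟩ := (hg.dvd_or_dvd hd).resolve_right hgh
    rw [hw]
    refine ⟨w, ?_, rfl⟩
    simp only [V, SetLike.mem_coe, mem_restrictTotalDegree]
    by_cases hw0 : w = 0
    · simp [hw0]
    have h2 : x.1.2.1.1.totalDegree ≤ a + m := (mem_restrictTotalDegree _ _ _).1 x.1.2.1.2
    rw [hw, totalDegree_mul_of_isDomain hg0 hw0] at h2
    omega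
  have hkerdim : Module.finrank K (LinearMap.ker Λ) ≤ Module.finrank K (V m) := by
    rw [← LinearMap.finrank_range_of_inj hinj]
    exact (Submodule.finrank_mono hπr).trans (Submodule.finrank_map_le _ _)
  have hrdim : Module.finrank K (LinearMap.range Λ) ≤ Module.finrank K (V (a + b + m)) :=
    Submodule.finrank_mono hrange
  have hsum := LinearMap.finrank_range_add_finrank_ker Λ
  rw [Module.finrank_prod, Module.finrank_prod, Module.finrank_pi_fintype] at hsum
  have hE : Module.finrank K E = a + b + m - T.card := by
    rw [LinearEquiv.finrank_eq (Polynomial.degreeLTEquiv K _)]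
    simp
  simp only [hE, Finset.sum_const, Finset.card_univ, Fintype.card_coe, smul_eq_mul] at hsum
  simp only [V] at *
  omega

/-- A Bézout bound for lines contained in the intersection of two surfaces. -/
theorem card_lines_le {g h : MvPolynomial (Fin 3) K} (hg : Prime g) (hgh : ¬ g ∣ h)
    (T : Finset (K × K × K)) (hT : ∀ u ∈ T, restr u g = 0 ∧ restr u h = 0) :
    T.card ≤ g.totalDegree * h.totalDegree := by
  by_contra! hlt
  obtain ⟨m, hm⟩ : ∃ m, m = g.totalDegree * h.totalDegree * (2 + g.totalDegree + h.totalDegree) +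
    T.card ^ 2 + 1 := ⟨_, rfl⟩
  have hNm : T.card ≤ m := by
    nlinarith [Nat.zero_le (g.totalDegree * h.totalDegree * (2 + g.totalDegree + h.totalDegree))]
  have key := finrank_bezout_le hg hgh T hT m
  have e1 := six_mul_finrank_restrictTotalDegree (K := K) (h.totalDegree + m)
  have e2 := six_mul_finrank_restrictTotalDegree (K := K) (g.totalDegree + m)
  have e3 := six_mul_finrank_restrictTotalDegree (K := K) (g.totalDegree + h.totalDegree + m)
  have e4 := six_mul_finrank_restrictTotalDegree (K := K) m
  obtain ⟨k, hk⟩ := Nat.exists_eq_add_of_le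
    (show T.card ≤ g.totalDegree + h.totalDegree + m by omega)
  rw [show g.totalDegree + h.totalDegree + m - T.card = k by omega] at key
  generalize Module.finrank K (restrictTotalDegree (Fin 3) K (h.totalDegree + m)) = x1 at *
  generalize Module.finrank K (restrictTotalDegree (Fin 3) K (g.totalDegree + m)) = x2 at *
  generalize Module.finrank K
    (restrictTotalDegree (Fin 3) K (g.totalDegree + h.totalDegree + m)) = x3 at *
  generalize Module.finrank K (restrictTotalDegree (Fin 3) K m) = x4 at *
  generalize T.card = N at *
  generalize g.totalDegree = a at *
  generalize h.totalDegree = b at *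
  clear hT hgh hg
  zify at key e1 e2 e3 e4 hk hm hlt
  have h6 : 6 * (N * k : ℤ) ≤ 3 * a * b * (2 * m + 4 + a + b) := by
    linear_combination 6 * key + e3 + e4 - e1 - e2
  have hk' : (k : ℤ) = a + b + m - N := by linarith
  rw [hk'] at h6
  have h7 : (a * b + 1 : ℤ) * m ≤ N * m := by
    apply mul_le_mul_of_nonneg_right _ (by positivity)
    linarith
  nlinarith [show (0 : ℤ) ≤ N * (a + b) by positivity, show (0 : ℤ) ≤ a * b * (a + b) by positivity,
    show (0 : ℤ) ≤ a * b by positivity]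

end Bezout

section Derivatives

open MvPolynomial

variable {K : Type*} [Field K]

theorem pderiv_pderiv_comm (i j : Fin 3) (f : MvPolynomial (Fin 3) K) :
    pderiv i (pderiv j f) = pderiv j (pderiv i f) := by
  induction f using MvPolynomial.induction_on with
  | C a => simp
  | add p q hp hq => simp [hp, hq]
  | mul_X p k hp =>
    have hX : ∀ a b : Fin 3, pderiv a (pderiv b (X k : MvPolynomial (Fin 3) K)) = 0 := by
      intro a b
      by_cases hb : k = b
      · subst hb; simp
      · rw [pderiv_X_of_ne hb]; simp
    simp only [pderiv_mul, map_add, hX, hp]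
    ring

theorem totalDegree_pderiv_le (i : Fin 3) (f : MvPolynomial (Fin 3) K) :
    (pderiv i f).totalDegree ≤ f.totalDegree - 1 := by
  refine Finset.sup_le fun m hm => ?_
  rw [mem_support_iff, coeff_pderiv] at hm
  have h1 : m + Finsupp.single i 1 ∈ f.support := mem_support_iff.2 (left_ne_zero_of_mul hm)
  have h2 := le_totalDegree h1
  rw [Finsupp.sum_add_index' (by simp) (by simp), Finsupp.sum_single_index rfl] at h2
  omega

theorem exists_pderiv_ne_zero {p : ℕ} [CharP K p] {f : MvPolynomial (Fin 3) K}
    (hf : 0 < f.totalDegree) (hp : f.totalDegree < p) : ∃ i, pderiv i f ≠ 0 := by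
  by_contra! h
  obtain ⟨m, hm, hmi⟩ : ∃ m ∈ f.support, (m.sum fun _ e => e) ≠ 0 := by
    by_contra! h0
    exact hf.ne' (Nat.le_zero.1 (Finset.sup_le fun m hm => (h0 m hm).le))
  obtain ⟨i, hi⟩ : ∃ i, m i ≠ 0 := by
    by_contra! h0
    exact hmi (Finset.sum_eq_zero fun i _ => h0 i)
  have h1 : (m - Finsupp.single i 1) + Finsupp.single i 1 = m := by
    apply tsub_add_cancel_of_le
    rw [Finsupp.single_le_iff]
    omega
  have h2 := congrArg (coeff (m - Finsupp.single i 1)) (h i)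
  rw [coeff_pderiv, h1, coeff_zero] at h2
  have h3 := (mul_eq_zero.1 h2).resolve_left (mem_support_iff.1 hm)
  have h4 : ((m i : ℕ) : K) = 0 := by
    rw [← h3]
    have : (m - Finsupp.single i 1 : Fin 3 →₀ ℕ) i + 1 = m i := by simp; omega
    exact_mod_cast congrArg (Nat.cast (R := K)) this.symm
  have h5 : m i ≤ f.totalDegree := by
    refine le_trans ?_ (le_totalDegree hm)
    rw [Finsupp.sum_fintype _ _ (by simp)]
    exact Finset.single_le_sum (f := fun i => m i) (by simp) (Finset.mem_univ i)
  exact absurd (Nat.le_of_dvd (Nat.pos_of_ne_zero hi) ((CharP.cast_eq_zero_iff K p _).1 h4))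
    (by omega)

/-- The derivative in the direction `(1, s, s²)`. -/
noncomputable def dirD (s : K) (f : MvPolynomial (Fin 3) K) : MvPolynomial (Fin 3) K :=
  pderiv 0 f + C s * pderiv 1 f + C (s ^ 2) * pderiv 2 f

theorem derivative_restr (u : K × K × K) (f : MvPolynomial (Fin 3) K) :
    Polynomial.derivative (restr u f) = restr u (dirD u.1 f) := by
  induction f using MvPolynomial.induction_on with
  | C a => simp [dirD, restr, algHom_C]
  | add p q hp hq =>
    simp only [map_add, hp, hq, dirD, map_mul]
    ring
  | mul_X p k hp =>
    rw [map_mul, Polynomial.derivative_mul, hp]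
    have hX : Polynomial.derivative (restr u (X k)) = restr u (dirD u.1 (X k)) := by
      fin_cases k
      · simp [dirD, restr, pderiv_X]
      · simp [dirD, restr, algHom_C, pderiv_X]
      · simp [dirD, restr, algHom_C, pderiv_X]
        rw [← Polynomial.C_pow, Polynomial.derivative_C]
    rw [hX, ← map_mul, ← map_mul, ← map_add]
    congr 1
    simp only [dirD, pderiv_mul]
    ring

/-- First order Taylor expansion of a polynomial at `P` in direction `v`. -/
noncomputable def dualEval (P v : Fin 3 → K) : MvPolynomial (Fin 3) K →ₐ[K] DualNumber K :=
  aeval fun i => TrivSqZeroExt.inl (P i) + TrivSqZeroExt.inr (v i)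

theorem fst_dualEval (P v : Fin 3 → K) (f : MvPolynomial (Fin 3) K) :
    (dualEval P v f).fst = MvPolynomial.eval P f := by
  induction f using MvPolynomial.induction_on with
  | C a => simp [dualEval, algHom_C, TrivSqZeroExt.algebraMap_eq_inl]
  | add p q hp hq => simp [hp, hq]
  | mul_X p k hp =>
    rw [map_mul, TrivSqZeroExt.fst_mul, hp]
    simp [dualEval]

theorem snd_dualEval (P v : Fin 3 → K) (f : MvPolynomial (Fin 3) K) :
    (dualEval P v f).snd = ∑ i, v i * MvPolynomial.eval P (pderiv i f) := by
  induction f using MvPolynomial.induction_on with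
  | C a => simp [dualEval, algHom_C, TrivSqZeroExt.algebraMap_eq_inl]
  | add p q hp hq => simp [hp, hq, mul_add, Finset.sum_add_distrib]
  | mul_X p k hp =>
    rw [map_mul, TrivSqZeroExt.snd_mul, hp, fst_dualEval]
    have h1 : (dualEval P v (X k)).snd = v k := by simp [dualEval]
    have h2 : (dualEval P v (X k)).fst = P k := by simp [dualEval]
    rw [h1, h2]
    fin_cases k <;> simp [pderiv_X, Pi.single_apply, Fin.sum_univ_three] <;> ring

theorem dual_flecnode {a0 b c g0 g1 g2 g3 g4 : DualNumber K} {s μ : K}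
    (h1 : c * c * c * g1 - c * c * b * g2 + c * b * b * g3 - c * c * a0 * g3 +
      (a0 * b * c * g4 + a0 * b * c * g4) - b * b * b * g4 = 0)
    (h0 : c * c * c * g0 - c * c * a0 * g2 + c * a0 * b * g3 + a0 * a0 * c * g4 -
      a0 * b * b * g4 = 0)
    (hq : a0.fst + b.fst * s + c.fst * s ^ 2 = 0)
    (hq' : a0.snd + b.snd * s + c.snd * s ^ 2 + μ * (b.fst + 2 * s * c.fst) = 0)
    (hc : c.fst ≠ 0) :
    g0.snd + g1.snd * s + g2.snd * s ^ 2 + g3.snd * s ^ 3 + g4.snd * s ^ 4 +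
      μ * (g1.fst + 2 * s * g2.fst + 3 * s ^ 2 * g3.fst + 4 * s ^ 3 * g4.fst) = 0 := by
  obtain ⟨σ, hσ1, hσ2⟩ : ∃ σ : DualNumber K, σ.fst = s ∧ σ.snd = μ := ⟨(s, μ), rfl, rfl⟩
  have hqq : a0 + b * σ + c * σ ^ 2 = 0 := by
    ext
    · simp [hσ1, pow_two]; linear_combination hq
    · simp [hσ1, hσ2, pow_two]; linear_combination hq'
  have hG : c ^ 3 * (g0 + g1 * σ + g2 * σ ^ 2 + g3 * σ ^ 3 + g4 * σ ^ 4) = 0 := by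
    linear_combination h1 * σ + h0 + hqq * (c ^ 2 * g2 + g3 * (c ^ 2 * σ - c * b) +
      g4 * (c ^ 2 * σ ^ 2 - c * b * σ + b ^ 2 - a0 * c))
  have hu : IsUnit (c ^ 3) := by
    apply IsUnit.pow
    rw [TrivSqZeroExt.isUnit_iff_isUnit_fst]
    exact hc.isUnit
  have hG' := (hu.mul_right_eq_zero).1 hG
  have := congrArg TrivSqZeroExt.snd hG'
  simp [hσ1, hσ2, pow_succ] at this
  linear_combination this

/-- The constant coefficient of the remainder of the second directional derivative (as a polynomial
in the slope) modulo the first one, up to a power of the leading coefficient. -/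
noncomputable def flec0 (g : MvPolynomial (Fin 3) K) : MvPolynomial (Fin 3) K :=
  let a0 := pderiv 0 g
  let b := pderiv 1 g
  let c := pderiv 2 g
  let g0 := pderiv 0 (pderiv 0 g)
  let g2 := pderiv 1 (pderiv 1 g) + (pderiv 0 (pderiv 2 g) + pderiv 0 (pderiv 2 g))
  let g3 := pderiv 1 (pderiv 2 g) + pderiv 1 (pderiv 2 g)
  let g4 := pderiv 2 (pderiv 2 g)
  c * c * c * g0 - c * c * a0 * g2 + c * a0 * b * g3 + a0 * a0 * c * g4 - a0 * b * b * g4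

/-- The linear coefficient of the same remainder. -/
noncomputable def flec1 (g : MvPolynomial (Fin 3) K) : MvPolynomial (Fin 3) K :=
  let a0 := pderiv 0 g
  let b := pderiv 1 g
  let c := pderiv 2 g
  let g1 := pderiv 0 (pderiv 1 g) + pderiv 0 (pderiv 1 g)
  let g2 := pderiv 1 (pderiv 1 g) + (pderiv 0 (pderiv 2 g) + pderiv 0 (pderiv 2 g))
  let g3 := pderiv 1 (pderiv 2 g) + pderiv 1 (pderiv 2 g)
  let g4 := pderiv 2 (pderiv 2 g)
  c * c * c * g1 - c * c * b * g2 + c * b * b * g3 - c * c * a0 * g3 +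
      (a0 * b * c * g4 + a0 * b * c * g4) - b * b * b * g4

end Derivatives

section Flecnode

variable {K : Type*} [Field K]

section Univariate

open Polynomial

theorem natDegree_eq_zero_of_derivative_eq_zero_of_lt {p : ℕ} [CharP K p] {f : K[X]}
    (hp : f.natDegree < p) (h : derivative f = 0) : f.natDegree = 0 := by
  by_contra h0
  have h1 := congrArg (fun q => q.coeff (f.natDegree - 1)) h
  have h2 : f.natDegree - 1 + 1 = f.natDegree := by omega
  simp only [coeff_derivative, coeff_zero, h2] at h1
  have hf : f.coeff f.natDegree ≠ 0 := by
    intro h3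
    rw [coeff_natDegree, leadingCoeff_eq_zero] at h3
    exact h0 (by simp [h3])
  have h4 := (mul_eq_zero.1 h1).resolve_left hf
  have h5 : ((f.natDegree : ℕ) : K) = 0 := by
    rw [← h4]
    exact_mod_cast congrArg (Nat.cast (R := K)) h2.symm
  exact absurd (Nat.le_of_dvd (Nat.pos_of_ne_zero h0) ((CharP.cast_eq_zero_iff K p _).1 h5))
    (by omega)

theorem natDegree_eq_zero_of_dvd_derivative {p : ℕ} [CharP K p] {f : K[X]}
    (hp : f.natDegree < p) (h : f ∣ derivative f) : f.natDegree = 0 := by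
  by_contra h0
  apply h0
  apply natDegree_eq_zero_of_derivative_eq_zero_of_lt hp
  apply eq_zero_of_dvd_of_natDegree_lt h
  exact natDegree_derivative_lt h0

theorem eq_C_mul_of_wronskian_eq_zero {p : ℕ} [CharP K p] {A B : K[X]} (hB : B ≠ 0)
    (hAp : A.natDegree < p) (hBp : B.natDegree < p)
    (h : derivative A * B = A * derivative B) : ∃ κ, A = C κ * B := by
  by_cases hA : A = 0
  · exact ⟨0, by simp [hA]⟩
  obtain ⟨d, A1, B1, hd, rfl, rfl, hco⟩ : ∃ d A1 B1 : K[X], d ≠ 0 ∧ A = d * A1 ∧ B = d * B1 ∧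
      IsCoprime A1 B1 := by
    have hd : EuclideanDomain.gcd A B ≠ 0 := fun h0 => hB (EuclideanDomain.gcd_eq_zero_iff.1 h0).2
    obtain ⟨A1, hA1⟩ := EuclideanDomain.gcd_dvd_left A B
    obtain ⟨B1, hB1⟩ := EuclideanDomain.gcd_dvd_right A B
    have hab := EuclideanDomain.gcd_eq_gcd_ab A B
    generalize EuclideanDomain.gcd A B = d at *
    refine ⟨d, A1, B1, hd, hA1, hB1, EuclideanDomain.gcdA A B, EuclideanDomain.gcdB A B, ?_⟩
    generalize EuclideanDomain.gcdA A B = x at *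
    generalize EuclideanDomain.gcdB A B = y at *
    apply mul_left_cancel₀ hd
    rw [hA1, hB1] at hab
    linear_combination -hab
  have hA1 := right_ne_zero_of_mul hA
  have hB1 := right_ne_zero_of_mul hB
  rw [natDegree_mul hd hA1] at hAp
  rw [natDegree_mul hd hB1] at hBp
  have h1 : derivative A1 * B1 = A1 * derivative B1 := by
    apply mul_left_cancel₀ (pow_ne_zero 2 hd)
    simp only [derivative_mul] at h
    linear_combination h
  have hA0 : A1.natDegree = 0 := natDegree_eq_zero_of_dvd_derivative (p := p) (by omega)
    (hco.dvd_of_dvd_mul_right (Dvd.intro _ h1.symm))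
  have hB0 : B1.natDegree = 0 := natDegree_eq_zero_of_dvd_derivative (p := p) (by omega)
    (hco.symm.dvd_of_dvd_mul_left (Dvd.intro_left _ h1))
  rw [natDegree_eq_zero] at hA0 hB0
  obtain ⟨x, rfl⟩ := hA0
  obtain ⟨y, rfl⟩ := hB0
  have hy : y ≠ 0 := by
    rintro rfl
    simp at hB1
  refine ⟨x / y, ?_⟩
  rw [mul_left_comm, ← C_mul, div_mul_cancel₀ _ hy]

theorem eq_linear_mul_of_ode {p : ℕ} [CharP K p] {E H : K[X]} {a : ℕ} (hE : E ≠ 0)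
    (hEa : E.natDegree ≤ a) (hHa : H.natDegree ≤ a) (hp : 2 * a + 1 < p)
    (h : E * (derivative (derivative E) * H - E * derivative (derivative H)) =
      2 * derivative E * (derivative E * H - E * derivative H)) :
    ∃ κ κ' : K, H = (C κ * X + C κ') * E := by
  have hE' : (derivative E).natDegree ≤ a := (natDegree_derivative_le E).trans (by omega)
  have hH' : (derivative H).natDegree ≤ a := (natDegree_derivative_le H).trans (by omega)
  obtain ⟨κ, hκ⟩ := eq_C_mul_of_wronskian_eq_zero (p := p)
    (A := derivative H * E - H * derivative E) (B := E * E) (mul_ne_zero hE hE)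
    (lt_of_le_of_lt ((natDegree_sub_le _ _).trans (max_le
      (natDegree_mul_le.trans (add_le_add hH' hEa)) (natDegree_mul_le.trans (add_le_add hHa hE'))))
      (by omega))
    (lt_of_le_of_lt (natDegree_mul_le.trans (add_le_add hEa hEa)) (by omega)) (by
      simp only [derivative_mul, derivative_sub]
      linear_combination (-E) * h)
  have hXE : (C κ * X * E).natDegree ≤ a + 1 := by
    refine natDegree_mul_le.trans ?_
    have : (C κ * X).natDegree ≤ 1 := by compute_degree
    omega
  obtain ⟨κ', hκ'⟩ := eq_C_mul_of_wronskian_eq_zero (p := p) (A := H - C κ * X * E) (B := E) hE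
    (lt_of_le_of_lt ((natDegree_sub_le _ _).trans (max_le (hHa.trans (Nat.le_succ a)) hXE))
      (by omega)) (by omega) (by
      simp only [derivative_mul, derivative_sub, derivative_X, derivative_C]
      linear_combination hκ)
  exact ⟨κ, κ', by linear_combination hκ'⟩

end Univariate

open MvPolynomial

theorem eval_dirD_dirD (P : Fin 3 → K) (s : K) (g : MvPolynomial (Fin 3) K) :
    eval P (dirD s (dirD s g)) = eval P (pderiv 0 (pderiv 0 g)) +
      2 * eval P (pderiv 0 (pderiv 1 g)) * s +
      (eval P (pderiv 1 (pderiv 1 g)) + 2 * eval P (pderiv 0 (pderiv 2 g))) * s ^ 2 +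
      2 * eval P (pderiv 1 (pderiv 2 g)) * s ^ 3 + eval P (pderiv 2 (pderiv 2 g)) * s ^ 4 := by
  simp only [dirD, map_add, pderiv_C_mul, map_mul, eval_C]
  rw [pderiv_pderiv_comm 1 0, pderiv_pderiv_comm 2 0, pderiv_pderiv_comm 2 1]
  ring

theorem restr_dirD_eq_zero {u : K × K × K} {g : MvPolynomial (Fin 3) K} (h : restr u g = 0) :
    restr u (dirD u.1 g) = 0 := by
  rw [← derivative_restr, h, Polynomial.derivative_zero]

theorem eval_pderiv_meet {u u' : K × K × K} {g : MvPolynomial (Fin 3) K} (h : restr u g = 0)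
    (h' : restr u' g = 0) (hc : Cross u u') (hs : u.1 ≠ u'.1) :
    (restr u (pderiv 1 g)).eval (meetT u u') + (u.1 + u'.1) *
      (restr u (pderiv 2 g)).eval (meetT u u') = 0 := by
  have h1 := eval_eq_zero_of_restr (restr_dirD_eq_zero h) (meetT u u')
  have h2 := eval_eq_zero_of_restr (restr_dirD_eq_zero h') (meetT u u')
  rw [← linePt_meetT hc hs] at h2
  rw [eval_restr, eval_restr]
  simp only [dirD, map_add, map_mul, eval_C] at h1 h2
  apply mul_left_cancel₀ (sub_ne_zero.2 hs)
  linear_combination h1 - h2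

theorem eval_flec_meet {u u' : K × K × K} {g : MvPolynomial (Fin 3) K} (h : restr u g = 0)
    (h' : restr u' g = 0) (hc : Cross u u') (hs : u.1 ≠ u'.1) :
    eval (linePt u (meetT u u')) (flec0 g) = 0 ∧ eval (linePt u (meetT u u')) (flec1 g) = 0 := by
  have key : ∀ v : K × K × K, restr v g = 0 → ∀ t,
      eval (linePt v t) (flec1 g) * v.1 + eval (linePt v t) (flec0 g) = 0 := by
    intro v hv t
    have h1 := eval_eq_zero_of_restr (restr_dirD_eq_zero hv) t
    have h2 := eval_eq_zero_of_restr (restr_dirD_eq_zero (restr_dirD_eq_zero hv)) t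
    rw [eval_dirD_dirD] at h2
    simp only [dirD, map_add, map_mul, eval_C] at h1
    simp only [flec0, flec1, map_add, map_mul, map_sub]
    generalize eval (linePt v t) (pderiv 0 g) = a0 at *
    generalize eval (linePt v t) (pderiv 1 g) = b at *
    generalize eval (linePt v t) (pderiv 2 g) = c at *
    generalize eval (linePt v t) (pderiv 0 (pderiv 0 g)) = f00 at *
    generalize eval (linePt v t) (pderiv 0 (pderiv 1 g)) = f01 at *
    generalize eval (linePt v t) (pderiv 0 (pderiv 2 g)) = f02 at *
    generalize eval (linePt v t) (pderiv 1 (pderiv 1 g)) = f11 at *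
    generalize eval (linePt v t) (pderiv 1 (pderiv 2 g)) = f12 at *
    generalize eval (linePt v t) (pderiv 2 (pderiv 2 g)) = f22 at *
    linear_combination c ^ 3 * h2 - h1 * (c ^ 2 * (f11 + 2 * f02) +
      2 * f12 * (c ^ 2 * v.1 - c * b) + f22 * (c ^ 2 * v.1 ^ 2 - c * b * v.1 + b ^ 2 - a0 * c))
  have h1 := key u h (meetT u u')
  have h2 := key u' h' (meetT u u')
  rw [← linePt_meetT hc hs] at h2
  have h3 : eval (linePt u (meetT u u')) (flec1 g) = 0 := by
    apply mul_left_cancel₀ (sub_ne_zero.2 hs)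
    linear_combination h1 - h2
  rw [h3] at h1
  exact ⟨by linear_combination h1, h3⟩

theorem flecnode_ode [Infinite K] {u : K × K × K} {g : MvPolynomial (Fin 3) K}
    (h : restr u g = 0) (h0 : g ∣ flec0 g) (h1 : g ∣ flec1 g) {E H : Polynomial K}
    (hH : H = restr u (pderiv 2 g))
    (hE : E = restr u (pderiv 1 g) + Polynomial.C (2 * u.1) * H) (hH0 : H ≠ 0) (hE0 : E ≠ 0) :
    E * (Polynomial.derivative (Polynomial.derivative E) * H -
        E * Polynomial.derivative (Polynomial.derivative H)) =
      2 * Polynomial.derivative E * (Polynomial.derivative E * H - E * Polynomial.derivative H) := by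
  rw [← sub_eq_zero]
  apply mul_left_cancel₀ (mul_ne_zero hH0 hE0)
  rw [mul_zero]
  apply Polynomial.funext
  intro t
  by_cases hz : H.eval t = 0 ∨ E.eval t = 0
  · rcases hz with hz | hz <;> simp [hz]
  push Not at hz
  obtain ⟨hHt, hEt⟩ := hz
  set P := linePt u t with hP
  have ev : ∀ f, (restr u f).eval t = eval P f := fun f => eval_restr u t f
  set F := restr u (pderiv 1 g) with hF
  -- values of the derivatives on the line
  have vH : H.eval t = eval P (pderiv 2 g) := by rw [hH, ev]
  have vF : F.eval t = eval P (pderiv 1 g) := by rw [hF, ev]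
  have vH' : (Polynomial.derivative H).eval t = eval P (pderiv 0 (pderiv 2 g)) +
      u.1 * eval P (pderiv 1 (pderiv 2 g)) + u.1 ^ 2 * eval P (pderiv 2 (pderiv 2 g)) := by
    rw [hH, derivative_restr, ev]
    simp [dirD]
  have vF' : (Polynomial.derivative F).eval t = eval P (pderiv 0 (pderiv 1 g)) +
      u.1 * eval P (pderiv 1 (pderiv 1 g)) + u.1 ^ 2 * eval P (pderiv 1 (pderiv 2 g)) := by
    rw [hF, derivative_restr, ev]
    simp [dirD, pderiv_pderiv_comm 2 1]
  have vH'' : (Polynomial.derivative (Polynomial.derivative H)).eval t =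
      eval P (dirD u.1 (dirD u.1 (pderiv 2 g))) := by
    rw [hH, derivative_restr, derivative_restr, ev]
  have vF'' : (Polynomial.derivative (Polynomial.derivative F)).eval t =
      eval P (dirD u.1 (dirD u.1 (pderiv 1 g))) := by
    rw [hF, derivative_restr, derivative_restr, ev]
  have vE : E.eval t = F.eval t + 2 * u.1 * H.eval t := by rw [hE]; simp
  have vE' : (Polynomial.derivative E).eval t =
      (Polynomial.derivative F).eval t + 2 * u.1 * (Polynomial.derivative H).eval t := by
    rw [hE]; simp [Polynomial.derivative_mul]
  have vE'' : (Polynomial.derivative (Polynomial.derivative E)).eval t =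
      (Polynomial.derivative (Polynomial.derivative F)).eval t +
        2 * u.1 * (Polynomial.derivative (Polynomial.derivative H)).eval t := by
    rw [hE]; simp [Polynomial.derivative_mul]
  obtain ⟨ζ, hζ⟩ : ∃ ζ, F.eval t + ζ * H.eval t = 0 :=
    ⟨-F.eval t / H.eval t, by field_simp; ring⟩
  obtain ⟨μ, hμ⟩ : ∃ μ, (Polynomial.derivative F).eval t +
      ζ * (Polynomial.derivative H).eval t + μ * E.eval t = 0 :=
    ⟨-((Polynomial.derivative F).eval t + ζ * (Polynomial.derivative H).eval t) / E.eval t,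
      by field_simp; ring⟩
  set φ := dualEval P ![0, 1, ζ] with hφ
  have fst : ∀ f, (φ f).fst = eval P f := fst_dualEval _ _
  have snd : ∀ f, (φ f).snd = eval P (pderiv 1 f) + ζ * eval P (pderiv 2 f) := by
    intro f
    rw [hφ, snd_dualEval]
    simp [Fin.sum_univ_three]
  have hg : φ g = 0 := by
    ext
    · rw [fst]; exact eval_eq_zero_of_restr h t
    · rw [snd, ← vF, ← vH, hζ]; rfl
  have r0 : φ (flec0 g) = 0 := by
    obtain ⟨k, hk⟩ := h0
    rw [hk, map_mul, hg, zero_mul]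
  have r1 : φ (flec1 g) = 0 := by
    obtain ⟨k, hk⟩ := h1
    rw [hk, map_mul, hg, zero_mul]
  simp only [flec0, flec1, map_add, map_mul, map_sub] at r0 r1
  have hd := eval_eq_zero_of_restr (restr_dirD_eq_zero h) t
  simp only [dirD, map_add, map_mul, eval_C] at hd
  have main := dual_flecnode (s := u.1) (μ := μ) r1 r0 (by rw [fst, fst, fst]; linear_combination hd)
    (by
      simp only [snd, fst]
      rw [vE, vF, vH, vF', vH'] at hμ
      rw [pderiv_pderiv_comm 1 0, pderiv_pderiv_comm 2 0, pderiv_pderiv_comm 2 1]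
      linear_combination hμ)
    (by rw [fst, ← vH]; exact hHt)
  simp only [TrivSqZeroExt.snd_add, TrivSqZeroExt.fst_add, fst, snd] at main
  rw [eval_dirD_dirD] at vH'' vF''
  have c1 : ∀ i j, eval P (pderiv 1 (pderiv i (pderiv j g))) =
      eval P (pderiv i (pderiv j (pderiv 1 g))) := by
    intro i j
    rw [pderiv_pderiv_comm 1 i, pderiv_pderiv_comm 1 j]
  have c2 : ∀ i j, eval P (pderiv 2 (pderiv i (pderiv j g))) =
      eval P (pderiv i (pderiv j (pderiv 2 g))) := by
    intro i j
    rw [pderiv_pderiv_comm 2 i, pderiv_pderiv_comm 2 j]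
  have main2 : (Polynomial.derivative (Polynomial.derivative F)).eval t +
      ζ * (Polynomial.derivative (Polynomial.derivative H)).eval t +
      2 * μ * (Polynomial.derivative E).eval t = 0 := by
    rw [vE', vF', vH', vF'', vH'']
    rw [c1 0 0, c1 0 1, c1 0 2, c1 1 2, c1 2 2, c2 0 0, c2 0 1, c2 1 1, c2 0 2, c2 1 2] at main
    linear_combination main
  simp only [Polynomial.eval_mul, Polynomial.eval_sub, Polynomial.eval_ofNat, Polynomial.eval_zero]
  rw [vE'']
  rw [vE'] at main2 ⊢
  generalize (Polynomial.derivative (Polynomial.derivative F)).eval t = x1 at *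
  generalize (Polynomial.derivative (Polynomial.derivative H)).eval t = x2 at *
  generalize (Polynomial.derivative F).eval t = x3 at *
  generalize (Polynomial.derivative H).eval t = x4 at *
  generalize E.eval t = x5 at *
  generalize H.eval t = x6 at *
  generalize F.eval t = x7 at *
  linear_combination x6 * x5 * (x5 * x6 * main2 - x5 * x2 * (hζ + vE) -
    2 * (x3 + 2 * u.1 * x4) * (x6 * hμ - x4 * hζ - x4 * vE))

end Flecnode

section Configuration

open MvPolynomial

variable {K : Type*} [Field K]

/-- `adj` is a symmetric relation which forces lines to meet transversally, and no two lines meeting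
a third one meet each other. -/
structure IsTriangleFree (adj : K × K × K → K × K × K → Prop) : Prop where
  symm : ∀ {u u'}, adj u u' → adj u' u
  cross : ∀ {u u'}, adj u u' → Cross u u'
  slope_ne : ∀ {u u'}, adj u u' → u.1 ≠ u'.1
  not_cross : ∀ {u u' u''}, adj u u' → adj u u'' → u' ≠ u'' → ¬ Cross u' u''

variable {adj : K × K × K → K × K × K → Prop}

theorem IsTriangleFree.poly_eq_zero (hadj : IsTriangleFree adj) {u : K × K × K}
    {N : Finset (K × K × K)} (hN : ∀ u' ∈ N, adj u u') {q : Polynomial K}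
    (hq : ∀ u' ∈ N, q.eval (meetT u u') = 0) (hd : q.natDegree < N.card) : q = 0 := by
  have hinj : Set.InjOn (meetT u) N := by
    intro u' hu' u'' hu'' h
    by_contra hne
    apply hadj.not_cross (hN u' hu') (hN u'' hu'') hne
    apply cross_of_linePt_eq (t := meetT u u')
    rw [← linePt_meetT (hadj.cross (hN u' hu')) (hadj.slope_ne (hN u' hu')), h]
    exact linePt_meetT (hadj.cross (hN u'' hu'')) (hadj.slope_ne (hN u'' hu''))
  apply Polynomial.eq_zero_of_natDegree_lt_card_of_eval_eq_zero' q (N.image (meetT u))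
  · intro t ht
    obtain ⟨u', hu', rfl⟩ := Finset.mem_image.1 ht
    exact hq u' hu'
  · rwa [Finset.card_image_of_injOn hinj]

theorem IsTriangleFree.card_le_of_restr_ne_zero (hadj : IsTriangleFree adj) {u : K × K × K}
    {N : Finset (K × K × K)} (hN : ∀ u' ∈ N, adj u u') {f : MvPolynomial (Fin 3) K}
    (hf : ∀ u' ∈ N, restr u' f = 0) (hu : restr u f ≠ 0) : N.card ≤ f.totalDegree := by
  by_contra! hlt
  apply hu
  apply hadj.poly_eq_zero hN _ ((natDegree_restr_le u f).trans_lt hlt)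
  intro u' hu'
  rw [eval_restr, linePt_meetT (hadj.cross (hN u' hu')) (hadj.slope_ne (hN u' hu'))]
  exact eval_eq_zero_of_restr (hf u' hu') _

theorem exists_ne_zero_restr_eq_zero (S : Finset (K × K × K)) (D : ℕ)
    (h : 6 * (S.card * (D + 1)) < (D + 1) * (D + 2) * (D + 3)) :
    ∃ f : MvPolynomial (Fin 3) K, f ≠ 0 ∧ f.totalDegree ≤ D ∧ ∀ u ∈ S, restr u f = 0 := by
  let E := Polynomial.degreeLT K (D + 1)
  let Λ : restrictTotalDegree (Fin 3) K D →ₗ[K] (S → E) :=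
    LinearMap.pi fun u => LinearMap.codRestrict E
      ((restr u.1).toLinearMap ∘ₗ (restrictTotalDegree (Fin 3) K D).subtype) (by
        intro f
        apply Polynomial.mem_degreeLT.2
        refine lt_of_le_of_lt Polynomial.degree_le_natDegree ?_
        have h1 := (natDegree_restr_le u.1 f.1).trans ((mem_restrictTotalDegree _ _ _).1 f.2)
        exact_mod_cast Nat.lt_succ_of_le h1)
  have hE : Module.finrank K E = D + 1 := by
    rw [LinearEquiv.finrank_eq (Polynomial.degreeLTEquiv K _)]
    simp
  have hker : LinearMap.ker Λ ≠ ⊥ := by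
    apply LinearMap.ker_ne_bot_of_finrank_lt
    rw [Module.finrank_pi_fintype]
    simp only [hE, Finset.sum_const, Finset.card_univ, Fintype.card_coe, smul_eq_mul]
    have := six_mul_finrank_restrictTotalDegree (K := K) D
    omega
  obtain ⟨f, hf, hf0⟩ := Submodule.exists_mem_ne_zero_of_ne_bot hker
  refine ⟨f.1, fun h0 => hf0 (Subtype.ext h0), (mem_restrictTotalDegree _ _ _).1 f.2, ?_⟩
  intro u hu
  exact congrArg Subtype.val (congrFun (LinearMap.mem_ker.1 hf) ⟨u, hu⟩)

theorem IsTriangleFree.exists_generating_subset (hadj : IsTriangleFree adj)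
    (V : Finset (K × K × K)) {B D : ℕ} (hDB : D < B)
    (hdeg : ∀ v ∈ V, B ≤ (V.filter (adj v)).card) :
    ∃ S ⊆ V, (B - D) * S.card ≤ (D + 1) * V.card ∧ ∀ f : MvPolynomial (Fin 3) K,
      f.totalDegree ≤ D → (∀ u ∈ S, restr u f = 0) → ∀ u ∈ V, restr u f = 0 := by
  let φ : Finset (K × K × K) → ℕ := fun S => ∑ v ∈ V, min (D + 1) (S.filter (adj v)).card
  obtain ⟨S, hS, hmax⟩ := Finset.exists_max_image
    (V.powerset.filter fun S => (B - D) * S.card ≤ φ S) Finset.card ⟨∅, by simp⟩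
  rw [Finset.mem_filter, Finset.mem_powerset] at hS
  refine ⟨S, hS.1, hS.2.trans ?_, ?_⟩
  · calc φ S ≤ ∑ v ∈ V, (D + 1) := Finset.sum_le_sum fun v _ => min_le_left _ _
      _ = (D + 1) * V.card := by rw [Finset.sum_const, smul_eq_mul, mul_comm]
  intro f hfD hfS u hu
  by_contra hne
  set Z := V.filter fun v => restr v f = 0 with hZ
  have hSZ : S ⊆ Z := fun v hv => Finset.mem_filter.2 ⟨hS.1 hv, hfS v hv⟩
  have hle : ∀ v ∈ V, v ∉ Z → (Z.filter (adj v)).card ≤ D := by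
    intro v hv hvZ
    refine (hadj.card_le_of_restr_ne_zero (u := v) (f := f) (fun u' hu' => (Finset.mem_filter.1 hu').2)
      (fun u' hu' => (Finset.mem_filter.1 (Finset.mem_filter.1 hu').1).2) ?_).trans hfD
    exact fun h0 => hvZ (Finset.mem_filter.2 ⟨hv, h0⟩)
  have huZ : u ∉ Z := fun h => hne (Finset.mem_filter.1 h).2
  have huS : u ∉ S := fun h => huZ (hSZ h)
  have hM : B - D ≤ ((V.filter (adj u)).filter fun v => v ∉ Z).card := by
    have h1 := Finset.card_filter_add_card_filter_not (s := V.filter (adj u)) (fun v => v ∈ Z)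
    have h2 : ((V.filter (adj u)).filter fun v => v ∈ Z).card ≤ D := by
      refine le_trans (Finset.card_le_card ?_) (hle u hu huZ)
      intro v hv
      simp only [Finset.mem_filter] at hv ⊢
      exact ⟨hv.2, hv.1.2⟩
    have h3 := hdeg u hu
    omega
  have hφ : φ S + (B - D) ≤ φ (insert u S) := by
    refine (Nat.add_le_add_left hM _).trans ?_
    rw [Finset.filter_filter, Finset.card_filter, ← Finset.sum_add_distrib]
    refine Finset.sum_le_sum fun v hv => ?_
    have hmono : (S.filter (adj v)).card ≤ ((insert u S).filter (adj v)).card :=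
      Finset.card_le_card (Finset.filter_subset_filter _ (Finset.subset_insert _ _))
    split_ifs with hc
    · rw [Finset.filter_insert, if_pos (hadj.symm hc.1), Finset.card_insert_of_notMem
        (fun h => huS (Finset.mem_filter.1 h).1)]
      have h4 := (Finset.card_le_card (Finset.filter_subset_filter (adj v) hSZ)).trans
        (hle v hv hc.2)
      omega
    · omega
  have hmem : insert u S ∈ V.powerset.filter fun S => (B - D) * S.card ≤ φ S := by
    rw [Finset.mem_filter, Finset.mem_powerset]
    refine ⟨Finset.insert_subset hu hS.1, ?_⟩
    rw [Finset.card_insert_of_notMem huS, mul_add, mul_one]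
    exact (Nat.add_le_add_right hS.2 _).trans hφ
  have := hmax _ hmem
  rw [Finset.card_insert_of_notMem huS] at this
  omega

theorem exists_rich_irreducible_factor (f : MvPolynomial (Fin 3) K) (hf : f ≠ 0)
    (V : Finset (K × K × K)) (hV : V.Nonempty) (h : ∀ u ∈ V, restr u f = 0) :
    ∃ g, Irreducible g ∧ g ∣ f ∧
      V.card * g.totalDegree ≤ (V.filter fun u => restr u g = 0).card * f.totalDegree := by
  induction f using WfDvdMonoid.induction_on_irreducible generalizing V with
  | zero => exact absurd rfl hf
  | unit f hu =>
    obtain ⟨u, hu'⟩ := hV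
    exact absurd (h u hu') (hu.map (restr u)).ne_zero
  | mul f i hf0 hi ih =>
    set V0 := V.filter fun u => restr u i = 0
    set V1 := V.filter fun u => ¬ restr u i = 0 with hV1d
    have hcard : V0.card + V1.card = V.card := Finset.card_filter_add_card_filter_not _
    have hdeg : (i * f).totalDegree = i.totalDegree + f.totalDegree :=
      totalDegree_mul_of_isDomain hi.ne_zero hf0
    rw [hdeg]
    by_cases hx : V.card * i.totalDegree ≤ V0.card * (i.totalDegree + f.totalDegree)
    · exact ⟨i, hi, Dvd.intro _ rfl, hx⟩
    have hV1 : V1.Nonempty := by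
      rw [Finset.nonempty_iff_ne_empty]
      intro h0
      rw [h0, Finset.card_empty, add_zero] at hcard
      apply hx
      rw [hcard]
      gcongr
      omega
    obtain ⟨g, hg, hgf, hle⟩ := ih hf0 V1 hV1 (by
      intro u hu
      rw [hV1d, Finset.mem_filter] at hu
      have h1 := h u hu.1
      rw [map_mul] at h1
      exact (mul_eq_zero.1 h1).resolve_left hu.2)
    refine ⟨g, hg, hgf.trans (Dvd.intro_left _ rfl), ?_⟩
    have hN : (V1.filter fun u => restr u g = 0).card ≤ (V.filter fun u => restr u g = 0).card :=
      Finset.card_le_card (Finset.filter_subset_filter _ (Finset.filter_subset _ _))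
    have hpos : 0 < V1.card := hV1.card_pos
    refine le_trans ?_ (Nat.mul_le_mul_right _ hN)
    rw [← hcard] at hx ⊢
    generalize (V1.filter fun u => restr u g = 0).card = n at *
    generalize V0.card = x at *
    generalize V1.card = y at *
    push Not at hx
    have hx' : x * f.totalDegree ≤ y * i.totalDegree := by nlinarith
    apply Nat.le_of_mul_le_mul_left _ hpos
    nlinarith [Nat.mul_le_mul_left (x + y) hle, Nat.mul_le_mul_left n hx']

end Configuration

section DegreeBound

open MvPolynomial

variable {K : Type*} [Field K]

theorem totalDegree_mul4_le {a : ℕ} {x y z w : MvPolynomial (Fin 3) K} (hx : x.totalDegree ≤ a)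
    (hy : y.totalDegree ≤ a) (hz : z.totalDegree ≤ a) (hw : w.totalDegree ≤ a) :
    (x * y * z * w).totalDegree ≤ 4 * a := by
  have h1 := totalDegree_mul (x * y * z) w
  have h2 := totalDegree_mul (x * y) z
  have h3 := totalDegree_mul x y
  omega

theorem totalDegree_add_le_of_le {a : ℕ} {x y : MvPolynomial (Fin 3) K} (hx : x.totalDegree ≤ a)
    (hy : y.totalDegree ≤ a) : (x + y).totalDegree ≤ a :=
  (totalDegree_add _ _).trans (max_le hx hy)

theorem totalDegree_sub_le_of_le {a : ℕ} {x y : MvPolynomial (Fin 3) K} (hx : x.totalDegree ≤ a)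
    (hy : y.totalDegree ≤ a) : (x - y).totalDegree ≤ a :=
  (totalDegree_sub _ _).trans (max_le hx hy)

theorem totalDegree_flec_le (g : MvPolynomial (Fin 3) K) :
    (flec0 g).totalDegree ≤ 4 * g.totalDegree ∧ (flec1 g).totalDegree ≤ 4 * g.totalDegree := by
  have d1 : ∀ i, (pderiv i g).totalDegree ≤ g.totalDegree := fun i =>
    (totalDegree_pderiv_le i g).trans (Nat.sub_le _ _)
  have d2 : ∀ i j, (pderiv i (pderiv j g)).totalDegree ≤ g.totalDegree := fun i j =>
    ((totalDegree_pderiv_le i _).trans (Nat.sub_le _ _)).trans (d1 j)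
  have b0 := d1 0
  have b1 := d1 1
  have b2 := d1 2
  have b00 := d2 0 0
  have b01 := d2 0 1
  have b02 := d2 0 2
  have b11 := d2 1 1
  have b12 := d2 1 2
  have b22 := d2 2 2
  clear d1 d2
  unfold flec0 flec1
  dsimp only
  generalize pderiv 0 (pderiv 0 g) = f00 at *
  generalize pderiv 0 (pderiv 1 g) = f01 at *
  generalize pderiv 0 (pderiv 2 g) = f02 at *
  generalize pderiv 1 (pderiv 1 g) = f11 at *
  generalize pderiv 1 (pderiv 2 g) = f12 at *
  generalize pderiv 2 (pderiv 2 g) = f22 at *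
  generalize pderiv 0 g = f0 at *
  generalize pderiv 1 g = f1 at *
  generalize pderiv 2 g = f2 at *
  have b1' := totalDegree_add_le_of_le b01 b01
  have b2' := totalDegree_add_le_of_le b11 (totalDegree_add_le_of_le b02 b02)
  have b3' := totalDegree_add_le_of_le b12 b12
  generalize f01 + f01 = h1 at *
  generalize f11 + (f02 + f02) = h2 at *
  generalize f12 + f12 = h3 at *
  constructor
  · refine totalDegree_sub_le_of_le (totalDegree_add_le_of_le (totalDegree_add_le_of_le
      (totalDegree_sub_le_of_le ?_ ?_) ?_) ?_) ?_ <;> apply totalDegree_mul4_le <;> assumption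
  · refine totalDegree_sub_le_of_le (totalDegree_add_le_of_le (totalDegree_sub_le_of_le
      (totalDegree_add_le_of_le (totalDegree_sub_le_of_le ?_ ?_) ?_) ?_)
      (totalDegree_add_le_of_le ?_ ?_)) ?_ <;> apply totalDegree_mul4_le <;> assumption

end DegreeBound

section LineOnSurface

open MvPolynomial

variable {K : Type*} [Field K] {adj : K × K × K → K × K × K → Prop}

/-- A line on a surface whose flecnodal remainders vanish, which is not singular and which meets many
other lines of the surface, meets many lines satisfying one fixed linear equation. -/
theorem IsTriangleFree.exists_linear_relation [Infinite K] {p : ℕ} [CharP K p]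
    (hadj : IsTriangleFree adj) {g : MvPolynomial (Fin 3) K} (h0 : g ∣ flec0 g) (h1 : g ∣ flec1 g)
    {u : K × K × K} (hu : restr u g = 0) {i : Fin 3} (hi : restr u (pderiv i g) ≠ 0)
    (N : Finset (K × K × K)) (hN : ∀ u' ∈ N, adj u u' ∧ restr u' g = 0)
    (hcard : g.totalDegree < N.card) (hp : 2 * g.totalDegree + 1 < p) :
    ∃ κ κ' : K, N.card ≤ g.totalDegree +
      (N.filter fun u' => κ * (u'.2.1 - u.2.1) + κ' * (u.1 - u'.1) = 1).card := by
  have hNa : ∀ u' ∈ N, adj u u' := fun u' hu' => (hN u' hu').1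
  have hdle : ∀ i, (restr u (pderiv i g)).natDegree ≤ g.totalDegree := fun i =>
    (natDegree_restr_le _ _).trans ((totalDegree_pderiv_le i g).trans (Nat.sub_le _ _))
  have hmeet : ∀ u' ∈ N, (restr u (pderiv 1 g)).eval (meetT u u') + (u.1 + u'.1) *
      (restr u (pderiv 2 g)).eval (meetT u u') = 0 := fun u' hu' =>
    eval_pderiv_meet hu (hN u' hu').2 (hadj.cross (hNa u' hu')) (hadj.slope_ne (hNa u' hu'))
  obtain ⟨H, hH⟩ : ∃ H, H = restr u (pderiv 2 g) := ⟨_, rfl⟩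
  obtain ⟨E, hE⟩ : ∃ E, E = restr u (pderiv 1 g) + Polynomial.C (2 * u.1) * H := ⟨_, rfl⟩
  rw [← hH] at hmeet
  have hHd : H.natDegree ≤ g.totalDegree := hH ▸ hdle 2
  have hEd : E.natDegree ≤ g.totalDegree := by
    rw [hE]
    exact (Polynomial.natDegree_add_le _ _).trans
      (max_le (hdle 1) ((Polynomial.natDegree_C_mul_le _ _).trans hHd))
  have hEH : ∀ u' ∈ N, E.eval (meetT u u') = H.eval (meetT u u') * (u.1 - u'.1) := by
    intro u' hu'
    rw [hE]
    simp only [Polynomial.eval_add, Polynomial.eval_mul, Polynomial.eval_C]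
    linear_combination hmeet u' hu'
  have hH0 : H ≠ 0 := by
    intro hH0
    have hF0 : restr u (pderiv 1 g) = 0 := by
      apply hadj.poly_eq_zero hNa _ ((hdle 1).trans_lt hcard)
      intro u' hu'
      simpa [hH0] using hmeet u' hu'
    have h3 := restr_dirD_eq_zero hu
    rw [dirD, map_add, map_add, map_mul, map_mul, ← hH, hH0, hF0, mul_zero, mul_zero, add_zero,
      add_zero] at h3
    fin_cases i
    · exact hi h3
    · exact hi hF0
    · exact hi (hH ▸ hH0)
  have hE0 : E ≠ 0 := by
    intro hE0
    apply hH0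
    apply hadj.poly_eq_zero hNa _ (hHd.trans_lt hcard)
    intro u' hu'
    have h4 := hEH u' hu'
    rw [hE0, Polynomial.eval_zero] at h4
    exact (mul_eq_zero.1 h4.symm).resolve_right (sub_ne_zero.2 (hadj.slope_ne (hNa u' hu')))
  obtain ⟨κ, κ', hκ⟩ := eq_linear_mul_of_ode hE0 hEd hHd hp
    (flecnode_ode hu h0 h1 hH hE hH0 hE0)
  refine ⟨κ, κ', ?_⟩
  rw [← Finset.card_filter_add_card_filter_not (s := N)
    (fun u' => κ * (u'.2.1 - u.2.1) + κ' * (u.1 - u'.1) = 1), add_comm]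
  gcongr
  by_contra! hlt
  apply hE0
  refine hadj.poly_eq_zero (fun u' hu' => hNa u' (Finset.mem_filter.1 hu').1) ?_ (hEd.trans_lt hlt)
  intro u' hu'
  rw [Finset.mem_filter] at hu'
  by_contra hne
  apply hu'.2
  have h5 := hEH u' hu'.1
  rw [hκ] at h5
  simp only [Polynomial.eval_add, Polynomial.eval_mul, Polynomial.eval_C, Polynomial.eval_X] at h5
  have h6 : meetT u u' * (u.1 - u'.1) = u'.2.1 - u.2.1 :=
    div_mul_cancel₀ _ (sub_ne_zero.2 (hadj.slope_ne (hNa u' hu'.1)))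
  apply mul_left_cancel₀ hne
  linear_combination (-1 : K) * h5 - κ * E.eval (meetT u u') * h6

theorem IsTriangleFree.false_of_surface [Infinite K] {p : ℕ} [CharP K p]
    (hadj : IsTriangleFree adj) {V : Finset (K × K × K)} {B D k : ℕ}
    (hdeg : ∀ v ∈ V, B ≤ (V.filter (adj v)).card)
    (hk : ∀ u ∈ V, ∀ κ κ' : K, (V.filter fun u' => adj u u' ∧
      κ * (u'.2.1 - u.2.1) + κ' * (u.1 - u'.1) = 1).card ≤ k)
    {f : MvPolynomial (Fin 3) K} (hf : f ≠ 0) (hfD : f.totalDegree ≤ D)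
    (hfV : ∀ u ∈ V, restr u f = 0) (hV : V.Nonempty) (hD : 6 * D ^ 2 < V.card)
    (hB : 5 * D < B) (hkB : 2 * D + k < B) (hp : 2 * D + 1 < p) : False := by
  obtain ⟨g, hgi, hgf, hrich⟩ := exists_rich_irreducible_factor f hf V hV hfV
  have hg : Prime g := hgi.prime
  have hga : g.totalDegree ≤ f.totalDegree := totalDegree_le_of_dvd_of_isDomain hgf hf
  set a := g.totalDegree with ha
  set T := V.filter fun u => restr u g = 0 with hT
  have hTV : ∀ u ∈ T, u ∈ V ∧ restr u g = 0 := fun u hu => Finset.mem_filter.1 hu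
  have ha0 : 0 < a := by
    rw [Nat.pos_iff_ne_zero]
    intro h0
    have h1 := totalDegree_eq_zero_iff_eq_C.1 h0
    have hc : coeff 0 g ≠ 0 := fun h2 => hg.ne_zero (by rw [h1, h2, C_0])
    exact hg.not_isUnit (by rw [h1]; exact hc.isUnit.map C)
  obtain ⟨e, h, hgh, hfe⟩ : ∃ (e : ℕ) (h : MvPolynomial (Fin 3) K), ¬ g ∣ h ∧ f = g ^ e * h := by
    obtain ⟨e, h, h1, h2⟩ := WfDvdMonoid.max_power_factor hf hgi
    exact ⟨e, h, h1, h2⟩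
  have hhD : h.totalDegree ≤ D :=
    (totalDegree_le_of_dvd_of_isDomain (Dvd.intro_left _ hfe.symm) hf).trans hfD
  -- lines of `T` outside the other components meet many lines of `T`
  have hmany : ∀ u ∈ T, restr u h ≠ 0 → B - D ≤ (T.filter (adj u)).card := by
    intro u hu hne
    have h1 := hdeg u (hTV u hu).1
    have h2 : ((V.filter (adj u)).filter fun v => v ∉ T).card ≤ D := by
      refine (hadj.card_le_of_restr_ne_zero (u := u) (f := h) ?_ ?_ hne).trans hhD
      · intro u' hu'
        simp only [Finset.mem_filter] at hu'
        exact hu'.1.2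
      · intro u' hu'
        rw [Finset.mem_filter, Finset.mem_filter] at hu'
        have h3 := hfV u' hu'.1.1
        rw [hfe, map_mul, map_pow] at h3
        refine (mul_eq_zero.1 h3).resolve_left (pow_ne_zero _ fun h4 => hu'.2 ?_)
        exact Finset.mem_filter.2 ⟨hu'.1.1, h4⟩
    have h3 := Finset.card_filter_add_card_filter_not (s := V.filter (adj u)) (fun v => v ∈ T)
    have h4 : ((V.filter (adj u)).filter fun v => v ∈ T).card ≤ (T.filter (adj u)).card := by
      apply Finset.card_le_card
      intro v hv
      simp only [Finset.mem_filter] at hv ⊢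
      exact ⟨hv.2, hv.1.2⟩
    omega
  have hbad : (T.filter fun u => restr u h = 0).card ≤ a * D := by
    refine (card_lines_le hg hgh _ ?_).trans (Nat.mul_le_mul_left _ hhD)
    intro u hu
    rw [Finset.mem_filter] at hu
    exact ⟨(hTV u hu.1).2, hu.2⟩
  have hbadc := Finset.card_filter_add_card_filter_not (s := T) (fun u => restr u h = 0)
  have haD : a ≤ D := hga.trans hfD
  have hTcard : a * D + 4 * (a * a) < T.card := by
    have h1 : V.card * a ≤ T.card * D :=
      hrich.trans (Nat.mul_le_mul_left _ hfD)
    by_contra! h2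
    have h3 : T.card ≤ 5 * (a * D) := by nlinarith
    have h4 : V.card * a ≤ 5 * (a * D) * D := h1.trans (Nat.mul_le_mul_right _ h3)
    have h5 : V.card ≤ 5 * D ^ 2 := by
      apply Nat.le_of_mul_le_mul_left _ ha0
      linarith [h4, show 5 * (a * D) * D = a * (5 * D ^ 2) by ring]
    omega
  have hflec : ∀ r : MvPolynomial (Fin 3) K, r.totalDegree ≤ 4 * a →
      (∀ u u', restr u g = 0 → restr u' g = 0 → adj u u' →
        eval (linePt u (meetT u u')) r = 0) → g ∣ r := by
    intro r hr hev
    by_contra hgr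
    have h1 : (T.filter fun u => ¬ restr u h = 0).card ≤ a * (4 * a) := by
      refine (card_lines_le hg hgr _ ?_).trans (Nat.mul_le_mul_left _ hr)
      intro u hu
      rw [Finset.mem_filter] at hu
      refine ⟨(hTV u hu.1).2, ?_⟩
      refine hadj.poly_eq_zero (N := T.filter (adj u)) (fun u' hu' => (Finset.mem_filter.1 hu').2)
        ?_ ?_
      · intro u' hu'
        rw [Finset.mem_filter] at hu'
        rw [eval_restr]
        exact hev u u' (hTV u hu.1).2 (hTV u' hu'.1).2 hu'.2
      · have h2 := hmany u hu.1 hu.2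
        have h3 := natDegree_restr_le u r
        omega
    have h2 : a * (4 * a) = 4 * (a * a) := by ring
    omega
  have hd0 : g ∣ flec0 g := hflec _ (totalDegree_flec_le g).1 fun u u' hu hu' hc =>
    (eval_flec_meet hu hu' (hadj.cross hc) (hadj.slope_ne hc)).1
  have hd1 : g ∣ flec1 g := hflec _ (totalDegree_flec_le g).2 fun u u' hu hu' hc =>
    (eval_flec_meet hu hu' (hadj.cross hc) (hadj.slope_ne hc)).2
  obtain ⟨i, hi⟩ := exists_pderiv_ne_zero (K := K) (p := p) ha0 (by omega)
  have hgi' : ¬ g ∣ pderiv i g := by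
    intro hd
    have h1 := totalDegree_le_of_dvd_of_isDomain hd hi
    have h2 := totalDegree_pderiv_le i g
    omega
  obtain ⟨u, huT, huh, hui⟩ : ∃ u ∈ T, restr u h ≠ 0 ∧ restr u (pderiv i g) ≠ 0 := by
    by_contra! hall
    have h1 : (T.filter fun u => ¬ restr u h = 0).card ≤ a * a := by
      refine (card_lines_le hg hgi' _ ?_).trans (Nat.mul_le_mul_left _
        ((totalDegree_pderiv_le i g).trans (Nat.sub_le _ _)))
      intro u hu
      rw [Finset.mem_filter] at hu
      exact ⟨(hTV u hu.1).2, hall u hu.1 hu.2⟩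
    omega
  have hN := hmany u huT huh
  obtain ⟨κ, κ', hκ⟩ := hadj.exists_linear_relation (p := p) hd0 hd1 (hTV u huT).2 hui
    (T.filter (adj u)) (fun u' hu' =>
      ⟨(Finset.mem_filter.1 hu').2, (hTV u' (Finset.mem_filter.1 hu').1).2⟩) (by omega) (by omega)
  have h1 := hk u (hTV u huT).1 κ κ'
  have h2 : ((T.filter (adj u)).filter fun u' =>
      κ * (u'.2.1 - u.2.1) + κ' * (u.1 - u'.1) = 1).card ≤ k := by
    refine (Finset.card_le_card ?_).trans h1
    intro v hv
    simp only [Finset.mem_filter] at hv ⊢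
    exact ⟨(hTV v hv.1.1).1, hv.1.2, hv.2⟩
  omega

theorem IsTriangleFree.false_of_minDegree [Infinite K] {p : ℕ} [CharP K p]
    (hadj : IsTriangleFree adj) {V : Finset (K × K × K)} {B k : ℕ} (hV : V.Nonempty)
    (hdeg : ∀ v ∈ V, B ≤ (V.filter (adj v)).card)
    (hk : ∀ u ∈ V, ∀ κ κ' : K, (V.filter fun u' => adj u u' ∧
      κ * (u'.2.1 - u.2.1) + κ' * (u.1 - u'.1) = 1).card ≤ k)
    (hB : 10000 * V.card ≤ B ^ 2) (hkB : 10 * k ≤ B) (hp : V.card ≤ 2 * p ^ 2) : False := by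
  have hQ := hV.card_pos
  have hBQ : B ≤ V.card := by
    obtain ⟨v, hv⟩ := hV
    exact (hdeg v hv).trans (Finset.card_filter_le _ _)
  obtain ⟨Q, hQd⟩ : ∃ Q, Q = V.card := ⟨_, rfl⟩
  rw [← hQd] at hB hp hQ hBQ
  have hB100 : 100 ≤ B := by nlinarith
  have hBpos : 0 < B := by omega
  obtain ⟨D, hDd⟩ : ∃ D, D = 12 * Q / B + 1 := ⟨_, rfl⟩
  have hD1 : D * B ≤ 12 * Q + B := by
    rw [hDd, add_mul, one_mul]
    exact Nat.add_le_add_right (Nat.div_mul_le_self _ _) _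
  have hD2 : 12 * Q ≤ D * B := by
    have h1 := Nat.div_add_mod (12 * Q) B
    have h2 := Nat.mod_lt (12 * Q) hBpos
    rw [hDd]
    linarith
  have hDB : 80 * D ≤ B := by
    apply Nat.le_of_mul_le_mul_left _ hBpos
    nlinarith
  have hDQ : 6 * D ^ 2 < Q := by
    nlinarith [Nat.mul_le_mul_left D hDB]
  have hDp : 2 * D + 1 < p := by
    obtain ⟨d, hd⟩ : ∃ d, d = 12 * Q / B := ⟨_, rfl⟩
    have h1 : d * B ≤ 12 * Q := by
      rw [hd]
      exact Nat.div_mul_le_self _ _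
    have h2 : 10000 * d ^ 2 ≤ 144 * Q := by
      apply Nat.le_of_mul_le_mul_left _ hQ
      calc Q * (10000 * d ^ 2) = d ^ 2 * (10000 * Q) := by ring
        _ ≤ d ^ 2 * B ^ 2 := Nat.mul_le_mul_left _ hB
        _ = (d * B) ^ 2 := by ring
        _ ≤ (12 * Q) ^ 2 := Nat.pow_le_pow_left h1 2
        _ = Q * (144 * Q) := by ring
    have h3 : 100 * d ≤ 17 * p := by
      by_contra! h4
      nlinarith
    have h5 : 7 ≤ p := by
      by_contra! h4
      nlinarith
    omega
  obtain ⟨S, -, hScard, hS⟩ := hadj.exists_generating_subset V (B := B) (D := D) (by omega) hdeg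
  obtain ⟨f, hf, hfD, hfS⟩ := exists_ne_zero_restr_eq_zero S D (by
    rw [← hQd] at hScard
    have h1 : 79 * B * S.card ≤ 80 * ((D + 1) * Q) := by
      refine le_trans ?_ (Nat.mul_le_mul_left 80 hScard)
      rw [← mul_assoc]
      apply Nat.mul_le_mul_right
      omega
    have h2 : 6 * S.card ≤ D * (D + 1) := by
      apply Nat.le_of_mul_le_mul_left _ hBpos
      nlinarith [Nat.mul_le_mul_left (D + 1) hD2]
    nlinarith [Nat.mul_le_mul_left (D + 1) h2])
  exact hadj.false_of_surface (p := p) hdeg hk hf hfD (hS f hfD hfS) hV (by omega) (by omega)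
    (by omega) hDp

end LineOnSurface

section CrossingPairs

theorem IsTriangleFree.sum_degree_le {K : Type*} [Field K] [Infinite K] {p : ℕ} [CharP K p]
    {adj : K × K × K → K × K × K → Prop} (hadj : IsTriangleFree adj) {V : Finset (K × K × K)}
    {B k : ℕ} (hk : ∀ u ∈ V, ∀ κ κ' : K, (V.filter fun u' => adj u u' ∧
      κ * (u'.2.1 - u.2.1) + κ' * (u.1 - u'.1) = 1).card ≤ k)
    (hB : 10000 * V.card ≤ B ^ 2) (hkB : 10 * k ≤ B) (hp : V.card ≤ 2 * p ^ 2) :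
    ∑ u ∈ V, (V.filter (adj u)).card ≤ 2 * B * V.card := by
  by_contra! hlt
  obtain ⟨W, hW, hmin⟩ := Finset.exists_min_image
    (V.powerset.filter fun W => 2 * B * W.card < ∑ u ∈ W, (W.filter (adj u)).card) Finset.card
    ⟨V, by simpa using hlt⟩
  rw [Finset.mem_filter, Finset.mem_powerset] at hW
  obtain ⟨hWV, hWe⟩ := hW
  have hWne : W.Nonempty := by
    rw [Finset.nonempty_iff_ne_empty]
    rintro rfl
    simp at hWe
  have hWc := Finset.card_le_card hWV
  refine hadj.false_of_minDegree (p := p) hWne (B := B) (k := k) ?_ ?_ (by omega) hkB (by omega)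
  · intro v hv
    by_contra! hd
    have hsum : ∑ u ∈ W, (W.filter (adj u)).card ≤ 2 * (W.filter (adj v)).card +
        ∑ u ∈ W.erase v, ((W.erase v).filter (adj u)).card := by
      rw [← Finset.add_sum_erase W _ hv, two_mul, add_assoc]
      gcongr
      have h1 : (W.filter (adj v)).card = ∑ u ∈ W.erase v, if adj u v then 1 else 0 := by
        rw [← Finset.card_filter]
        congr 1
        ext u
        simp only [Finset.mem_filter, Finset.mem_erase]
        constructor
        · rintro ⟨h2, h3⟩
          exact ⟨⟨fun h4 => hadj.slope_ne h3 (by rw [h4]), h2⟩, hadj.symm h3⟩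
        · rintro ⟨⟨-, h2⟩, h3⟩
          exact ⟨h2, hadj.symm h3⟩
      rw [h1, ← Finset.sum_add_distrib]
      refine Finset.sum_le_sum fun u hu => ?_
      conv_lhs => rw [← Finset.insert_erase hv, Finset.filter_insert]
      split_ifs with h2
      · exact (Finset.card_insert_le _ _).trans (by omega)
      · omega
    have hcard := Finset.card_erase_of_mem hv
    have hpos := hWne.card_pos
    have hmem : W.erase v ∈ V.powerset.filter fun W =>
        2 * B * W.card < ∑ u ∈ W, (W.filter (adj u)).card := by
      rw [Finset.mem_filter, Finset.mem_powerset]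
      refine ⟨(Finset.erase_subset _ _).trans hWV, ?_⟩
      obtain ⟨n, hn⟩ : ∃ n, W.card = n + 1 := ⟨W.card - 1, by omega⟩
      rw [hcard, hn, Nat.add_sub_cancel]
      rw [hn] at hWe
      nlinarith
    have := hmin _ hmem
    omega
  · intro u hu κ κ'
    exact (Finset.card_le_card (Finset.filter_subset_filter _ hWV)).trans (hk u (hWV hu) κ κ')

variable {F : Type*} [Field F]

theorem ratFunc_quadratic_eq_zero {a b c : F}
    (h : RatFunc.C a + RatFunc.C b * RatFunc.X + RatFunc.C c * RatFunc.X ^ 2 = 0) :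
    a = 0 ∧ b = 0 ∧ c = 0 := by
  have h1 : Polynomial.C a + Polynomial.C b * Polynomial.X + Polynomial.C c * Polynomial.X ^ 2 =
      (0 : Polynomial F) := by
    apply RatFunc.algebraMap_injective F
    simpa using h
  refine ⟨?_, ?_, ?_⟩
  · simpa [Polynomial.coeff_X, Polynomial.coeff_C] using congrArg (fun q => q.coeff 0) h1
  · simpa [Polynomial.coeff_X, Polynomial.coeff_C, Polynomial.coeff_X_pow] using
      congrArg (fun q => q.coeff 1) h1
  · simpa [Polynomial.coeff_X, Polynomial.coeff_C, Polynomial.coeff_X_pow] using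
      congrArg (fun q => q.coeff 2) h1

/-- Lift of a line to the first of two families of lines over `F(X)`, each of which consists of
pairwise skew lines. -/
noncomputable def liftA (u : F × F × F) : RatFunc F × RatFunc F × RatFunc F :=
  (RatFunc.C u.1 + RatFunc.X ^ 2, -(RatFunc.C u.2.1 + RatFunc.X),
    RatFunc.C u.2.2 - RatFunc.X * RatFunc.C u.1 + RatFunc.X ^ 2 * RatFunc.C u.2.1)

/-- Lift of a line to the second family. -/
noncomputable def liftB (u : F × F × F) : RatFunc F × RatFunc F × RatFunc F :=
  (-(RatFunc.C u.1 + RatFunc.X ^ 2), RatFunc.C u.2.1 + RatFunc.X,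
    RatFunc.C u.2.2 - RatFunc.X * RatFunc.C u.1 + RatFunc.X ^ 2 * RatFunc.C u.2.1)

theorem cross_liftA_liftB {u u' : F × F × F} : Cross (liftA u) (liftB u') ↔ Cross u u' := by
  unfold Cross liftA liftB
  dsimp only
  rw [← (RatFunc.C : F →+* RatFunc F).injective.eq_iff]
  simp only [map_sub, map_mul]
  constructor <;> intro h <;> linear_combination h

theorem eq_of_cross_lift (h2 : (2 : F) ≠ 0) {u u' : F × F × F}
    (h : RatFunc.C (u'.2.2 - u.2.2 + (u.1 * u'.2.1 - u'.1 * u.2.1)) +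
      RatFunc.C (-(2 * (u'.1 - u.1))) * RatFunc.X +
      RatFunc.C (2 * (u'.2.1 - u.2.1)) * RatFunc.X ^ 2 = 0) : u = u' := by
  obtain ⟨e1, e3, e4⟩ := ratFunc_quadratic_eq_zero h
  have e5 : u'.1 = u.1 := by
    rw [neg_eq_zero] at e3
    exact sub_eq_zero.1 ((mul_eq_zero.1 e3).resolve_left h2)
  have e6 : u'.2.1 = u.2.1 := sub_eq_zero.1 ((mul_eq_zero.1 e4).resolve_left h2)
  rw [e5, e6] at e1
  exact Prod.ext e5.symm (Prod.ext e6.symm (by linear_combination -e1))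

theorem not_cross_liftA (h2 : (2 : F) ≠ 0) {u u' : F × F × F} (hne : u ≠ u') :
    ¬ Cross (liftA u) (liftA u') := by
  intro h
  apply hne
  apply eq_of_cross_lift h2
  unfold Cross liftA at h
  dsimp only at h
  simp only [map_sub, map_mul, map_add, map_neg, map_ofNat]
  linear_combination h

theorem not_cross_liftB (h2 : (2 : F) ≠ 0) {u u' : F × F × F} (hne : u ≠ u') :
    ¬ Cross (liftB u) (liftB u') := by
  intro h
  apply hne
  apply eq_of_cross_lift h2
  unfold Cross liftB at h
  dsimp only at h
  simp only [map_sub, map_mul, map_add, map_neg, map_ofNat]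
  linear_combination h

theorem liftA_slope_ne (h2 : (2 : F) ≠ 0) (u u' : F × F × F) : (liftA u).1 ≠ (liftB u').1 := by
  intro h
  unfold liftA liftB at h
  dsimp only at h
  have h1 := ratFunc_quadratic_eq_zero (a := u.1 + u'.1) (b := 0) (c := 2) (by
    simp only [map_add, map_zero, map_ofNat]
    linear_combination h)
  exact h2 h1.2.2

theorem liftA_injective : Function.Injective (liftA (F := F)) := by
  intro u u' h
  simp only [liftA, Prod.mk.injEq, add_left_inj, neg_inj] at h
  obtain ⟨h1, h2, h3⟩ := h
  rw [h1, h2] at h3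
  have hC := (RatFunc.C : F →+* RatFunc F).injective
  exact Prod.ext (hC h1) (Prod.ext (hC h2) (hC (by linear_combination h3)))

theorem liftB_injective : Function.Injective (liftB (F := F)) := by
  intro u u' h
  simp only [liftB, Prod.mk.injEq, add_left_inj, neg_inj] at h
  obtain ⟨h1, h2, h3⟩ := h
  rw [h1, h2] at h3
  have hC := (RatFunc.C : F →+* RatFunc F).injective
  exact Prod.ext (hC h1) (Prod.ext (hC h2) (hC (by linear_combination h3)))

/-- Adjacency between the two lifted families. -/
def liftAdj (x x' : RatFunc F × RatFunc F × RatFunc F) : Prop :=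
  ∃ u u' : F × F × F, Cross u u' ∧ ((x = liftA u ∧ x' = liftB u') ∨ (x = liftB u ∧ x' = liftA u'))

theorem isTriangleFree_liftAdj (h2 : (2 : F) ≠ 0) : IsTriangleFree (liftAdj (F := F)) where
  symm := by
    rintro x x' ⟨u, u', hc, ⟨rfl, rfl⟩ | ⟨rfl, rfl⟩⟩
    · exact ⟨u', u, hc.symm, Or.inr ⟨rfl, rfl⟩⟩
    · exact ⟨u', u, hc.symm, Or.inl ⟨rfl, rfl⟩⟩
  cross := by
    rintro x x' ⟨u, u', hc, ⟨rfl, rfl⟩ | ⟨rfl, rfl⟩⟩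
    · exact cross_liftA_liftB.2 hc
    · exact (cross_liftA_liftB.2 hc.symm).symm
  slope_ne := by
    rintro x x' ⟨u, u', hc, ⟨rfl, rfl⟩ | ⟨rfl, rfl⟩⟩
    · exact liftA_slope_ne h2 _ _
    · exact (liftA_slope_ne h2 _ _).symm
  not_cross := by
    rintro x x' x'' ⟨u, u', hc, ⟨rfl, rfl⟩ | ⟨rfl, rfl⟩⟩ ⟨v, v', hc', ⟨h1, rfl⟩ | ⟨h1, rfl⟩⟩ hne
    · exact not_cross_liftB h2 fun h => hne (by rw [h])
    · exact absurd (congrArg Prod.fst h1) (liftA_slope_ne h2 _ _)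
    · exact absurd (congrArg Prod.fst h1).symm (liftA_slope_ne h2 _ _)
    · exact not_cross_liftA h2 fun h => hne (by rw [h])

theorem card_linear_section_le (X : Finset (F × F × F)) {k : ℕ} (hk1 : 1 ≤ k)
    (hk : ∀ u v : F × F × F, v ≠ 0 → (X.filter fun x => ∃ t : F, x = u + t • v).card ≤ k)
    (u : F × F × F) {κ κ' κ'' : RatFunc F} (hκ : ¬ (κ = 0 ∧ κ' = 0)) :
    (X.filter fun x => Cross u x ∧ κ * RatFunc.C x.2.1 + κ' * RatFunc.C x.1 = κ'').card ≤ k := by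
  set Y := X.filter fun x => Cross u x ∧ κ * RatFunc.C x.2.1 + κ' * RatFunc.C x.1 = κ'' with hY
  by_cases hY1 : Y.card ≤ 1
  · exact hY1.trans hk1
  push Not at hY1
  obtain ⟨x, hx, y, hy, hxy⟩ := Finset.one_lt_card.1 hY1
  refine le_trans (Finset.card_le_card ?_) (hk x (y - x) (sub_ne_zero.2 hxy.symm))
  intro z hz
  rw [hY, Finset.mem_filter] at hx hy hz
  refine Finset.mem_filter.2 ⟨hz.1, ?_⟩
  obtain ⟨-, cx, ex⟩ := hx
  obtain ⟨-, cy, ey⟩ := hy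
  obtain ⟨-, cz, ez⟩ := hz
  unfold Cross at cx cy cz
  have hdet : (y.2.1 - x.2.1) * (z.1 - x.1) = (z.2.1 - x.2.1) * (y.1 - x.1) := by
    have e1 : κ * RatFunc.C (y.2.1 - x.2.1) + κ' * RatFunc.C (y.1 - x.1) = 0 := by
      simp only [map_sub]; linear_combination ey - ex
    have e2 : κ * RatFunc.C (z.2.1 - x.2.1) + κ' * RatFunc.C (z.1 - x.1) = 0 := by
      simp only [map_sub]; linear_combination ez - ex
    apply (RatFunc.C : F →+* RatFunc F).injective
    rw [map_mul, map_mul]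
    by_cases h0 : κ = 0
    · apply mul_left_cancel₀ (a := κ') (fun h1 => hκ ⟨h0, h1⟩)
      linear_combination RatFunc.C (y.2.1 - x.2.1) * e2 - RatFunc.C (z.2.1 - x.2.1) * e1
    · apply mul_left_cancel₀ h0
      linear_combination RatFunc.C (z.1 - x.1) * e1 - RatFunc.C (y.1 - x.1) * e2
  by_cases hd : y.1 - x.1 = 0
  · have hd2 : y.2.1 - x.2.1 ≠ 0 := by
      intro h0
      apply hxy
      refine Prod.ext (sub_eq_zero.1 hd).symm (Prod.ext (sub_eq_zero.1 h0).symm ?_)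
      linear_combination cx - cy - u.1 * h0 + u.2.1 * hd
    obtain ⟨t, ht⟩ : ∃ t, t * (y.2.1 - x.2.1) = z.2.1 - x.2.1 :=
      ⟨(z.2.1 - x.2.1) / (y.2.1 - x.2.1), div_mul_cancel₀ _ hd2⟩
    have hz1 : z.1 - x.1 = 0 := by
      apply mul_left_cancel₀ hd2
      linear_combination hdet + (z.2.1 - x.2.1) * hd
    refine ⟨t, Prod.ext ?_ (Prod.ext ?_ ?_)⟩
    · simp only [Prod.fst_add, Prod.smul_fst, Prod.fst_sub, smul_eq_mul]
      linear_combination hz1 - t * hd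
    · simp only [Prod.fst_add, Prod.snd_add, Prod.smul_snd, Prod.smul_fst, Prod.snd_sub,
        Prod.fst_sub, smul_eq_mul]
      linear_combination -ht
    · simp only [Prod.snd_add, Prod.smul_snd, Prod.snd_sub, smul_eq_mul]
      linear_combination cz - cx - t * (cy - cx) - u.1 * ht - u.2.1 * hz1 + t * u.2.1 * hd
  · obtain ⟨t, ht⟩ : ∃ t, t * (y.1 - x.1) = z.1 - x.1 :=
      ⟨(z.1 - x.1) / (y.1 - x.1), div_mul_cancel₀ _ hd⟩
    have hz2 : t * (y.2.1 - x.2.1) = z.2.1 - x.2.1 := by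
      apply mul_right_cancel₀ hd
      linear_combination hdet + (y.2.1 - x.2.1) * ht
    refine ⟨t, Prod.ext ?_ (Prod.ext ?_ ?_)⟩
    · simp only [Prod.fst_add, Prod.smul_fst, Prod.fst_sub, smul_eq_mul]
      linear_combination -ht
    · simp only [Prod.fst_add, Prod.snd_add, Prod.smul_snd, Prod.smul_fst, Prod.snd_sub,
        Prod.fst_sub, smul_eq_mul]
      linear_combination -hz2
    · simp only [Prod.snd_add, Prod.smul_snd, Prod.snd_sub, smul_eq_mul]
      linear_combination cz - cx - t * (cy - cx) - u.1 * hz2 + u.2.1 * ht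

/-- A Rudnev type bound for the number of pairs in `X` satisfying the bilinear relation `Cross`. -/
theorem sum_card_cross_le {p : ℕ} [CharP F p] (h2 : (2 : F) ≠ 0) (X : Finset (F × F × F)) {k B : ℕ}
    (hk1 : 1 ≤ k)
    (hk : ∀ u v : F × F × F, v ≠ 0 → (X.filter fun x => ∃ t : F, x = u + t • v).card ≤ k)
    (hX : X.card ≤ p ^ 2) (hB : 20000 * X.card ≤ B ^ 2) (hkB : 10 * k ≤ B) :
    ∑ u ∈ X, (X.filter (Cross u)).card ≤ 4 * B * X.card := by
  have hCinj := (RatFunc.C : F →+* RatFunc F).injective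
  have : CharP (RatFunc F) p := charP_of_injective_ringHom hCinj p
  have : Infinite (RatFunc F) := Infinite.of_injective _ (RatFunc.algebraMap_injective F)
  set V := X.image liftA ∪ X.image liftB with hV
  have hVc : V.card ≤ 2 * X.card := by
    refine (Finset.card_union_le _ _).trans ?_
    have h4 := Finset.card_image_le (s := X) (f := liftA)
    have h5 := Finset.card_image_le (s := X) (f := liftB)
    omega
  have key := (isTriangleFree_liftAdj h2).sum_degree_le (p := p) (V := V) (B := B) (k := k) (by
    intro x hx κ κ'
    by_cases hκ : κ = 0 ∧ κ' = 0
    · simp [hκ.1, hκ.2]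
    rcases Finset.mem_union.1 hx with hx | hx <;> obtain ⟨u, hu, rfl⟩ := Finset.mem_image.1 hx
    · refine le_trans ?_ (card_linear_section_le X hk1 hk u (κ := κ) (κ' := κ')
        (κ'' := 1 - κ * (RatFunc.X + RatFunc.C u.2.1 + RatFunc.X) -
          κ' * (RatFunc.C u.1 + RatFunc.X ^ 2 + RatFunc.X ^ 2)) hκ)
      refine (Finset.card_le_card ?_).trans (Finset.card_image_le (f := liftB))
      intro y hy
      rw [Finset.mem_filter] at hy
      obtain ⟨hyV, ⟨v, v', hc, ⟨h3, rfl⟩ | ⟨h3, rfl⟩⟩, hy2⟩ := hy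
      · obtain rfl := liftA_injective h3
        refine Finset.mem_image.2 ⟨v', Finset.mem_filter.2 ⟨?_, hc, ?_⟩, rfl⟩
        · rcases Finset.mem_union.1 hyV with h4 | h4 <;> obtain ⟨w, hw, h5⟩ := Finset.mem_image.1 h4
          · exact absurd (congrArg Prod.fst h5) (liftA_slope_ne h2 _ _)
          · rwa [← liftB_injective h5]
        · simp only [liftA, liftB] at hy2
          linear_combination hy2
      · exact absurd (congrArg Prod.fst h3) (liftA_slope_ne h2 _ _)
    · refine le_trans ?_ (card_linear_section_le X hk1 hk u (κ := -κ) (κ' := -κ')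
        (κ'' := 1 + κ * (RatFunc.X + RatFunc.C u.2.1 + RatFunc.X) +
          κ' * (RatFunc.C u.1 + RatFunc.X ^ 2 + RatFunc.X ^ 2)) (by simpa using hκ))
      refine (Finset.card_le_card ?_).trans (Finset.card_image_le (f := liftA))
      intro y hy
      rw [Finset.mem_filter] at hy
      obtain ⟨hyV, ⟨v, v', hc, ⟨h3, rfl⟩ | ⟨h3, rfl⟩⟩, hy2⟩ := hy
      · exact absurd (congrArg Prod.fst h3).symm (liftA_slope_ne h2 _ _)
      · obtain rfl := liftB_injective h3
        refine Finset.mem_image.2 ⟨v', Finset.mem_filter.2 ⟨?_, hc, ?_⟩, rfl⟩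
        · rcases Finset.mem_union.1 hyV with h4 | h4 <;> obtain ⟨w, hw, h5⟩ := Finset.mem_image.1 h4
          · rwa [← liftA_injective h5]
          · exact absurd (congrArg Prod.fst h5).symm (liftA_slope_ne h2 _ _)
        · simp only [liftA, liftB] at hy2
          linear_combination hy2) (by omega) hkB (by omega)
  calc ∑ u ∈ X, (X.filter (Cross u)).card
      ≤ ∑ u ∈ X, (V.filter (liftAdj (liftA u))).card := by
        refine Finset.sum_le_sum fun u hu => ?_
        rw [← Finset.card_image_of_injective _ liftB_injective]
        refine Finset.card_le_card ?_
        intro y hy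
        obtain ⟨u', hu', rfl⟩ := Finset.mem_image.1 hy
        rw [Finset.mem_filter] at hu' ⊢
        exact ⟨Finset.mem_union_right _ (Finset.mem_image_of_mem _ hu'.1),
          u, u', hu'.2, Or.inl ⟨rfl, rfl⟩⟩
    _ = ∑ x ∈ X.image liftA, (V.filter (liftAdj x)).card := by
        rw [Finset.sum_image liftA_injective.injOn]
    _ ≤ ∑ x ∈ V, (V.filter (liftAdj x)).card :=
        Finset.sum_le_sum_of_subset Finset.subset_union_left
    _ ≤ 2 * B * V.card := key
    _ ≤ 2 * B * (2 * X.card) := Nat.mul_le_mul_left _ hVc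
    _ = 4 * B * X.card := by ring

end CrossingPairs

section Coincidences

variable {α β ι σ : Type*}

theorem card_coincidence (U : Finset α) (V : Finset β) (f : α → ι) (g : β → ι) {I : Finset ι}
    (hI : ∀ u ∈ U, f u ∈ I) :
    ((U ×ˢ V).filter fun q => f q.1 = g q.2).card =
      ∑ i ∈ I, (U.filter fun u => f u = i).card * (V.filter fun v => g v = i).card := by
  rw [Finset.card_eq_sum_card_fiberwise (f := fun q => f q.1) (t := I)]
  · refine Finset.sum_congr rfl fun i _ => ?_
    rw [← Finset.card_product]
    congr 1
    ext ⟨u, v⟩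
    simp only [Finset.mem_filter, Finset.mem_product]
    constructor
    · rintro ⟨⟨⟨h1, h2⟩, h3⟩, h4⟩
      exact ⟨⟨h1, h4⟩, h2, h3.symm.trans h4⟩
    · rintro ⟨⟨h1, h4⟩, h2, h3⟩
      exact ⟨⟨⟨h1, h2⟩, h4.trans h3.symm⟩, h4⟩
  · intro q hq
    exact hI _ (Finset.mem_product.1 (Finset.mem_filter.1 hq).1).1

theorem two_mul_card_coincidence_le (U : Finset α) (V : Finset β) (f : α → ι) (g : β → ι) :
    2 * ((U ×ˢ V).filter fun q => f q.1 = g q.2).card ≤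
      ((U ×ˢ U).filter fun q => f q.1 = f q.2).card +
        ((V ×ˢ V).filter fun q => g q.1 = g q.2).card := by
  have h1 : ∀ u ∈ U, f u ∈ U.image f ∪ V.image g := fun u hu =>
    Finset.mem_union_left _ (Finset.mem_image_of_mem _ hu)
  have h2 : ∀ v ∈ V, g v ∈ U.image f ∪ V.image g := fun v hv =>
    Finset.mem_union_right _ (Finset.mem_image_of_mem _ hv)
  rw [card_coincidence U V f g h1, card_coincidence U U f f h1, card_coincidence V V g g h2,
    Finset.mul_sum, ← Finset.sum_add_distrib]
  refine Finset.sum_le_sum fun i _ => ?_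
  zify
  nlinarith [sq_nonneg (((U.filter fun u => f u = i).card : ℤ) - (V.filter fun v => g v = i).card)]

theorem card_mul_le_of_fibers (U : Finset α) (f : α → ι) (Λ : Finset σ) (e : σ → ι) {s : ℕ}
    (he : Set.InjOn e Λ) (hs : ∀ l ∈ Λ, s ≤ (U.filter fun u => f u = e l).card) :
    Λ.card * s ≤ U.card ∧
      Λ.card * s ^ 2 ≤ ((U ×ˢ U).filter fun q => f q.1 = f q.2).card := by
  have hI : ∀ u ∈ U, f u ∈ U.image f ∪ Λ.image e := fun u hu =>
    Finset.mem_union_left _ (Finset.mem_image_of_mem _ hu)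
  constructor
  · rw [Finset.card_eq_sum_card_fiberwise (f := f) (t := U.image f ∪ Λ.image e) hI]
    calc Λ.card * s ≤ ∑ l ∈ Λ, (U.filter fun u => f u = e l).card := by
          rw [← smul_eq_mul]; exact Finset.card_nsmul_le_sum _ _ _ hs
      _ = ∑ i ∈ Λ.image e, (U.filter fun u => f u = i).card := by rw [Finset.sum_image he]
      _ ≤ _ := Finset.sum_le_sum_of_subset Finset.subset_union_right
  · rw [card_coincidence U U f f hI]
    calc Λ.card * s ^ 2 ≤ ∑ l ∈ Λ, (U.filter fun u => f u = e l).card *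
            (U.filter fun u => f u = e l).card := by
          rw [← smul_eq_mul]
          refine Finset.card_nsmul_le_sum _ _ _ fun l hl => ?_
          rw [sq]
          exact Nat.mul_le_mul (hs l hl) (hs l hl)
      _ = ∑ i ∈ Λ.image e, (U.filter fun u => f u = i).card * (U.filter fun u => f u = i).card := by
          rw [Finset.sum_image he]
      _ ≤ _ := Finset.sum_le_sum_of_subset Finset.subset_union_right

end Coincidences

section Pencils

variable {F : Type*} [Field F]

theorem card_diff_coincidence_le (A : Finset F) {m : F} (hm : m ≠ 0) :
    (((A ×ˢ A) ×ˢ A ×ˢ A).filter fun q =>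
      q.1.2 - m * q.1.1 = q.2.2 - m * q.2.1).card ≤ addE F A A := by
  have self : ∀ d : F, d ≠ 0 → (((A ×ˢ A) ×ˢ A ×ˢ A).filter fun q =>
      d * (q.1.1 - q.1.2) = d * (q.2.1 - q.2.2)).card ≤ addE F A A := by
    intro d hd
    refine Finset.card_le_card_of_injOn (Equiv.prodProdProdComm F F F F) ?_
      (Equiv.injective _).injOn
    intro q hq
    simp only [Finset.coe_filter, Finset.mem_product, Set.mem_ofPred_eq,
      Equiv.prodProdProdComm_apply] at hq ⊢
    exact ⟨⟨⟨hq.1.1.1, hq.1.2.1⟩, hq.1.1.2, hq.1.2.2⟩, mul_left_cancel₀ hd hq.2⟩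
  have h1 := two_mul_card_coincidence_le (A ×ˢ A) (A ×ˢ A) (fun q => m * (q.1 - q.2))
    (fun q => 1 * (q.1 - q.2))
  have h2 := self m hm
  have h3 := self 1 one_ne_zero
  refine le_trans (Finset.card_le_card_of_injOn (Equiv.prodProdProdComm F F F F) ?_
      (Equiv.injective _).injOn) (show (((A ×ˢ A) ×ˢ A ×ˢ A).filter fun q =>
        m * (q.1.1 - q.1.2) = 1 * (q.2.1 - q.2.2)).card ≤ _ by omega)
  intro q hq
  simp only [Finset.coe_filter, Finset.mem_product, Set.mem_ofPred_eq,
    Equiv.prodProdProdComm_apply] at hq ⊢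
  exact ⟨⟨⟨hq.1.1.1, hq.1.2.1⟩, hq.1.1.2, hq.1.2.2⟩, by linear_combination -hq.2⟩

theorem card_div_coincidence_le (A : Finset F) (x y : F) {E : ℕ}
    (hE : ∀ s : F, mulE F (A.image fun a => a - s) (A.image fun a => a - s) ≤ E) :
    (((A.erase x ×ˢ A.erase y) ×ˢ A.erase x ×ˢ A.erase y).filter fun q =>
      (q.1.2 - y) / (q.1.1 - x) = (q.2.2 - y) / (q.2.1 - x)).card ≤ E := by
  have self : ∀ s : F, (((A.erase s ×ˢ A.erase s) ×ˢ A.erase s ×ˢ A.erase s).filter fun q =>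
      (q.1.1 - s) / (q.1.2 - s) = (q.2.1 - s) / (q.2.2 - s)).card ≤ E := by
    intro s
    have hinj : Function.Injective fun a : F => a - s := sub_left_injective
    refine le_trans (Finset.card_le_card_of_injOn (fun q => Equiv.prodProdProdComm F F F F
      (Prod.map (Prod.map (· - s) (· - s)) (Prod.map (· - s) (· - s)) q)) ?_
      ((Equiv.injective _).comp ((hinj.prodMap hinj).prodMap (hinj.prodMap hinj))).injOn) (hE s)
    intro q hq
    simp only [Finset.coe_filter, Finset.mem_product, Set.mem_ofPred_eq,
      Equiv.prodProdProdComm_apply, Prod.map_fst, Prod.map_snd, Finset.mem_erase] at hq ⊢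
    obtain ⟨⟨⟨h1, h2⟩, h3, h4⟩, h5⟩ := hq
    refine ⟨⟨⟨Finset.mem_image_of_mem _ h1.2, Finset.mem_image_of_mem _ h3.2⟩,
      Finset.mem_image_of_mem _ h2.2, Finset.mem_image_of_mem _ h4.2⟩, ?_⟩
    rwa [div_eq_div_iff (sub_ne_zero.2 h2.1) (sub_ne_zero.2 h4.1)] at h5
  have h1 := two_mul_card_coincidence_le (A.erase x ×ˢ A.erase x) (A.erase y ×ˢ A.erase y)
    (fun q => (q.1 - x) / (q.2 - x)) (fun q => (q.1 - y) / (q.2 - y))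
  have h2 := self x
  have h3 := self y
  refine le_trans (Finset.card_le_card_of_injOn (Equiv.prodProdProdComm F F F F) ?_
      (Equiv.injective _).injOn)
      (show (((A.erase x ×ˢ A.erase x) ×ˢ A.erase y ×ˢ A.erase y).filter fun q =>
        (q.1.1 - x) / (q.1.2 - x) = (q.2.1 - y) / (q.2.2 - y)).card ≤ _ by omega)
  intro q hq
  simp only [Finset.coe_filter, Finset.mem_product, Set.mem_ofPred_eq,
    Equiv.prodProdProdComm_apply] at hq ⊢
  obtain ⟨⟨⟨h1, h2⟩, h3, h4⟩, h5⟩ := hq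
  refine ⟨⟨⟨h1, h3⟩, h2, h4⟩, ?_⟩
  have e1 := sub_ne_zero.2 (Finset.ne_of_mem_erase h1)
  have e3 := sub_ne_zero.2 (Finset.ne_of_mem_erase h3)
  have e4 := sub_ne_zero.2 (Finset.ne_of_mem_erase h4)
  rw [div_eq_div_iff e1 e3] at h5
  rw [div_eq_div_iff e3 e4]
  linear_combination -h5

theorem nPts_le_card_slope_fiber (A : Finset F) (x y : F) {l : F × F} (hl : l.1 ≠ 0)
    (hxy : y = l.1 * x + l.2) : nPts A A l ≤
      ((A.erase x ×ˢ A.erase y).filter fun q => (q.2 - y) / (q.1 - x) = l.1).card + 1 := by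
  rw [← Finset.card_singleton (x, y)]
  refine le_trans (Finset.card_le_card ?_) (Finset.card_union_le _ _)
  intro q hq
  simp only [Finset.mem_filter, Finset.mem_product, Finset.mem_union, Finset.mem_erase,
    Finset.mem_singleton] at hq ⊢
  by_cases hx : q.1 = x
  · exact Or.inr (Prod.ext hx (by rw [hq.2, hx, hxy]))
  · have hx' := sub_ne_zero.2 hx
    have e : q.2 - y = l.1 * (q.1 - x) := by rw [hq.2, hxy]; ring
    refine Or.inl ⟨⟨⟨hx, hq.1.1⟩, fun h => ?_, hq.1.2⟩, by rw [e, mul_div_cancel_right₀ _ hx']⟩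
    rw [h, sub_self] at e
    exact mul_ne_zero hl hx' e.symm

/-- Bounds for the number of rich lines in a pencil. -/
theorem card_pencil_le (A : Finset F) {E t : ℕ} (ht : 2 ≤ t) (L : Finset (F × F))
    (hL : ∀ l ∈ L, l.1 ≠ 0 ∧ t ≤ nPts A A l) (hadd : addE F A A ≤ E)
    (hmul : ∀ s : F, mulE F (A.image fun a => a - s) (A.image fun a => a - s) ≤ E)
    (P w : F × F) :
    (L.filter fun l => ∃ s : F, l = P + s • w).card * t ≤ 2 * A.card ^ 2 ∧
      (L.filter fun l => ∃ s : F, l = P + s • w).card * t ^ 2 ≤ 4 * E := by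
  set Λ := L.filter fun l => ∃ s : F, l = P + s • w with hΛ
  by_cases hw1 : w.1 = 0
  · have hfst : ∀ l ∈ Λ, l.1 = P.1 := by
      intro l hl
      obtain ⟨-, s, rfl⟩ := Finset.mem_filter.1 hl
      simp [hw1]
    by_cases hP : P.1 = 0
    · have : Λ = ∅ := by
        refine Finset.eq_empty_of_forall_notMem fun l hl => (hL l (Finset.mem_filter.1 hl).1).1 ?_
        rw [hfst l hl, hP]
      simp [this]
    have h1 := card_mul_le_of_fibers (A ×ˢ A) (fun q => q.2 - P.1 * q.1) Λ Prod.snd (s := t)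
      (fun l hl l' hl' h => Prod.ext ((hfst l hl).trans (hfst l' hl').symm) h) (by
        intro l hl
        refine (hL l (Finset.mem_filter.1 hl).1).2.trans (Finset.card_le_card ?_)
        intro q hq
        rw [Finset.mem_filter] at hq ⊢
        refine ⟨hq.1, ?_⟩
        rw [hq.2, hfst l hl]
        ring)
    have h2 := h1.2.trans (card_diff_coincidence_le A hP)
    have h3 := h1.1
    rw [Finset.card_product, ← sq] at h3
    exact ⟨by omega, by omega⟩
  · set x := -(w.2 / w.1) with hx
    set y := P.1 * x + P.2 with hy
    have hthru : ∀ l ∈ Λ, y = l.1 * x + l.2 := by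
      intro l hl
      obtain ⟨-, s, rfl⟩ := Finset.mem_filter.1 hl
      rw [hy, hx]
      simp only [Prod.fst_add, Prod.snd_add, Prod.smul_fst, Prod.smul_snd, smul_eq_mul]
      field_simp
      ring
    obtain ⟨r, rfl⟩ : ∃ r, t = r + 1 := ⟨t - 1, by omega⟩
    have h1 := card_mul_le_of_fibers (A.erase x ×ˢ A.erase y)
      (fun q => (q.2 - y) / (q.1 - x)) Λ Prod.fst (s := r)
      (fun l hl l' hl' h => Prod.ext h (by
        have e1 := hthru l hl
        have e2 := hthru l' hl'
        linear_combination e2 - e1 - x * h)) (by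
        intro l hl
        have h2 := hL l (Finset.mem_filter.1 hl).1
        have h3 := nPts_le_card_slope_fiber A x y h2.1 (hthru l hl)
        omega)
    have h2 := h1.2.trans (card_div_coincidence_le A x y hmul)
    have h3 : Λ.card * r ≤ A.card * A.card :=
      h1.1.trans ((Finset.card_product _ _).trans_le (Nat.mul_le_mul
        (Finset.card_le_card (Finset.erase_subset _ _))
        (Finset.card_le_card (Finset.erase_subset _ _))))
    constructor
    · nlinarith
    · have : (r + 1) ^ 2 ≤ 4 * r ^ 2 := by nlinarith
      calc Λ.card * (r + 1) ^ 2 ≤ Λ.card * (4 * r ^ 2) := Nat.mul_le_mul_left _ this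
        _ = 4 * (Λ.card * r ^ 2) := by ring
        _ ≤ 4 * E := Nat.mul_le_mul_left _ h2

end Pencils

section Incidences

variable {F : Type*} [Field F]

theorem sum_nPts_sub_le (A : Finset F) (L : Finset (F × F)) :
    ∑ l ∈ L, (nPts A A l * nPts A A l - nPts A A l) ≤ A.card ^ 4 := by
  calc ∑ l ∈ L, (nPts A A l * nPts A A l - nPts A A l)
      = ∑ l ∈ L, ((A ×ˢ A).filter fun q => q.2 = l.1 * q.1 + l.2).offDiag.card :=
        Finset.sum_congr rfl fun l _ => (Finset.offDiag_card _).symm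
    _ = (L.biUnion fun l => ((A ×ˢ A).filter fun q => q.2 = l.1 * q.1 + l.2).offDiag).card := by
        refine (Finset.card_biUnion ?_).symm
        intro l _ l' _ hne
        rw [Function.onFun, Finset.disjoint_left]
        rintro ⟨q, q'⟩ h h'
        rw [Finset.mem_offDiag, Finset.mem_filter, Finset.mem_filter] at h h'
        obtain ⟨⟨-, h1⟩, ⟨-, h2⟩, h3⟩ := h
        obtain ⟨⟨-, h4⟩, ⟨-, h5⟩, -⟩ := h'
        dsimp only at h1 h2 h3 h4 h5
        have hx : q.1 - q'.1 ≠ 0 := by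
          rw [sub_ne_zero]
          exact fun hx => h3 (Prod.ext hx (by rw [h1, h2, hx]))
        have hm : l.1 = l'.1 := by
          apply mul_right_cancel₀ hx
          linear_combination h2 - h1 - h5 + h4
        exact hne (Prod.ext hm (by linear_combination h4 - h1 - q.1 * hm))
    _ ≤ ((A ×ˢ A) ×ˢ A ×ˢ A).card := by
        refine Finset.card_le_card (Finset.biUnion_subset.2 fun l _ q hq => ?_)
        rw [Finset.mem_offDiag, Finset.mem_filter, Finset.mem_filter] at hq
        exact Finset.mem_product.2 ⟨hq.1.1, hq.2.1.1⟩
    _ = A.card ^ 4 := by simp only [Finset.card_product]; ring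

theorem card_rich_mul_sq_le (A : Finset F) {t : ℕ} (ht : 2 ≤ t) (L : Finset (F × F))
    (hL : ∀ l ∈ L, t ≤ nPts A A l) : L.card * t ^ 2 ≤ 2 * A.card ^ 4 := by
  have h1 : L.card * t ^ 2 ≤ ∑ l ∈ L, 2 * (nPts A A l * nPts A A l - nPts A A l) := by
    rw [← smul_eq_mul]
    refine Finset.card_nsmul_le_sum _ _ _ fun l hl => ?_
    obtain ⟨r, hr⟩ := Nat.exists_eq_add_of_le (hL l hl)
    have : t ^ 2 + 2 * (t + r) ≤ 2 * ((t + r) * (t + r)) := by nlinarith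
    rw [hr]
    omega
  rw [← Finset.mul_sum] at h1
  have := sum_nPts_sub_le A L
  omega

theorem sum_nPts_univ [Fintype F] (A : Finset F) :
    ∑ l : F × F, nPts A A l = Fintype.card F * A.card ^ 2 := by
  calc ∑ l : F × F, nPts A A l
      = ∑ l : F × F, ∑ q ∈ A ×ˢ A, if q.2 = l.1 * q.1 + l.2 then 1 else 0 :=
        Finset.sum_congr rfl fun l _ => Finset.card_filter _ _
    _ = ∑ q ∈ A ×ˢ A, ∑ l : F × F, if q.2 = l.1 * q.1 + l.2 then 1 else 0 := Finset.sum_comm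
    _ = ∑ q ∈ A ×ˢ A, Fintype.card F := by
        refine Finset.sum_congr rfl fun q _ => ?_
        rw [Fintype.sum_prod_type]
        have : ∀ m : F, (∑ c : F, if q.2 = m * q.1 + c then 1 else 0) = 1 := by
          intro m
          rw [Finset.sum_eq_single (q.2 - m * q.1)]
          · simp
          · intro c _ hc
            exact if_neg fun h => hc (by rw [h]; ring)
          · simp
        simp [this]
    _ = _ := by rw [Finset.sum_const, Finset.card_product, smul_eq_mul]; ring

/-- Second moment of the number of points of `A × A` on a line. -/
theorem sum_nPts_sub_mean_sq_le [Fintype F] (A : Finset F) :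
    ∑ l : F × F, ((nPts A A l : ℝ) - (A.card : ℝ) ^ 2 / Fintype.card F) ^ 2 ≤
      Fintype.card F * (A.card : ℝ) ^ 2 := by
  have hq : (0 : ℝ) < Fintype.card F := by exact_mod_cast Fintype.card_pos
  have h1 : (∑ l : F × F, (nPts A A l : ℝ)) = Fintype.card F * (A.card : ℝ) ^ 2 := by
    exact_mod_cast sum_nPts_univ A
  have h2 : (∑ l : F × F, ((nPts A A l : ℝ) * nPts A A l - nPts A A l)) ≤ (A.card : ℝ) ^ 4 := by
    have h3 : ∑ l : F × F, ((nPts A A l * nPts A A l - nPts A A l : ℕ) : ℝ) ≤ (A.card : ℝ) ^ 4 := by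
      exact_mod_cast sum_nPts_sub_le A Finset.univ
    refine le_trans (le_of_eq (Finset.sum_congr rfl fun l _ => ?_)) h3
    rw [Nat.cast_sub (Nat.le_mul_self _), Nat.cast_mul]
  rw [Finset.sum_sub_distrib, h1] at h2
  have h4 : ∑ l : F × F, ((nPts A A l : ℝ) - (A.card : ℝ) ^ 2 / Fintype.card F) ^ 2 =
      ∑ l : F × F, (nPts A A l : ℝ) * nPts A A l -
        2 * ((A.card : ℝ) ^ 2 / Fintype.card F) * ∑ l : F × F, (nPts A A l : ℝ) +
        Fintype.card F * Fintype.card F * ((A.card : ℝ) ^ 2 / Fintype.card F) ^ 2 := by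
    rw [Finset.mul_sum, ← Finset.sum_sub_distrib]
    have : (Fintype.card F * Fintype.card F * ((A.card : ℝ) ^ 2 / Fintype.card F) ^ 2 : ℝ) =
        ∑ l : F × F, ((A.card : ℝ) ^ 2 / Fintype.card F) ^ 2 := by
      simp [Fintype.card_prod]
    rw [this, ← Finset.sum_add_distrib]
    exact Finset.sum_congr rfl fun l _ => by ring
  have h5 : (Fintype.card F * Fintype.card F * ((A.card : ℝ) ^ 2 / Fintype.card F) ^ 2 : ℝ) =
      (A.card : ℝ) ^ 4 := by field_simp
  have h6 : 2 * ((A.card : ℝ) ^ 2 / Fintype.card F) * (Fintype.card F * (A.card : ℝ) ^ 2) =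
      2 * (A.card : ℝ) ^ 4 := by field_simp
  rw [h4, h1, h5, h6]
  linarith

theorem card_rich_mul_sq_le_of_large [Fintype F] (A : Finset F) {t : ℕ} (L : Finset (F × F))
    (hL : ∀ l ∈ L, t ≤ nPts A A l) (ht : 2 * A.card ^ 2 ≤ t * Fintype.card F) :
    L.card * t ^ 2 ≤ 4 * (Fintype.card F * A.card ^ 2) := by
  have hq : (0 : ℝ) < Fintype.card F := by exact_mod_cast Fintype.card_pos
  have ht' : (A.card : ℝ) ^ 2 / Fintype.card F ≤ t / 2 := by
    rw [div_le_div_iff₀ hq two_pos]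
    have : (2 * A.card ^ 2 : ℝ) ≤ t * Fintype.card F := by exact_mod_cast ht
    linarith
  have h1 : (L.card : ℝ) * ((t : ℝ) / 2) ^ 2 ≤
      ∑ l ∈ L, ((nPts A A l : ℝ) - (A.card : ℝ) ^ 2 / Fintype.card F) ^ 2 := by
    rw [← nsmul_eq_mul]
    refine Finset.card_nsmul_le_sum _ _ _ fun l hl => ?_
    have : (t : ℝ) ≤ nPts A A l := by exact_mod_cast hL l hl
    gcongr
    linarith
  have h2 := h1.trans ((Finset.sum_le_sum_of_subset_of_nonneg (Finset.subset_univ L)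
    fun _ _ _ => sq_nonneg _).trans (sum_nPts_sub_mean_sq_le A))
  have h3 : (L.card * t ^ 2 : ℝ) ≤ 4 * (Fintype.card F * (A.card : ℝ) ^ 2) := by linarith
  exact_mod_cast h3

theorem sum_card_cross_sq_le {p : ℕ} [CharP F p] (h2 : (2 : F) ≠ 0) (X : Finset (F × F × F)) {k : ℕ}
    (hk1 : 1 ≤ k)
    (hk : ∀ u v : F × F × F, v ≠ 0 → (X.filter fun x => ∃ t : F, x = u + t • v).card ≤ k)
    (hX : X.card ≤ p ^ 2) :
    (∑ u ∈ X, (X.filter (Cross u)).card) ^ 2 ≤ 10 ^ 6 * ((X.card + k ^ 2) * X.card ^ 2) := by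
  obtain ⟨s, hs⟩ : ∃ s, s = Nat.sqrt X.card := ⟨_, rfl⟩
  have hs1 : s * s ≤ X.card := hs ▸ Nat.sqrt_le _
  have hs2 : X.card < (s + 1) * (s + 1) := hs ▸ Nat.lt_succ_sqrt _
  have h := sum_card_cross_le (p := p) h2 X (k := k) (B := 10 * k + 142 * (s + 1)) hk1 hk hX
    (by nlinarith) (by omega)
  have h3 : 4 * (10 * k + 142 * (s + 1)) ≤ 608 * (k + s) := by omega
  calc _ ≤ (608 * (k + s) * X.card) ^ 2 := by
        refine Nat.pow_le_pow_left (h.trans ?_) 2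
        exact Nat.mul_le_mul_right _ h3
    _ = (608 ^ 2 * (k + s) ^ 2) * X.card ^ 2 := by ring
    _ ≤ (10 ^ 6 * (X.card + k ^ 2)) * X.card ^ 2 := by
        refine Nat.mul_le_mul_right _ ?_
        zify at hs1 ⊢
        nlinarith [sq_nonneg ((k : ℤ) - s)]
    _ = _ := by ring

/-- Quadruples `(l, x), (l', x')` with `l x = l' x'`. -/
noncomputable def valueCoincidences (A : Finset F) (L : Finset (F × F)) : ℕ :=
  (((L ×ˢ A) ×ˢ L ×ˢ A).filter fun q =>
    q.1.1.1 * q.1.2 + q.1.1.2 = q.2.1.1 * q.2.2 + q.2.1.2).card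

theorem nPts_eq_card (A : Finset F) (l : F × F) :
    nPts A A l = (A.filter fun x => l.1 * x + l.2 ∈ A).card := by
  refine Finset.card_nbij' (fun q => q.1) (fun x => (x, l.1 * x + l.2)) ?_ ?_ ?_ ?_
  · intro q hq
    simp only [Finset.coe_filter, Finset.mem_product, Set.mem_ofPred_eq] at hq ⊢
    exact ⟨hq.1.1, hq.2 ▸ hq.1.2⟩
  · intro x hx
    simp only [Finset.coe_filter, Finset.mem_product, Set.mem_ofPred_eq] at hx ⊢
    exact ⟨hx, trivial⟩
  · intro q hq
    exact Prod.ext rfl (Finset.mem_filter.1 hq).2.symm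
  · intro x _
    rfl

theorem card_rich_sq_le_valueCoincidences (A : Finset F) {t : ℕ} (L : Finset (F × F))
    (hL : ∀ l ∈ L, t ≤ nPts A A l) :
    (L.card * t) ^ 2 ≤ A.card * valueCoincidences A L := by
  set h : (F × F) × F → F := fun u => u.1.1 * u.2 + u.1.2 with hh
  have h1 : L.card * t ≤ ∑ y ∈ A, ((L ×ˢ A).filter fun u => h u = y).card := by
    calc L.card * t ≤ ∑ l ∈ L, nPts A A l := by
          rw [← smul_eq_mul]; exact Finset.card_nsmul_le_sum _ _ _ hL
      _ = ((L ×ˢ A).filter fun u => h u ∈ A).card := by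
          rw [Finset.card_eq_sum_card_fiberwise (f := Prod.fst) (t := L)
            fun u hu => (Finset.mem_product.1 (Finset.mem_filter.1 hu).1).1]
          refine Finset.sum_congr rfl fun l hl => ?_
          rw [nPts_eq_card]
          refine Finset.card_nbij' (fun x => (l, x)) Prod.snd ?_ ?_ ?_ ?_
          · intro x hx
            simpa [hl, hh] using hx
          · rintro ⟨l', x⟩ hx
            simp only [Finset.coe_filter, Finset.mem_filter, Finset.mem_product,
              Set.mem_ofPred_eq] at hx ⊢
            obtain ⟨⟨⟨-, h3⟩, h4⟩, rfl⟩ := hx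
            exact ⟨h3, h4⟩
          · intro x _
            rfl
          · rintro ⟨l', x⟩ hx
            exact Prod.ext (Finset.mem_filter.1 hx).2.symm rfl
      _ = ∑ y ∈ A, ((L ×ˢ A).filter fun u => h u = y).card := by
          rw [Finset.card_eq_sum_card_fiberwise (f := h) (t := A)
            (s := (L ×ˢ A).filter fun u => h u ∈ A) fun u hu => (Finset.mem_filter.1 hu).2]
          refine Finset.sum_congr rfl fun y hy => ?_
          rw [Finset.filter_filter]
          congr 1
          ext u
          simp only [Finset.mem_filter]
          exact and_congr_right fun _ => ⟨fun h3 => h3.2, fun h3 => ⟨h3 ▸ hy, h3⟩⟩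
  calc (L.card * t) ^ 2 ≤ (∑ y ∈ A, ((L ×ˢ A).filter fun u => h u = y).card) ^ 2 :=
        Nat.pow_le_pow_left h1 2
    _ ≤ A.card * ∑ y ∈ A, ((L ×ˢ A).filter fun u => h u = y).card ^ 2 := sq_sum_le_card_mul_sum_sq
    _ ≤ A.card * valueCoincidences A L := by
        refine Nat.mul_le_mul_left _ ?_
        unfold valueCoincidences
        rw [card_coincidence (L ×ˢ A) (L ×ˢ A) h h (I := (L ×ˢ A).image h ∪ A) fun u hu =>
          Finset.mem_union_left _ (Finset.mem_image_of_mem _ hu)]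
        simp only [sq]
        exact Finset.sum_le_sum_of_subset Finset.subset_union_right

end Incidences

section Energies

variable {F : Type*} [Field F]

theorem card_cross_pairs_sq_le {p : ℕ} [CharP F p] (h2 : (2 : F) ≠ 0) (X : Finset (F × F × F))
    {k : ℕ} (hk1 : 1 ≤ k)
    (hk : ∀ u v : F × F × F, v ≠ 0 → (X.filter fun x => ∃ t : F, x = u + t • v).card ≤ k)
    (hX : X.card ≤ p ^ 2) :
    ((X ×ˢ X).filter fun q => Cross q.1 q.2).card ^ 2 ≤
      10 ^ 6 * ((X.card + k ^ 2) * X.card ^ 2) := by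
  have h : ((X ×ˢ X).filter fun q => Cross q.1 q.2).card = ∑ u ∈ X, (X.filter (Cross u)).card := by
    simp only [Finset.card_filter, Finset.sum_product]
  rw [h]
  exact sum_card_cross_sq_le h2 X hk1 hk hX

theorem valueCoincidences_sq_le {p : ℕ} [CharP F p] (h2 : (2 : F) ≠ 0) (A : Finset F)
    (L : Finset (F × F)) {k : ℕ} (hk1 : 1 ≤ k) (hAk : A.card ≤ k)
    (hk : ∀ P w : F × F, (L.filter fun l => ∃ s : F, l = P + s • w).card ≤ k)
    (hX : A.card * L.card ≤ p ^ 2) :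
    valueCoincidences A L ^ 2 ≤
      10 ^ 6 * ((A.card * L.card + k ^ 2) * (A.card * L.card) ^ 2) := by
  set φ : (F × F) × F → F × F × F := fun q => (q.1.1, q.2, q.1.2) with hφ
  have hinj : Function.Injective φ := by
    rintro ⟨⟨a, b⟩, c⟩ ⟨⟨a', b'⟩, c'⟩ h
    simp only [hφ, Prod.mk.injEq] at h ⊢
    tauto
  set X := (L ×ˢ A).image φ with hXdef
  have hXc : X.card = A.card * L.card := by
    rw [hXdef, Finset.card_image_of_injective _ hinj, Finset.card_product, mul_comm]
  have hmem : ∀ x : F × F × F, x ∈ X ↔ (x.1, x.2.2) ∈ L ∧ x.2.1 ∈ A := by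
    intro x
    rw [hXdef, Finset.mem_image]
    constructor
    · rintro ⟨q, hq, rfl⟩
      exact Finset.mem_product.1 hq
    · intro h
      exact ⟨((x.1, x.2.2), x.2.1), Finset.mem_product.2 h, rfl⟩
  have hline : ∀ u v : F × F × F, v ≠ 0 →
      (X.filter fun x => ∃ t : F, x = u + t • v).card ≤ k := by
    intro u v hv
    by_cases hv0 : v.1 = 0 ∧ v.2.2 = 0
    · refine le_trans ?_ hAk
      refine Finset.card_le_card_of_injOn (fun x => x.2.1) ?_ ?_
      · intro x hx
        exact ((hmem x).1 (Finset.mem_filter.1 hx).1).2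
      · intro x hx y hy hxy
        obtain ⟨-, s, rfl⟩ := Finset.mem_filter.1 hx
        obtain ⟨-, s', rfl⟩ := Finset.mem_filter.1 hy
        refine Prod.ext ?_ (Prod.ext hxy ?_)
        · simp [hv0.1]
        · simp [hv0.2]
    · refine le_trans ?_ (hk (u.1, u.2.2) (v.1, v.2.2))
      refine Finset.card_le_card_of_injOn (fun x => (x.1, x.2.2)) ?_ ?_
      · intro x hx
        obtain ⟨hx, s, rfl⟩ := Finset.mem_filter.1 hx
        exact Finset.mem_filter.2 ⟨((hmem _).1 hx).1, s, rfl⟩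
      · intro x hx y hy hxy
        obtain ⟨-, s, rfl⟩ := Finset.mem_filter.1 hx
        obtain ⟨-, s', rfl⟩ := Finset.mem_filter.1 hy
        simp only [Prod.fst_add, Prod.snd_add, Prod.smul_fst, Prod.smul_snd, smul_eq_mul,
          Prod.mk.injEq, add_right_inj, mul_eq_mul_right_iff] at hxy
        have : s = s' := by tauto
        rw [this]
  rw [← hXc]
  refine le_trans (Nat.pow_le_pow_left ?_ 2)
    (card_cross_pairs_sq_le (p := p) h2 X hk1 hline (hXc.trans_le hX))
  refine Finset.card_le_card_of_injOn
    (fun q => ((q.1.1.1, q.2.2, q.1.1.2), (q.2.1.1, q.1.2, q.2.1.2))) ?_ ?_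
  · intro q hq
    simp only [Finset.coe_filter, Finset.mem_product, Set.mem_ofPred_eq, hmem] at hq ⊢
    obtain ⟨⟨⟨h3, h4⟩, h5, h6⟩, h7⟩ := hq
    refine ⟨⟨⟨h3, h6⟩, h5, h4⟩, ?_⟩
    unfold Cross
    linear_combination -h7
  · rintro ⟨⟨⟨a, b⟩, c⟩, ⟨a', b'⟩, c'⟩ - ⟨⟨⟨d, e⟩, f⟩, ⟨d', e'⟩, f'⟩ - h
    simp only [Prod.mk.injEq] at h ⊢
    tauto

/-- The affine map `l⁻¹ ∘ l'`. -/
noncomputable def affQuot (q : (F × F) × F × F) : F × F :=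
  (q.2.1 / q.1.1, (q.2.2 - q.1.2) / q.1.1)

/-- Energy of the family of maps `l⁻¹ ∘ l'`. -/
noncomputable def quotEnergy (L : Finset (F × F)) : ℕ :=
  (((L ×ˢ L) ×ˢ L ×ˢ L).filter fun q => affQuot q.1 = affQuot q.2).card

theorem quotEnergy_sq_le {p : ℕ} [CharP F p] (h2 : (2 : F) ≠ 0)
    (L : Finset (F × F)) (hL : ∀ l ∈ L, l.1 ≠ 0) {M : ℕ} (hM1 : 1 ≤ M)
    (hM : ∀ P w : F × F, (L.filter fun l => ∃ s : F, l = P + s • w).card ≤ M)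
    (hX : M * L.card ≤ p ^ 2) :
    quotEnergy L ^ 2 ≤ 10 ^ 6 * ((M * L.card + M ^ 2) * L.card ^ 4) := by
  set φ : (F × F) × F × F → F × F × F := fun q => (q.1.1, q.1.2, -(q.1.1 * q.2.2)) with hφ
  set Y : F → Finset ((F × F) × F × F) := fun π => (L ×ˢ L).filter fun q => q.1.1 * q.2.1 = π
    with hY
  have hslope : ∀ a : F, (L.filter fun l => l.1 = a).card ≤ M := by
    intro a
    refine (Finset.card_le_card fun l hl => ?_).trans (hM (a, 0) (0, 1))
    rw [Finset.mem_filter] at hl ⊢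
    exact ⟨hl.1, l.2, Prod.ext (by simp [hl.2]) (by simp)⟩
  have hYc : ∀ π, (Y π).card ≤ M * L.card := by
    intro π
    rw [Finset.card_eq_sum_card_fiberwise (f := Prod.fst) (s := Y π) (t := L)
      fun q hq => (Finset.mem_product.1 (Finset.mem_filter.1 hq).1).1, mul_comm, ← smul_eq_mul]
    refine Finset.sum_le_card_nsmul _ _ _ fun l hl => ?_
    refine (Finset.card_le_card_of_injOn Prod.snd ?_ ?_).trans (hslope (π / l.1))
    · intro q hq
      obtain ⟨hqY, rfl⟩ := Finset.mem_filter.1 hq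
      obtain ⟨hqL, hπ⟩ := Finset.mem_filter.1 hqY
      refine Finset.mem_filter.2 ⟨(Finset.mem_product.1 hqL).2, ?_⟩
      rw [← hπ, mul_div_cancel_left₀ _ (hL _ hl)]
    · intro q hq q' hq' h
      exact Prod.ext ((Finset.mem_filter.1 hq).2.trans (Finset.mem_filter.1 hq').2.symm) h
  have hline : ∀ π : F, π ≠ 0 → ∀ u v : F × F × F, v ≠ 0 →
      (((Y π).image φ).filter fun x => ∃ t : F, x = u + t • v).card ≤ M := by
    intro π hπ u v hv
    by_cases hv0 : v.1 = 0 ∧ v.2.1 = 0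
    · refine le_trans ?_ (hslope (π / u.1))
      refine Finset.card_le_card_of_injOn (fun x => (π / u.1, -x.2.2 / u.1)) ?_ ?_
      · intro x hx
        obtain ⟨hx, s, hs⟩ := Finset.mem_filter.1 hx
        obtain ⟨q, hq, rfl⟩ := Finset.mem_image.1 hx
        obtain ⟨hq, hqπ⟩ := Finset.mem_filter.1 hq
        rw [Finset.mem_product] at hq
        have h3 : q.1.1 = u.1 := by
          have := congrArg Prod.fst hs
          simpa [hφ, hv0.1] using this
        have h4 := hL _ hq.1
        have h5 : (π / u.1, -(φ q).2.2 / u.1) = q.2 := by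
          refine Prod.ext ?_ ?_
          · simp only
            rw [← hqπ, ← h3, mul_div_cancel_left₀ _ h4]
          · simp only [hφ, neg_neg]
            rw [← h3, mul_div_cancel_left₀ _ h4]
        refine Finset.mem_filter.2 ⟨?_, rfl⟩
        exact (congrArg (· ∈ L) h5).mpr hq.2
      · intro x hx y hy hxy
        obtain ⟨hx, s, hs⟩ := Finset.mem_filter.1 hx
        obtain ⟨-, s', hs'⟩ := Finset.mem_filter.1 hy
        obtain ⟨q, hq, rfl⟩ := Finset.mem_image.1 hx
        have h3 : q.1.1 = u.1 := by
          have := congrArg Prod.fst hs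
          simpa [hφ, hv0.1] using this
        have h4 : u.1 ≠ 0 := h3 ▸ hL _ (Finset.mem_product.1 (Finset.mem_filter.1 hq).1).1
        refine Prod.ext ?_ (Prod.ext ?_ ?_)
        · rw [hs, hs']; simp [hv0.1]
        · rw [hs, hs']; simp [hv0.2]
        · have h5 := congrArg Prod.snd hxy
          simp only at h5
          rw [div_left_inj' h4] at h5
          exact neg_injective h5
    · refine le_trans ?_ (hM (u.1, u.2.1) (v.1, v.2.1))
      refine Finset.card_le_card_of_injOn (fun x => (x.1, x.2.1)) ?_ ?_
      · intro x hx
        obtain ⟨hx, s, hs⟩ := Finset.mem_filter.1 hx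
        obtain ⟨q, hq, rfl⟩ := Finset.mem_image.1 hx
        refine Finset.mem_filter.2 ⟨(Finset.mem_product.1 (Finset.mem_filter.1 hq).1).1, s, ?_⟩
        rw [hs]
        rfl
      · intro x hx y hy hxy
        obtain ⟨-, s, rfl⟩ := Finset.mem_filter.1 hx
        obtain ⟨-, s', rfl⟩ := Finset.mem_filter.1 hy
        simp only [Prod.fst_add, Prod.snd_add, Prod.smul_fst, Prod.smul_snd, smul_eq_mul,
          Prod.mk.injEq, add_right_inj, mul_eq_mul_right_iff] at hxy
        have : s = s' := by tauto
        rw [this]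
  set I := (L ×ˢ L).image fun q => q.1.1 * q.2.1 with hI
  have hI0 : ∀ π ∈ I, π ≠ 0 := by
    intro π hπ
    obtain ⟨q, hq, rfl⟩ := Finset.mem_image.1 hπ
    rw [Finset.mem_product] at hq
    exact mul_ne_zero (hL _ hq.1) (hL _ hq.2)
  have hsumY : ∑ π ∈ I, (Y π).card = L.card ^ 2 := by
    rw [sq, ← Finset.card_product, Finset.card_eq_sum_card_fiberwise
      (f := fun q : (F × F) × F × F => q.1.1 * q.2.1) (s := L ×ˢ L) (t := I)
      fun q hq => Finset.mem_image_of_mem _ hq]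
  have hfiber : quotEnergy L ≤ ∑ π ∈ I,
      (((Y π).image φ ×ˢ (Y π).image φ).filter fun q => Cross q.1 q.2).card := by
    unfold quotEnergy
    rw [Finset.card_eq_sum_card_fiberwise
      (f := fun q : ((F × F) × F × F) × (F × F) × F × F => q.1.1.1 * q.2.2.1) (t := I)
      (s := ((L ×ˢ L) ×ˢ L ×ˢ L).filter fun q => affQuot q.1 = affQuot q.2)
      fun q hq => by
        simp only [Finset.coe_filter, Finset.mem_product, Set.mem_ofPred_eq] at hq
        exact Finset.mem_image_of_mem (fun q : (F × F) × F × F => q.1.1 * q.2.1)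
          (Finset.mem_product.2 ⟨hq.1.1.1, hq.1.2.2⟩ : (q.1.1, q.2.2) ∈ L ×ˢ L)]
    refine Finset.sum_le_sum fun π hπ => ?_
    refine Finset.card_le_card_of_injOn (fun q => (φ (q.1.1, q.2.2), φ (q.2.1, q.1.2))) ?_ ?_
    · rintro ⟨⟨l₁, l₂⟩, l₃, l₄⟩ hq
      simp only [Finset.coe_filter, Finset.mem_product, Finset.mem_filter, Set.mem_ofPred_eq,
        affQuot, Prod.mk.injEq] at hq ⊢
      obtain ⟨⟨⟨⟨h3, h4⟩, h5, h6⟩, h7, h8⟩, h9⟩ := hq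
      rw [div_eq_div_iff (hL _ h3) (hL _ h5)] at h7 h8
      refine ⟨⟨Finset.mem_image_of_mem _ (Finset.mem_filter.2
        ⟨Finset.mem_product.2 ⟨h3, h6⟩, h9⟩), Finset.mem_image_of_mem _ (Finset.mem_filter.2
        ⟨Finset.mem_product.2 ⟨h5, h4⟩, by linear_combination h7 + h9⟩)⟩, ?_⟩
      simp only [Cross, hφ]
      linear_combination -h8
    · rintro ⟨⟨l₁, l₂⟩, l₃, l₄⟩ hq ⟨⟨m₁, m₂⟩, m₃, m₄⟩ hq' h
      simp only [Finset.coe_filter, Finset.mem_product, Finset.mem_filter, Set.mem_ofPred_eq,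
        affQuot, Prod.mk.injEq, hφ] at hq hq' h ⊢
      obtain ⟨⟨⟨⟨h3, h4⟩, h5, h6⟩, h7, -⟩, h9⟩ := hq
      obtain ⟨⟨⟨⟨g3, g4⟩, g5, g6⟩, g7, -⟩, g9⟩ := hq'
      rw [div_eq_div_iff (hL _ h3) (hL _ h5)] at h7
      rw [div_eq_div_iff (hL _ g3) (hL _ g5)] at g7
      obtain ⟨⟨e1, e2, e3⟩, e4, e5, e6⟩ := h
      have a1 := hL _ g3
      have a3 := hL _ g5
      rw [e1] at h7 h9 e3
      rw [e4] at h7 e6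
      refine ⟨⟨Prod.ext e1 e2, Prod.ext ?_ ?_⟩, Prod.ext e4 e5, Prod.ext ?_ ?_⟩
      · apply mul_right_cancel₀ a3
        linear_combination h7 - g7 + h9 - g9
      · exact mul_left_cancel₀ a3 (neg_injective e6)
      · exact mul_left_cancel₀ a1 (h9.trans g9.symm)
      · exact mul_left_cancel₀ a1 (neg_injective e3)
  have hterm : ∀ π ∈ I, ((((Y π).image φ ×ˢ (Y π).image φ).filter fun q => Cross q.1 q.2).card : ℝ) ≤
      √(10 ^ 6 * (M * L.card + M ^ 2)) * (Y π).card := by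
    intro π hπ
    have hc := Finset.card_image_le (s := Y π) (f := φ)
    have h := card_cross_pairs_sq_le (p := p) h2 _ hM1 (hline π (hI0 π hπ))
      (hc.trans ((hYc π).trans hX))
    have h3 := h.trans (show _ ≤ 10 ^ 6 * ((M * L.card + M ^ 2) * (Y π).card ^ 2) from by
      gcongr
      exact hc.trans (hYc π))
    have h4 : ((((Y π).image φ ×ˢ (Y π).image φ).filter fun q => Cross q.1 q.2).card : ℝ) ^ 2 ≤
        10 ^ 6 * ((M * L.card + M ^ 2) * (Y π).card ^ 2) := by exact_mod_cast h3
    refine abs_le_of_sq_le_sq' ?_ (by positivity) |>.2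
    rw [mul_pow, Real.sq_sqrt (by positivity)]
    linarith
  have h3 : (quotEnergy L : ℝ) ≤ √(10 ^ 6 * (M * L.card + M ^ 2)) * L.card ^ 2 := by
    calc (quotEnergy L : ℝ) ≤ ∑ π ∈ I,
          ((((Y π).image φ ×ˢ (Y π).image φ).filter fun q => Cross q.1 q.2).card : ℝ) := by
          exact_mod_cast hfiber
      _ ≤ ∑ π ∈ I, √(10 ^ 6 * (M * L.card + M ^ 2)) * (Y π).card := Finset.sum_le_sum hterm
      _ = √(10 ^ 6 * (M * L.card + M ^ 2)) * L.card ^ 2 := by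
          rw [← Finset.mul_sum]
          congr 1
          exact_mod_cast hsumY
  have h4 : (quotEnergy L : ℝ) ^ 2 ≤ 10 ^ 6 * ((M * L.card + M ^ 2) * L.card ^ 4) := by
    calc (quotEnergy L : ℝ) ^ 2 ≤ (√(10 ^ 6 * (M * L.card + M ^ 2)) * L.card ^ 2) ^ 2 := by
          gcongr
      _ = _ := by
          rw [mul_pow, Real.sq_sqrt (by positivity)]
          ring
  exact_mod_cast h4

end Energies

section RichLines

theorem sum_pow_le_of_tail_le {σ : Type*} (S : Finset σ) (i : σ → ℕ) {n q : ℕ} {Y : ℝ}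
    (hn : ∀ s ∈ S, i s ≤ n)
    (h : ∀ t : ℕ, 2 ≤ t → ((S.filter fun s => t ≤ i s).card : ℝ) * (t : ℝ) ^ q ≤ Y) :
    ∑ s ∈ S.filter (fun s => 2 ≤ i s), (i s : ℝ) ^ q ≤ 2 ^ q * Y * ((Nat.log 2 n : ℝ) + 1) := by
  have hY : 0 ≤ Y := le_trans (by positivity) (h 2 le_rfl)
  rw [← Finset.sum_fiberwise_of_maps_to (g := fun s => Nat.log 2 (i s))
    (t := Finset.range (Nat.log 2 n + 1)) fun s hs => Finset.mem_range.2
      (Nat.lt_succ_of_le (Nat.log_mono_right (hn s (Finset.mem_filter.1 hs).1)))]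
  have hconst : 2 ^ q * Y * ((Nat.log 2 n : ℝ) + 1) =
      ∑ _j ∈ Finset.range (Nat.log 2 n + 1), 2 ^ q * Y := by
    rw [Finset.sum_const, Finset.card_range, nsmul_eq_mul]
    push_cast
    ring
  rw [hconst]
  refine Finset.sum_le_sum fun j _ => ?_
  rcases Nat.eq_zero_or_pos j with rfl | hj
  · rw [Finset.sum_eq_zero]
    · positivity
    · intro s hs
      rw [Finset.mem_filter, Finset.mem_filter] at hs
      have := Nat.log_pos one_lt_two hs.1.2
      omega
  · calc ∑ s ∈ (S.filter fun s => 2 ≤ i s).filter (fun s => Nat.log 2 (i s) = j), (i s : ℝ) ^ q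
        ≤ ((S.filter fun s => 2 ≤ i s).filter fun s => Nat.log 2 (i s) = j).card •
            (2 * (2 : ℝ) ^ j) ^ q := by
          refine Finset.sum_le_card_nsmul _ _ _ fun s hs => ?_
          have h1 := Nat.lt_pow_succ_log_self one_lt_two (i s)
          rw [(Finset.mem_filter.1 hs).2, pow_succ'] at h1
          gcongr
          exact_mod_cast h1.le
      _ ≤ (S.filter fun s => 2 ^ j ≤ i s).card • (2 * (2 : ℝ) ^ j) ^ q := by
          refine nsmul_le_nsmul_left (by positivity) (Finset.card_le_card fun s hs => ?_)
          rw [Finset.mem_filter, Finset.mem_filter] at hs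
          refine Finset.mem_filter.2 ⟨hs.1.1, ?_⟩
          rw [← hs.2]
          exact Nat.pow_log_le_self 2 (by omega)
      _ = 2 ^ q * (((S.filter fun s => 2 ^ j ≤ i s).card : ℝ) * ((2 ^ j : ℕ) : ℝ) ^ q) := by
          rw [nsmul_eq_mul, mul_pow]
          push_cast
          ring
      _ ≤ 2 ^ q * Y := by
          gcongr
          exact h (2 ^ j) (by
            calc 2 = 2 ^ 1 := rfl
              _ ≤ 2 ^ j := Nat.pow_le_pow_right two_pos hj)

variable {F : Type*} [Field F]

theorem nPts_le_card (A : Finset F) (l : F × F) : nPts A A l ≤ A.card := by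
  rw [nPts_eq_card]
  exact Finset.card_le_card (Finset.filter_subset _ _)

theorem valueCoincidences_eq_sum (A : Finset F) (L : Finset (F × F)) (hL : ∀ l ∈ L, l.1 ≠ 0) :
    valueCoincidences A L = ∑ q ∈ L ×ˢ L, nPts A A (affQuot q) := by
  unfold valueCoincidences
  rw [Finset.card_eq_sum_card_fiberwise (f := fun q => (q.1.1, q.2.1)) (t := L ×ˢ L)
    (s := ((L ×ˢ A) ×ˢ L ×ˢ A).filter fun q =>
      q.1.1.1 * q.1.2 + q.1.1.2 = q.2.1.1 * q.2.2 + q.2.1.2) fun q hq => by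
      simp only [Finset.coe_filter, Finset.mem_product, Set.mem_ofPred_eq] at hq
      exact Finset.mem_product.2 ⟨hq.1.1.1, hq.1.2.1⟩]
  refine Finset.sum_congr rfl fun l hl => ?_
  rw [Finset.mem_product] at hl
  have hl0 := hL _ hl.1
  have hiff : ∀ x x' : F, l.1.1 * x + l.1.2 = l.2.1 * x' + l.2.2 ↔
      x = (affQuot l).1 * x' + (affQuot l).2 := by
    intro x x'
    unfold affQuot
    field_simp
    constructor <;> intro h <;> linear_combination h
  refine Finset.card_nbij' (fun q => (q.2.2, q.1.2)) (fun q => ((l.1, q.2), (l.2, q.1))) ?_ ?_ ?_ ?_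
  · rintro ⟨⟨l₁, x⟩, l₂, x'⟩ hq
    simp only [Finset.coe_filter, Finset.mem_filter, Finset.mem_product,
      Set.mem_ofPred_eq] at hq ⊢
    obtain ⟨⟨⟨⟨-, h3⟩, -, h4⟩, h5⟩, rfl⟩ := hq
    exact ⟨⟨h4, h3⟩, (hiff _ _).1 h5⟩
  · rintro ⟨x', x⟩ hq
    simp only [Finset.coe_filter, Finset.mem_filter, Finset.mem_product,
      Set.mem_ofPred_eq] at hq ⊢
    exact ⟨⟨⟨⟨hl.1, hq.1.2⟩, hl.2, hq.1.1⟩, (hiff _ _).2 hq.2⟩, trivial⟩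
  · rintro ⟨⟨l₁, x⟩, l₂, x'⟩ hq
    obtain rfl := (Finset.mem_filter.1 hq).2
    rfl
  · rintro ⟨x', x⟩ -
    rfl

variable [Fintype F]

/-- The non-horizontal, non-vertical lines containing at least `t` points of `A × A`. -/
noncomputable def rich (A : Finset F) (t : ℕ) : Finset (F × F) :=
  (Finset.univ.filter fun l : F × F => l.1 ≠ 0).filter fun l => t ≤ nPts A A l

theorem mem_rich {A : Finset F} {t : ℕ} {l : F × F} :
    l ∈ rich A t ↔ l.1 ≠ 0 ∧ t ≤ nPts A A l := by
  simp [rich]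

theorem card_rich_mul_pow_four_le {p : ℕ} [CharP F p] (hcard : Fintype.card F = p)
    (h2 : (2 : F) ≠ 0) (A : Finset F) (hA : A.card ^ 3 ≤ p ^ 2) {t : ℕ} (ht : 2 ≤ t) :
    (rich A t).card * t ^ 4 ≤ 2 * 10 ^ 6 * A.card ^ 5 := by
  obtain ⟨E, hadd, hmul⟩ : ∃ E, addE F A A ≤ E ∧
      ∀ s : F, mulE F (A.image fun a => a - s) (A.image fun a => a - s) ≤ E := by
    refine ⟨addE F A A + ∑ s : F, mulE F (A.image fun a => a - s) (A.image fun a => a - s),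
      Nat.le_add_right _ _, fun s => ?_⟩
    exact (Finset.single_le_sum (f := fun s : F => mulE F (A.image fun a => a - s)
      (A.image fun a => a - s)) (fun _ _ => Nat.zero_le _) (Finset.mem_univ s)).trans
      (Nat.le_add_left _ _)
  have hpencil := card_pencil_le A ht (rich A t) (fun l hl => mem_rich.1 hl) hadd hmul
  have hrich : ∀ l ∈ rich A t, t ≤ nPts A A l := fun l hl => (mem_rich.1 hl).2
  have htriv := card_rich_mul_sq_le A ht _ hrich
  have hV := card_rich_sq_le_valueCoincidences A _ hrich
  have hlarge := card_rich_mul_sq_le_of_large A (rich A t) hrich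
  have htn : 0 < (rich A t).card → t ≤ A.card := fun h => by
    obtain ⟨l, hl⟩ := Finset.card_pos.1 h
    exact (hrich l hl).trans (nPts_le_card A l)
  have hval := fun k h3 h4 h5 => valueCoincidences_sq_le (p := p) h2 A (rich A t) (k := k) h3 h4 h5
  rw [hcard] at hlarge
  generalize valueCoincidences A (rich A t) = V at *
  set n := A.card
  set N := (rich A t).card
  rcases Nat.eq_zero_or_pos N with h0 | hNpos
  · simp [h0]
  have htn := htn hNpos
  have hnpos : 0 < n := by omega
  rcases le_or_gt (n * N) (p ^ 2) with hX | hX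
  · have hk := hval (2 * n ^ 2 / t) (by rw [Nat.one_le_div_iff (by omega)]; nlinarith)
      (by rw [Nat.le_div_iff_mul_le (by omega)]; nlinarith)
      (fun P w => by
        rw [Nat.le_div_iff_mul_le (by omega)]
        exact (hpencil P w).1) hX
    have hkt : 2 * n ^ 2 / t * t ≤ 2 * n ^ 2 := Nat.div_mul_le_self _ _
    generalize 2 * n ^ 2 / t = k at hk hkt
    have h3 : N ^ 2 * t ^ 4 ≤ 10 ^ 6 * (n ^ 4 * (n * N + k ^ 2)) := by
      have h4 : N ^ 2 * (N ^ 2 * t ^ 4) ≤ N ^ 2 * (10 ^ 6 * (n ^ 4 * (n * N + k ^ 2))) := by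
        calc N ^ 2 * (N ^ 2 * t ^ 4) = ((N * t) ^ 2) ^ 2 := by ring
          _ ≤ (n * V) ^ 2 := Nat.pow_le_pow_left hV 2
          _ = n ^ 2 * V ^ 2 := by ring
          _ ≤ n ^ 2 * (10 ^ 6 * ((n * N + k ^ 2) * (n * N) ^ 2)) := Nat.mul_le_mul_left _ hk
          _ = _ := by ring
      exact Nat.le_of_mul_le_mul_left h4 (by positivity)
    rcases le_total (k ^ 2) (n * N) with h5 | h5
    · refine Nat.le_of_mul_le_mul_left (?_ : N * (N * t ^ 4) ≤ N * (2 * 10 ^ 6 * n ^ 5)) hNpos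
      calc N * (N * t ^ 4) = N ^ 2 * t ^ 4 := by ring
        _ ≤ 10 ^ 6 * (n ^ 4 * (n * N + n * N)) := h3.trans (by gcongr)
        _ = _ := by ring
    · have h6 : (N * t ^ 3) ^ 2 ≤ (3000 * n ^ 4) ^ 2 := by
        calc (N * t ^ 3) ^ 2 = (N ^ 2 * t ^ 4) * t ^ 2 := by ring
          _ ≤ (10 ^ 6 * (n ^ 4 * (k ^ 2 + k ^ 2))) * t ^ 2 :=
            Nat.mul_le_mul_right _ (h3.trans (by gcongr))
          _ = 2 * 10 ^ 6 * n ^ 4 * (k * t) ^ 2 := by ring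
          _ ≤ 2 * 10 ^ 6 * n ^ 4 * (2 * n ^ 2) ^ 2 := by gcongr
          _ ≤ (3000 * n ^ 4) ^ 2 := by ring_nf; omega
      have h7 := (Nat.pow_le_pow_iff_left two_ne_zero).1 h6
      calc N * t ^ 4 = (N * t ^ 3) * t := by ring
        _ ≤ (3000 * n ^ 4) * n := Nat.mul_le_mul h7 htn
        _ = 3000 * n ^ 5 := by ring
        _ ≤ 2 * 10 ^ 6 * n ^ 5 := Nat.mul_le_mul_right _ (by norm_num)
  · rcases le_or_gt (2 * n ^ 2) (t * p) with h3 | h3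
    · have h4 := hlarge h3
      have h5 : N * (N * t ^ 4) ≤ N * (16 * n ^ 5) := by
        calc N * (N * t ^ 4) = (N * t ^ 2) ^ 2 := by ring
          _ ≤ (4 * (p * n ^ 2)) ^ 2 := Nat.pow_le_pow_left h4 2
          _ = 16 * n ^ 4 * p ^ 2 := by ring
          _ ≤ 16 * n ^ 4 * (n * N) := by gcongr
          _ = _ := by ring
      exact (Nat.le_of_mul_le_mul_left h5 hNpos).trans (Nat.mul_le_mul_right _ (by norm_num))
    · have h5 : n ^ 3 * (N * t ^ 4) ≤ n ^ 3 * (8 * n ^ 5) := by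
        calc n ^ 3 * (N * t ^ 4) ≤ p ^ 2 * (N * t ^ 4) := Nat.mul_le_mul_right _ hA
          _ = (N * t ^ 2) * (t * p) ^ 2 := by ring
          _ ≤ (2 * n ^ 4) * (2 * n ^ 2) ^ 2 :=
            Nat.mul_le_mul htriv (Nat.pow_le_pow_left h3.le 2)
          _ = _ := by ring
      exact (Nat.le_of_mul_le_mul_left h5 (by positivity)).trans
        (Nat.mul_le_mul_right _ (by norm_num))

theorem card_rich_pow_le_quotEnergy (A : Finset F) {t : ℕ} (ht : 2 * A.card ≤ t ^ 2) :
    (rich A t).card ^ 4 * t ^ 8 ≤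
      16 * A.card ^ 4 * (quotEnergy (rich A t) * ∑ l ∈ rich A 2, nPts A A l ^ 4) := by
  set L := rich A t with hLdef
  have hL : ∀ l ∈ L, l.1 ≠ 0 := fun l hl => (mem_rich.1 hl).1
  have hV := card_rich_sq_le_valueCoincidences A L fun l hl => (mem_rich.1 hl).2
  rw [valueCoincidences_eq_sum A L hL] at hV
  set P := (L ×ˢ L).filter fun q => 2 ≤ nPts A A (affQuot q) with hP
  have hPc : P.card ≤ L.card ^ 2 := by
    rw [sq, ← Finset.card_product]
    exact Finset.card_le_card (Finset.filter_subset _ _)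
  have hsplit : ∑ q ∈ L ×ˢ L, nPts A A (affQuot q) ≤
      ∑ q ∈ P, nPts A A (affQuot q) + L.card ^ 2 := by
    rw [← Finset.sum_filter_add_sum_filter_not _ fun q => 2 ≤ nPts A A (affQuot q)]
    refine Nat.add_le_add_left ?_ _
    calc _ ≤ ((L ×ˢ L).filter fun q => ¬ 2 ≤ nPts A A (affQuot q)).card • 1 :=
          Finset.sum_le_card_nsmul _ _ _ fun q hq => by
            have := (Finset.mem_filter.1 hq).2
            omega
      _ ≤ L.card ^ 2 := by
          rw [smul_eq_mul, mul_one, sq, ← Finset.card_product]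
          exact Finset.card_le_card (Finset.filter_subset _ _)
  have hI : ∀ q ∈ P, affQuot q ∈ rich A 2 := by
    intro q hq
    obtain ⟨hq1, hq2⟩ := Finset.mem_filter.1 hq
    rw [Finset.mem_product] at hq1
    exact mem_rich.2 ⟨div_ne_zero (hL _ hq1.2) (hL _ hq1.1), hq2⟩
  have hsq : ∑ q ∈ P, nPts A A (affQuot q) ^ 2 =
      ∑ l ∈ rich A 2, (P.filter fun q => affQuot q = l).card * nPts A A l ^ 2 := by
    rw [← Finset.sum_fiberwise_of_maps_to hI]
    refine Finset.sum_congr rfl fun l _ => ?_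
    rw [← smul_eq_mul, ← Finset.sum_const]
    exact Finset.sum_congr rfl fun q hq => by rw [(Finset.mem_filter.1 hq).2]
  have hE : ∑ l ∈ rich A 2, (P.filter fun q => affQuot q = l).card ^ 2 ≤ quotEnergy L := by
    have h := card_coincidence P P affQuot affQuot hI
    simp only [← sq] at h
    calc _ = ((P ×ˢ P).filter fun q => affQuot q.1 = affQuot q.2).card := by
          convert h.symm
      _ ≤ quotEnergy L := by
          unfold quotEnergy
          refine Finset.card_le_card fun q hq => ?_
          rw [Finset.mem_filter, Finset.mem_product] at hq
          exact Finset.mem_filter.2 ⟨Finset.mem_product.2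
            ⟨(Finset.mem_filter.1 hq.1.1).1, (Finset.mem_filter.1 hq.1.2).1⟩, hq.2⟩
  have h4 : (∑ q ∈ P, nPts A A (affQuot q)) ^ 4 ≤
      L.card ^ 4 * (quotEnergy L * ∑ l ∈ rich A 2, nPts A A l ^ 4) := by
    calc (∑ q ∈ P, nPts A A (affQuot q)) ^ 4 = ((∑ q ∈ P, nPts A A (affQuot q)) ^ 2) ^ 2 := by ring
      _ ≤ (P.card * ∑ q ∈ P, nPts A A (affQuot q) ^ 2) ^ 2 :=
        Nat.pow_le_pow_left sq_sum_le_card_mul_sum_sq 2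
      _ ≤ (L.card ^ 2 * ∑ q ∈ P, nPts A A (affQuot q) ^ 2) ^ 2 := by gcongr
      _ = L.card ^ 4 * (∑ l ∈ rich A 2,
          (P.filter fun q => affQuot q = l).card * nPts A A l ^ 2) ^ 2 := by rw [hsq]; ring
      _ ≤ L.card ^ 4 * ((∑ l ∈ rich A 2, (P.filter fun q => affQuot q = l).card ^ 2) *
          ∑ l ∈ rich A 2, (nPts A A l ^ 2) ^ 2) := by
        gcongr
        exact Finset.sum_mul_sq_le_sq_mul_sq _ _ _
      _ ≤ _ := by
        simp only [← pow_mul]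
        gcongr
  set V := ∑ q ∈ P, nPts A A (affQuot q)
  rcases Nat.eq_zero_or_pos L.card with h0 | hpos
  · simp [h0]
  have h5 : (L.card * t) ^ 2 ≤ 2 * (A.card * V) := by
    have h6 : A.card * L.card ^ 2 * 2 ≤ (L.card * t) ^ 2 := by
      calc A.card * L.card ^ 2 * 2 = L.card ^ 2 * (2 * A.card) := by ring
        _ ≤ L.card ^ 2 * t ^ 2 := by gcongr
        _ = _ := by ring
    have h7 := hV.trans (Nat.mul_le_mul_left _ hsplit)
    rw [mul_add] at h7
    omega
  refine Nat.le_of_mul_le_mul_left (?_ : L.card ^ 4 * (L.card ^ 4 * t ^ 8) ≤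
    L.card ^ 4 * (16 * A.card ^ 4 * (quotEnergy L * ∑ l ∈ rich A 2, nPts A A l ^ 4)))
    (pow_pos hpos 4)
  calc L.card ^ 4 * (L.card ^ 4 * t ^ 8) = ((L.card * t) ^ 2) ^ 4 := by ring
    _ ≤ (2 * (A.card * V)) ^ 4 := Nat.pow_le_pow_left h5 4
    _ = 16 * A.card ^ 4 * V ^ 4 := by ring
    _ ≤ 16 * A.card ^ 4 * (L.card ^ 4 * (quotEnergy L * ∑ l ∈ rich A 2, nPts A A l ^ 4)) := by
      gcongr
    _ = _ := by ring

end RichLines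

section CollinearTuples

variable {F : Type*} [Field F] [Fintype F]

theorem Ctuples_succ_le (k : ℕ) (A : Finset F) :
    Ctuples F (k + 1) A A ≤
      2 * A.card ^ (k + 2) + ∑ l ∈ rich A 2, nPts A A l ^ (k + 1) := by
  have hsub : ((Fintype.piFinset fun _ : Fin (k + 1) => A ×ˢ A).filter
        fun f => Collinear F (Set.range f)) ⊆
      ((A.biUnion fun x => Fintype.piFinset fun _ : Fin (k + 1) => {x} ×ˢ A) ∪
        A.biUnion fun y => Fintype.piFinset fun _ : Fin (k + 1) => A ×ˢ {y}) ∪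
      (rich A 2).biUnion fun l => Fintype.piFinset fun _ : Fin (k + 1) =>
        (A ×ˢ A).filter fun q => q.2 = l.1 * q.1 + l.2 := by
    intro f hf
    obtain ⟨hf, hcol⟩ := Finset.mem_filter.1 hf
    simp only [Fintype.mem_piFinset, Finset.mem_product] at hf
    obtain ⟨v, hv⟩ := (collinear_iff_of_mem (Set.mem_range_self (f := f) 0)).1 hcol
    choose r hr using fun i => hv (f i) (Set.mem_range_self i)
    have h1 : ∀ i, (f i).1 = r i * v.1 + (f 0).1 := fun i => by
      simpa using congrArg Prod.fst (hr i)
    have h2 : ∀ i, (f i).2 = r i * v.2 + (f 0).2 := fun i => by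
      simpa using congrArg Prod.snd (hr i)
    simp only [Finset.mem_union, Finset.mem_biUnion, Fintype.mem_piFinset, Finset.mem_product,
      Finset.mem_singleton, Finset.mem_filter]
    by_cases hx : ∀ i, (f i).1 = (f 0).1
    · exact Or.inl (Or.inl ⟨(f 0).1, (hf 0).1, fun i => ⟨hx i, (hf i).2⟩⟩)
    by_cases hy : ∀ i, (f i).2 = (f 0).2
    · exact Or.inl (Or.inr ⟨(f 0).2, (hf 0).2, fun i => ⟨(hf i).1, hy i⟩⟩)
    push Not at hx hy
    obtain ⟨i, hi⟩ := hx
    obtain ⟨j, hj⟩ := hy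
    have hv1 : v.1 ≠ 0 := fun h => hi (by rw [h1 i, h]; ring)
    have hv2 : v.2 ≠ 0 := fun h => hj (by rw [h2 j, h]; ring)
    have hline : ∀ i, (f i).2 = v.2 / v.1 * (f i).1 + ((f 0).2 - v.2 / v.1 * (f 0).1) := by
      intro i
      rw [h1 i, h2 i]
      field_simp
      ring
    refine Or.inr ⟨(v.2 / v.1, (f 0).2 - v.2 / v.1 * (f 0).1),
      mem_rich.2 ⟨div_ne_zero hv2 hv1, ?_⟩, fun i => ⟨hf i, hline i⟩⟩
    refine Finset.one_lt_card.2 ⟨f i, ?_, f 0, ?_, fun h => hi (congrArg Prod.fst h)⟩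
    · exact Finset.mem_filter.2 ⟨Finset.mem_product.2 (hf i), hline i⟩
    · exact Finset.mem_filter.2 ⟨Finset.mem_product.2 (hf 0), hline 0⟩
  refine (Finset.card_le_card hsub).trans ((Finset.card_union_le _ _).trans
    (Nat.add_le_add ((Finset.card_union_le _ _).trans ?_) ?_))
  · rw [two_mul]
    refine Nat.add_le_add ?_ ?_ <;> refine Finset.card_biUnion_le.trans (le_of_eq ?_) <;>
      simp [Fintype.card_piFinset, ← pow_succ']
  · refine Finset.card_biUnion_le.trans (Finset.sum_le_sum fun l _ => ?_)
    simp [Fintype.card_piFinset, nPts]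

end CollinearTuples

section FifthMoment

theorem mul_pow_five_mul_le {N t G n y ℓ : ℝ} (hN : 0 ≤ N) (ht : 0 ≤ t) (hG : 0 ≤ G)
    (hn : 0 ≤ n) (hy1 : 1 ≤ y) (hℓ : 1 ≤ ℓ) (hGy : y ^ 6 * G ≤ 4 * n ^ 3) (hty : n ≤ t * y)
    (h : N ^ 4 * t ^ 20 ≤
      256 * 10 ^ 6 * (32 * 10 ^ 6) ^ 2 * n ^ 18 * ℓ ^ 2 * (G * t ^ 2 * N + G ^ 2)) :
    N * t ^ 5 * y ≤ 16 * 10 ^ 12 * ℓ * n ^ 6 := by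
  have hℓ0 : 0 ≤ ℓ := by linarith
  have hy : 0 ≤ y := by linarith
  rcases hn.eq_or_lt with rfl | hn0
  · have hNt : N ^ 4 * t ^ 20 ≤ 0 := by simpa using h
    have h0 : (N * t ^ 5) ^ 4 = 0 := le_antisymm (by linarith [mul_pow N (t ^ 5) 4, pow_mul t 5 4])
      (by positivity)
    rw [pow_eq_zero_iff (by norm_num)] at h0
    simp [h0]
  have ht0 : 0 < t := by
    rcases ht.eq_or_lt with rfl | ht0
    · linarith
    · exact ht0
  rcases hN.eq_or_lt with rfl | hN0
  · simp only [zero_mul]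
    positivity
  set K : ℝ := 256 * 10 ^ 6 * (32 * 10 ^ 6) ^ 2 with hK
  have hK0 : 0 < K := by positivity
  rcases le_total G (t ^ 2 * N) with hc | hc
  · have h1 : N ^ 3 * t ^ 18 ≤ 2 * K * n ^ 18 * ℓ ^ 2 * G := by
      refine le_of_mul_le_mul_left ?_ (by positivity : 0 < N * t ^ 2)
      calc N * t ^ 2 * (N ^ 3 * t ^ 18) = N ^ 4 * t ^ 20 := by ring
        _ ≤ K * n ^ 18 * ℓ ^ 2 * (G * t ^ 2 * N + G ^ 2) := h
        _ ≤ K * n ^ 18 * ℓ ^ 2 * (G * t ^ 2 * N + G * (t ^ 2 * N)) := by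
          rw [sq G]
          gcongr
        _ = _ := by ring
    have h2 : n ^ 3 * (N * t ^ 5 * y) ^ 3 ≤ n ^ 3 * (8 * K * n ^ 18 * ℓ ^ 2) := by
      calc n ^ 3 * (N * t ^ 5 * y) ^ 3 ≤ (t * y) ^ 3 * (N * t ^ 5 * y) ^ 3 := by gcongr
        _ = N ^ 3 * t ^ 18 * y ^ 6 := by ring
        _ ≤ 2 * K * n ^ 18 * ℓ ^ 2 * G * y ^ 6 := by gcongr
        _ = 2 * K * n ^ 18 * ℓ ^ 2 * (y ^ 6 * G) := by ring
        _ ≤ 2 * K * n ^ 18 * ℓ ^ 2 * (4 * n ^ 3) := by gcongr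
        _ = _ := by ring
    refine le_of_pow_le_pow_left₀ (n := 3) (by norm_num) (by positivity)
      ((le_of_mul_le_mul_left h2 (by positivity)).trans ?_)
    calc 8 * K * n ^ 18 * ℓ ^ 2 ≤ (16 * 10 ^ 12) ^ 3 * n ^ 18 * ℓ ^ 3 := by
          gcongr
          · rw [hK]
            norm_num
          · norm_num
      _ = _ := by ring
  · have h2 : (N * t ^ 5 * y) ^ 4 * y ^ 8 ≤ 32 * K * n ^ 24 * ℓ ^ 2 := by
      calc (N * t ^ 5 * y) ^ 4 * y ^ 8 = N ^ 4 * t ^ 20 * y ^ 12 := by ring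
        _ ≤ K * n ^ 18 * ℓ ^ 2 * (G * t ^ 2 * N + G ^ 2) * y ^ 12 := by gcongr
        _ ≤ K * n ^ 18 * ℓ ^ 2 * (G * G + G ^ 2) * y ^ 12 := by
          rw [mul_assoc G]
          gcongr
        _ = 2 * K * n ^ 18 * ℓ ^ 2 * (y ^ 6 * G) ^ 2 := by ring
        _ ≤ 2 * K * n ^ 18 * ℓ ^ 2 * (4 * n ^ 3) ^ 2 := by gcongr
        _ = _ := by ring
    have h3 : (N * t ^ 5 * y) ^ 4 * 1 ≤ (N * t ^ 5 * y) ^ 4 * y ^ 8 := by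
      gcongr
      exact one_le_pow₀ hy1
    rw [mul_one] at h3
    refine le_of_pow_le_pow_left₀ (n := 4) (by norm_num) (by positivity) ((h3.trans h2).trans ?_)
    calc 32 * K * n ^ 24 * ℓ ^ 2 ≤ (16 * 10 ^ 12) ^ 4 * n ^ 24 * ℓ ^ 4 := by
          gcongr
          · rw [hK]
            norm_num
          · norm_num
      _ = _ := by ring

theorem card_sq_le_addE {F : Type*} [Field F] (A : Finset F) : A.card ^ 2 ≤ addE F A A := by
  rw [sq, ← Finset.card_product]
  refine Finset.card_le_card_of_injOn (fun q => ((q.1, q.1), (q.2, q.2))) ?_ ?_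
  · intro q hq
    rw [Finset.mem_coe, Finset.mem_product] at hq
    simp [hq.1, hq.2]
  · rintro ⟨a, b⟩ - ⟨c, d⟩ - h
    simp only [Prod.mk.injEq] at h ⊢
    tauto

variable {F : Type*} [Field F] [Fintype F]

theorem mulE_le_mulEbar (A : Finset F) (s : F) :
    mulE F (A.image fun a => a - s) (A.image fun a => a - s) ≤ mulEbar F A :=
  le_ciSup (Set.finite_range fun s : F =>
    mulE F (A.image fun a => a - s) (A.image fun a => a - s)).bddAbove s

theorem sum_nPts_pow_four_le {p : ℕ} [CharP F p] (hcard : Fintype.card F = p)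
    (h2 : (2 : F) ≠ 0) (A : Finset F) (hA : A.card ^ 3 ≤ p ^ 2) :
    ∑ l ∈ rich A 2, (nPts A A l : ℝ) ^ 4 ≤
      32 * 10 ^ 6 * (A.card : ℝ) ^ 5 * ((Nat.log 2 A.card : ℝ) + 1) := by
  have h := sum_pow_le_of_tail_le (Finset.univ.filter fun l : F × F => l.1 ≠ 0) (nPts A A)
    (n := A.card) (q := 4) (Y := 2 * 10 ^ 6 * (A.card : ℝ) ^ 5) (fun l _ => nPts_le_card A l)
    fun t ht => by exact_mod_cast card_rich_mul_pow_four_le hcard h2 A hA ht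
  refine h.trans (le_of_eq (by ring))

theorem card_rich_mul_pow_five_le {p : ℕ} [CharP F p] (hcard : Fintype.card F = p)
    (h2 : (2 : F) ≠ 0) (A : Finset F) (hA : A.card ^ 3 ≤ p ^ 2) {E : ℕ} (hadd : addE F A A ≤ E)
    (hmul : ∀ s : F, mulE F (A.image fun a => a - s) (A.image fun a => a - s) ≤ E)
    {y : ℝ} (hy1 : 1 ≤ y) (hy : y ^ 6 * E ≤ (A.card : ℝ) ^ 3) {t : ℕ} (ht : 2 ≤ t) :
    ((rich A t).card : ℝ) * (t : ℝ) ^ 5 * y ≤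
      16 * 10 ^ 12 * ((Nat.log 2 A.card : ℝ) + 1) * (A.card : ℝ) ^ 6 := by
  have hN4 := card_rich_mul_pow_four_le hcard h2 A hA ht
  have hQ := sum_nPts_pow_four_le hcard h2 A hA
  have hℓ : (1 : ℝ) ≤ (Nat.log 2 A.card : ℝ) + 1 := by
    linarith [Nat.cast_nonneg (α := ℝ) (Nat.log 2 A.card)]
  set ℓ : ℝ := (Nat.log 2 A.card : ℝ) + 1
  set L := rich A t with hL
  set n := A.card with hn
  rcases L.eq_empty_or_nonempty with h0 | ⟨l₀, hl₀⟩
  · rw [h0, Finset.card_empty, Nat.cast_zero, zero_mul, zero_mul]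
    positivity
  have htn : t ≤ n := (mem_rich.1 hl₀).2.trans (nPts_le_card A l₀)
  have hn0 : (0 : ℝ) < n := by exact_mod_cast (by omega : 0 < n)
  have hyn : y ^ 6 ≤ n := by
    have h1 : (n : ℝ) ^ 2 ≤ E := by exact_mod_cast (card_sq_le_addE A).trans hadd
    have h3 : (n : ℝ) ^ 2 * y ^ 6 ≤ (n : ℝ) ^ 2 * n := by
      calc (n : ℝ) ^ 2 * y ^ 6 ≤ E * y ^ 6 := by gcongr
        _ ≤ (n : ℝ) ^ 3 := by linarith
        _ = _ := by ring
    exact le_of_mul_le_mul_left h3 (by positivity)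
  have hN4' : (L.card : ℝ) * (t : ℝ) ^ 4 ≤ 2 * 10 ^ 6 * (n : ℝ) ^ 5 := by exact_mod_cast hN4
  have htriv : (L.card : ℝ) * (t : ℝ) ^ 5 * y ≤ 2 * 10 ^ 6 * (n : ℝ) ^ 5 * (t * y) := by
    calc (L.card : ℝ) * (t : ℝ) ^ 5 * y = (L.card : ℝ) * (t : ℝ) ^ 4 * (t * y) := by ring
      _ ≤ _ := by gcongr
  have hfin : ∀ z : ℝ, z ≤ 8 * 10 ^ 6 → t * y ≤ n * z →
      (L.card : ℝ) * (t : ℝ) ^ 5 * y ≤ 16 * 10 ^ 12 * ℓ * (n : ℝ) ^ 6 := by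
    intro z hz hzt
    calc _ ≤ _ := htriv
      _ ≤ 2 * 10 ^ 6 * (n : ℝ) ^ 5 * (n * (8 * 10 ^ 6)) := by
        have : t * y ≤ n * (8 * 10 ^ 6) := hzt.trans (by gcongr)
        gcongr
      _ = 16 * 10 ^ 12 * 1 * (n : ℝ) ^ 6 := by ring
      _ ≤ _ := by gcongr
  rcases le_or_gt (t * y) n with hlt | hty
  · exact hfin 1 (by norm_num) (by linarith)
  rcases le_or_gt n (8 * 10 ^ 6) with hsmall | hlarge
  · refine hfin y ?_ (by gcongr)
    calc y ≤ y ^ 6 := le_self_pow₀ hy1 (by norm_num)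
      _ ≤ n := hyn
      _ ≤ 8 * 10 ^ 6 := by exact_mod_cast hsmall
  have ht2 : 2 * n ≤ t ^ 2 := by
    by_contra! hcon
    have hcon' : (t : ℝ) ^ 2 < 2 * n := by exact_mod_cast hcon
    have h3 : (n : ℝ) ^ 2 < n * (2 * y ^ 2) := by
      calc (n : ℝ) ^ 2 < (t * y) ^ 2 := by gcongr
        _ = (t : ℝ) ^ 2 * y ^ 2 := by ring
        _ ≤ 2 * n * y ^ 2 := by gcongr
        _ = _ := by ring
    have h4 : (n : ℝ) < 2 * y ^ 2 := by
      rw [sq] at h3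
      exact lt_of_mul_lt_mul_left h3 hn0.le
    have h5 : (n : ℝ) ^ 3 ≤ 8 * n := by
      calc (n : ℝ) ^ 3 ≤ (2 * y ^ 2) ^ 3 := by gcongr
        _ = 8 * y ^ 6 := by ring
        _ ≤ _ := by gcongr
    have h6 : (8 * 10 ^ 6 : ℝ) < n := by exact_mod_cast hlarge
    nlinarith
  have hpen := card_pencil_le A ht L (fun l hl => mem_rich.1 hl) hadd hmul
  set M := 4 * E / t ^ 2 with hM
  have htpos : 0 < t ^ 2 := by positivity
  have hpM := fun P w => (Nat.le_div_iff_mul_le htpos).2 (hpen P w).2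
  rw [← hM] at hpM
  have hM1 : 1 ≤ M := by
    refine le_trans (Finset.card_pos.2 ⟨l₀, ?_⟩) (hpM l₀ 0)
    simpa using hl₀
  have hMt : (M : ℝ) * (t : ℝ) ^ 2 ≤ 4 * E := by exact_mod_cast Nat.div_mul_le_self (4 * E) (t ^ 2)
  have hMN : M * L.card ≤ p ^ 2 := by
    refine le_trans ?_ hA
    have h3 : (M : ℝ) * L.card * n ^ 6 ≤ 8 * 10 ^ 6 * (n : ℝ) ^ 2 * n ^ 6 := by
      calc (M : ℝ) * L.card * n ^ 6 ≤ (M : ℝ) * L.card * (t * y) ^ 6 := by gcongr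
        _ = (M : ℝ) * (t : ℝ) ^ 2 * y ^ 6 * (L.card * (t : ℝ) ^ 4) := by ring
        _ ≤ 4 * E * y ^ 6 * (2 * 10 ^ 6 * (n : ℝ) ^ 5) := by gcongr
        _ = 8 * 10 ^ 6 * (y ^ 6 * E) * (n : ℝ) ^ 5 := by ring
        _ ≤ 8 * 10 ^ 6 * (n : ℝ) ^ 3 * (n : ℝ) ^ 5 := by gcongr
        _ = _ := by ring
    have h4 : (M : ℝ) * L.card ≤ 8 * 10 ^ 6 * (n : ℝ) ^ 2 :=
      le_of_mul_le_mul_right h3 (by positivity)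
    have h5 : M * L.card ≤ 8 * 10 ^ 6 * n ^ 2 := by exact_mod_cast h4
    calc _ ≤ _ := h5
      _ ≤ n * n ^ 2 := Nat.mul_le_mul_right _ hlarge.le
      _ = _ := by ring
  have hEn := quotEnergy_sq_le h2 L (fun l hl => (mem_rich.1 hl).1) hM1 hpM hMN
  have hpow := card_rich_pow_le_quotEnergy A ht2
  rw [← hL, ← hn] at hpow
  set e := quotEnergy L
  have hEn' : (e : ℝ) ^ 2 ≤ 10 ^ 6 * ((M * L.card + (M : ℝ) ^ 2) * (L.card : ℝ) ^ 4) := by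
    exact_mod_cast hEn
  have hpow' : (L.card : ℝ) ^ 4 * (t : ℝ) ^ 8 ≤
      16 * (n : ℝ) ^ 4 * (e * ∑ l ∈ rich A 2, (nPts A A l : ℝ) ^ 4) := by exact_mod_cast hpow
  have hLpos : (0 : ℝ) < L.card := by exact_mod_cast Finset.card_pos.2 ⟨l₀, hl₀⟩
  have hmain : (L.card : ℝ) ^ 4 * (t : ℝ) ^ 16 ≤ 256 * 10 ^ 6 * (32 * 10 ^ 6) ^ 2 * (n : ℝ) ^ 18 *
      ℓ ^ 2 * (M * L.card + (M : ℝ) ^ 2) := by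
    refine le_of_mul_le_mul_left ?_ (pow_pos hLpos 4)
    calc (L.card : ℝ) ^ 4 * ((L.card : ℝ) ^ 4 * (t : ℝ) ^ 16)
        = ((L.card : ℝ) ^ 4 * (t : ℝ) ^ 8) ^ 2 := by ring
      _ ≤ (16 * (n : ℝ) ^ 4 * (e * (32 * 10 ^ 6 * (n : ℝ) ^ 5 * ℓ))) ^ 2 := by
        refine pow_le_pow_left₀ (by positivity) (hpow'.trans ?_) 2
        gcongr
      _ = 256 * (32 * 10 ^ 6) ^ 2 * (n : ℝ) ^ 18 * ℓ ^ 2 * (e : ℝ) ^ 2 := by ring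
      _ ≤ 256 * (32 * 10 ^ 6) ^ 2 * (n : ℝ) ^ 18 * ℓ ^ 2 *
          (10 ^ 6 * ((M * L.card + (M : ℝ) ^ 2) * (L.card : ℝ) ^ 4)) := by gcongr
      _ = _ := by ring
  refine mul_pow_five_mul_le (G := 4 * E) (by positivity) (by positivity) (by positivity) hn0.le
    hy1 hℓ (by linarith) hty.le ?_
  calc (L.card : ℝ) ^ 4 * (t : ℝ) ^ 20 = (L.card : ℝ) ^ 4 * (t : ℝ) ^ 16 * (t : ℝ) ^ 4 := by ring
    _ ≤ 256 * 10 ^ 6 * (32 * 10 ^ 6) ^ 2 * (n : ℝ) ^ 18 *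
      ℓ ^ 2 * (M * L.card + (M : ℝ) ^ 2) * (t : ℝ) ^ 4 := by gcongr
    _ = 256 * 10 ^ 6 * (32 * 10 ^ 6) ^ 2 * (n : ℝ) ^ 18 * ℓ ^ 2 *
      ((M * (t : ℝ) ^ 2) * (t : ℝ) ^ 2 * L.card + (M * (t : ℝ) ^ 2) ^ 2) := by ring
    _ ≤ _ := by gcongr

theorem Ctuples_five_le {p : ℕ} [CharP F p] (hcard : Fintype.card F = p)
    (h2 : (2 : F) ≠ 0) (A : Finset F) (hA : A.card ^ 3 ≤ p ^ 2) {E : ℕ} (hadd : addE F A A ≤ E)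
    (hmul : ∀ s : F, mulE F (A.image fun a => a - s) (A.image fun a => a - s) ≤ E)
    {y : ℝ} (hy1 : 1 ≤ y) (hy : y ^ 6 * E ≤ (A.card : ℝ) ^ 3) :
    (Ctuples F 5 A A : ℝ) - 2 * (A.card : ℝ) ^ 6 ≤
      512 * 10 ^ 12 * ((A.card : ℝ) ^ 6 / y) * ((Nat.log 2 A.card : ℝ) + 1) ^ 2 := by
  have h := sum_pow_le_of_tail_le (Finset.univ.filter fun l : F × F => l.1 ≠ 0) (nPts A A)
    (n := A.card) (q := 5)
    (Y := 16 * 10 ^ 12 * ((Nat.log 2 A.card : ℝ) + 1) * (A.card : ℝ) ^ 6 / y)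
    (fun l _ => nPts_le_card A l)
    fun t ht => by
      rw [le_div_iff₀ (by linarith)]
      exact card_rich_mul_pow_five_le hcard h2 A hA hadd hmul hy1 hy ht
  have hC : (Ctuples F 5 A A : ℝ) ≤
      2 * (A.card : ℝ) ^ 6 + ∑ l ∈ rich A 2, (nPts A A l : ℝ) ^ 5 := by
    exact_mod_cast Ctuples_succ_le 4 A
  calc (Ctuples F 5 A A : ℝ) - 2 * (A.card : ℝ) ^ 6
      ≤ ∑ l ∈ rich A 2, (nPts A A l : ℝ) ^ 5 := by linarith
    _ ≤ _ := h
    _ = _ := by ring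

end FifthMoment

theorem stmt3 (c : ℝ) (hc : 0 < c) :
    ∃ C D : ℝ, 0 < C ∧ 0 < D ∧ ∀ (p : ℕ) [Fact p.Prime] (A : Finset (ZMod p)),
      (A.card : ℝ) ≤ (p : ℝ) ^ (2 / 3 : ℝ) →
      (addE (ZMod p) A A : ℝ) ≤ (A.card : ℝ) ^ (3 - c) →
      (mulEbar (ZMod p) A : ℝ) ≤ (A.card : ℝ) ^ (3 - c) →
      (Ctuples (ZMod p) 5 A A : ℝ) - 2 * (A.card : ℝ) ^ 6 ≤
        C * (A.card : ℝ) ^ (6 - c / 6) * Real.log A.card ^ (5 / 6 : ℝ) *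
          Real.log A.card ^ D := by
  refine ⟨512 * 10 ^ 12 * 9, 7 / 6, by norm_num, by norm_num, fun p _ A hA hadd hmul => ?_⟩
  rcases le_or_gt A.card 1 with hsmall | hlarge
  · have h1 : Ctuples (ZMod p) 5 A A ≤ (A.card * A.card) ^ 5 := by
      refine (Finset.card_filter_le _ _).trans (le_of_eq ?_)
      simp [Fintype.card_piFinset]
    have h2 : Real.log A.card = 0 := by
      rcases Nat.le_one_iff_eq_zero_or_eq_one.1 hsmall with h | h <;> simp [h]
    have h3 : (A.card * A.card) ^ 5 ≤ 2 * A.card ^ 6 := by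
      rcases Nat.le_one_iff_eq_zero_or_eq_one.1 hsmall with h | h <;> simp [h]
    have h4 : (Ctuples (ZMod p) 5 A A : ℝ) ≤ 2 * (A.card : ℝ) ^ 6 := by
      exact_mod_cast h1.trans h3
    rw [h2, Real.zero_rpow (by norm_num), Real.zero_rpow (by norm_num)]
    linarith
  have hn2 : (2 : ℝ) ≤ A.card := by exact_mod_cast hlarge
  have hn0 : (0 : ℝ) < A.card := by linarith
  have hA' : A.card ^ 3 ≤ p ^ 2 := by
    have h : (A.card : ℝ) ^ 3 ≤ (p : ℝ) ^ 2 := by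
      calc (A.card : ℝ) ^ 3 ≤ ((p : ℝ) ^ (2 / 3 : ℝ)) ^ 3 := by gcongr
        _ = (p : ℝ) ^ 2 := by
          rw [← Real.rpow_natCast, ← Real.rpow_mul p.cast_nonneg, ← Real.rpow_natCast]
          norm_num
    exact_mod_cast h
  have hp2 : 2 < p := by
    by_contra! hcon
    have h1 : 2 ^ 3 ≤ A.card ^ 3 := Nat.pow_le_pow_left hlarge 3
    have h2 : p ^ 2 ≤ 2 ^ 2 := Nat.pow_le_pow_left hcon 2
    omega
  have h2 : (2 : ZMod p) ≠ 0 := by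
    intro h
    have h' : ((2 : ℕ) : ZMod p) = 0 := by exact_mod_cast h
    exact absurd (Nat.le_of_dvd two_pos ((ZMod.natCast_eq_zero_iff 2 p).1 h')) (by omega)
  set y : ℝ := (A.card : ℝ) ^ (c / 6) with hy
  have hy1 : 1 ≤ y := Real.one_le_rpow (by linarith) (by positivity)
  have hy6 : y ^ 6 * ((max (addE (ZMod p) A A) (mulEbar (ZMod p) A) : ℕ) : ℝ) ≤
      (A.card : ℝ) ^ 3 := by
    calc y ^ 6 * ((max (addE (ZMod p) A A) (mulEbar (ZMod p) A) : ℕ) : ℝ)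
        ≤ y ^ 6 * (A.card : ℝ) ^ (3 - c) := by
          rw [Nat.cast_max]
          gcongr
          exact max_le hadd hmul
      _ = (A.card : ℝ) ^ 3 := by
          rw [hy, ← Real.rpow_natCast, ← Real.rpow_mul hn0.le, ← Real.rpow_add hn0,
            ← Real.rpow_natCast]
          congr 1
          push_cast
          ring
  have h := Ctuples_five_le (ZMod.card p) h2 A hA' (le_max_left _ _)
    (fun s => (mulE_le_mulEbar A s).trans (le_max_right _ _)) hy1 hy6
  have hlog0 : 0 < Real.log A.card := Real.log_pos (by linarith)
  have hℓ : (Nat.log 2 A.card : ℝ) + 1 ≤ 3 * Real.log A.card := by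
    have h3 : (Nat.log 2 A.card : ℝ) * Real.log 2 ≤ Real.log A.card := by
      rw [← Real.log_pow]
      exact Real.log_le_log (by positivity)
        (by exact_mod_cast Nat.pow_log_le_self 2 (by omega : A.card ≠ 0))
    have h4 : Real.log 2 ≤ Real.log A.card := Real.log_le_log two_pos hn2
    have h5 := Real.log_two_gt_d9
    nlinarith [Nat.cast_nonneg (α := ℝ) (Nat.log 2 A.card)]
  refine h.trans ?_
  have hpow : (A.card : ℝ) ^ (6 - c / 6) = (A.card : ℝ) ^ 6 / y := by
    rw [Real.rpow_sub hn0, hy]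
    norm_cast
  rw [hpow, mul_assoc (_ * _) (_ ^ _) (_ ^ _), ← Real.rpow_add hlog0]
  calc _ ≤ 512 * 10 ^ 12 * ((A.card : ℝ) ^ 6 / y) * (3 * Real.log A.card) ^ 2 := by gcongr
    _ = _ := by
      norm_num
      ring
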